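/- There is a positive constant a such that, with probability 1, for all n large enough the internal DLA cluster A(n) on the comb satisfies 𝒟(n − a·√(log n)) ⊆ A(n) ⊆ 𝒟(n + a·√(log n)). -/

import Mathlib

open MeasureTheory ENNReal
open scoped Pointwise

/-- Adjacency in the comb lattice `𝒞`. -/
def combAdj (z w : ℤ × ℤ) : Prop :=
  (z.1 = w.1 ∧ |z.2 - w.2| = 1) ∨ (z.2 = 0 ∧ w.2 = 0 ∧ |z.1 - w.1| = 1)

/-- Degree of a vertex in the comb. -/
def combDeg (z : ℤ × ℤ) : ℕ := if z.2 = 0 then 4 else 2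

open Classical in
/-- One-step transition probability of the simple random walk on the comb. -/
noncomputable def stepProb (z w : ℤ × ℤ) : ℝ≥0∞ :=
  if combAdj z w then ((combDeg z : ℝ≥0∞))⁻¹ else 0

/-- Probability that the walk started at `v` follows the given finite path. -/
noncomputable def pathProb (v : ℤ × ℤ) {n : ℕ} (path : Fin (n + 1) → ℤ × ℤ) : ℝ≥0∞ :=
  (if path 0 = v then 1 else 0) * ∏ i : Fin n, stepProb (path i.castSucc) (path i.succ)

/-- `S` is a simple random walk on the comb started at `v`, under the probability
measure `P` (characterized by its finite-dimensional distributions). -/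
def IsCombWalk {Ω : Type*} [MeasurableSpace Ω] (P : Measure Ω)
    (S : ℕ → Ω → ℤ × ℤ) (v : ℤ × ℤ) : Prop :=
  IsProbabilityMeasure P ∧ (∀ t, Measurable (S t)) ∧
    ∀ (n : ℕ) (path : Fin (n + 1) → ℤ × ℤ),
      P {ω | ∀ i : Fin (n + 1), S i ω = path i} = pathProb v path

/-- `W i`, `i : ℕ`, are i.i.d. simple random walks on the comb started at the origin. -/
def IsIIDCombWalks {Ω : Type*} [MeasurableSpace Ω] (P : Measure Ω)
    (W : ℕ → ℕ → Ω → ℤ × ℤ) : Prop :=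
  IsProbabilityMeasure P ∧ (∀ i t, Measurable (W i t)) ∧
    ∀ (k n : ℕ) (path : Fin k → Fin (n + 1) → ℤ × ℤ),
      P {ω | ∀ i : Fin k, ∀ t : Fin (n + 1), W i t ω = path i t} =
        ∏ i : Fin k, pathProb (0, 0) (path i)

/-- The domain `𝒟(ρ) = D(ρ) ∩ ℤ²`. -/
def combD (ρ : ℝ) : Set (ℤ × ℤ) :=
  {z | |(z.1 : ℝ)| < ρ ∧ |(z.2 : ℝ)| < (ρ - |(z.1 : ℝ)|) ^ 2 / 3}

/-- The boundary `∂𝒟(ρ)`: sites outside `𝒟(ρ)` at graph distance 1 from `𝒟(ρ)`. -/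
def combBoundary (ρ : ℝ) : Set (ℤ × ℤ) :=
  {z | z ∉ combD ρ ∧ ∃ w ∈ combD ρ, combAdj w z}

/-- Hitting time of a set by a trajectory (`⊤` if the set is never hit). -/
noncomputable def hitTime (Λ : Set (ℤ × ℤ)) (traj : ℕ → ℤ × ℤ) : ℕ∞ :=
  ⨅ (m : ℕ) (_ : traj m ∈ Λ), (m : ℕ∞)

/-- The trajectory exits `D` for the first time at the site `z`. -/
def exitsAt (D : Set (ℤ × ℤ)) (z : ℤ × ℤ) (traj : ℕ → ℤ × ℤ) : Prop :=
  ∃ n : ℕ, (∀ m < n, traj m ∈ D) ∧ traj n ∉ D ∧ traj n = z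

/-- Green's function of the walk `S` killed upon exiting `Λ`:
expected number of visits to `y` strictly before the exit time. -/
noncomputable def greenFn {Ω : Type*} [MeasurableSpace Ω] (P : Measure Ω)
    (S : ℕ → Ω → ℤ × ℤ) (Λ : Set (ℤ × ℤ)) (y : ℤ × ℤ) : ℝ≥0∞ :=
  ∑' n : ℕ, P {ω | (∀ m ≤ n, S m ω ∈ Λ) ∧ S n ω = y}

/-- The parent `𝒜(z)` of a vertex of the comb: its unique neighbor closer to the origin. -/
def parent (z : ℤ × ℤ) : ℤ × ℤ :=
  if z.2 = 0 then (z.1 - Int.sign z.1, 0) else (z.1, z.2 - Int.sign z.2)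

/-- First site outside `A` visited by the trajectory: the settlement site of an explorer. -/
noncomputable def settlePoint (A : Set (ℤ × ℤ)) (traj : ℕ → ℤ × ℤ) : ℤ × ℤ :=
  traj (sInf {n | traj n ∉ A})

/-- The internal DLA cluster after `k` explorers with trajectories `W 0, …, W (k-1)`. -/
noncomputable def dlaCluster (W : ℕ → ℕ → ℤ × ℤ) : ℕ → Set (ℤ × ℤ)
  | 0 => ∅
  | k + 1 => dlaCluster W k ∪ {settlePoint (dlaCluster W k) (W k)}

open Classical in
/-- Toppling at `x` for the divisible sandpile: the mass exceeding 1 at `x`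
is distributed equally among the neighbors of `x` in the comb. -/
noncomputable def topple (x : ℤ × ℤ) (μ : ℤ × ℤ → ℝ) : ℤ × ℤ → ℝ := fun z =>
  if μ x ≤ 1 then μ z
  else if z = x then 1
  else if combAdj x z then μ z + (μ x - 1) / (combDeg x : ℝ)
  else μ z

/-- Mass distribution of the divisible sandpile started with mass `mass` at the
origin, after `k` topplings along the sequence `seq`. -/
noncomputable def sandMass (seq : ℕ → ℤ × ℤ) (mass : ℝ) : ℕ → ℤ × ℤ → ℝ
  | 0 => fun z => if z = (0, 0) then mass else 0
  | k + 1 => topple (seq k) (sandMass seq mass k)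

/-- The odometer of the divisible sandpile: total mass emitted from `z`. -/
noncomputable def odometer (seq : ℕ → ℤ × ℤ) (mass : ℝ) (z : ℤ × ℤ) : ℝ :=
  ∑' k : ℕ, if seq k = z then max (sandMass seq mass k z - 1) 0 else 0

/-- The divisible sandpile cluster: sites which emitted positive mass. -/
def sandCluster (seq : ℕ → ℤ × ℤ) (mass : ℝ) : Set (ℤ × ℤ) :=
  {z | 0 < odometer seq mass z}

/-- Euclidean ball `𝔹(R)` of radius `R` in `ℤ²`. -/
def ballZ (R : ℝ) : Set (ℤ × ℤ) :=
  {z | Real.sqrt ((z.1 : ℝ) ^ 2 + (z.2 : ℝ) ^ 2) < R}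

/-- Smallest integer `≥ (ρ - x)²/3`. -/
noncomputable def Lrho (ρ : ℝ) (x : ℤ) : ℕ := ⌈(ρ - (x : ℝ)) ^ 2 / 3⌉₊

/-- Smallest integer `≥ (ρ - |x|)²/3`. -/
noncomputable def LrhoAbs (ρ : ℝ) (x : ℤ) : ℕ := ⌈(ρ - |(x : ℝ)|) ^ 2 / 3⌉₊


abbrev Z2 := ℤ × ℤ

/-- average of a real function over neighbors -/
noncomputable def cavg (G : Z2 → ℝ) (z : Z2) : ℝ :=
  if z.2 = 0 then (G (z.1+1,0) + G (z.1-1,0) + G (z.1,1) + G (z.1,-1))/4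
  else (G (z.1,z.2+1) + G (z.1,z.2-1))/2

lemma combAdj_iff_axis (x : ℤ) (w : Z2) :
    combAdj (x,0) w ↔ w ∈ ({(x+1,0),(x-1,0),(x,1),(x,-1)} : Finset Z2) := by
  obtain ⟨a,b⟩ := w
  simp only [combAdj, Finset.mem_insert, Finset.mem_singleton, Prod.mk.injEq]
  constructor
  · rintro (⟨h1,h2⟩|⟨h1,h2,h3⟩)
    · rcases (abs_eq (by norm_num)).1 h2 with h|h <;> omega
    · rcases (abs_eq (by norm_num)).1 h3 with h|h <;> omega
  · rintro (⟨h1,h2⟩|⟨h1,h2⟩|⟨h1,h2⟩|⟨h1,h2⟩) <;> subst h1 <;> subst h2 <;> simp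

lemma combAdj_iff_off (x y : ℤ) (hy : y ≠ 0) (w : Z2) :
    combAdj (x,y) w ↔ w ∈ ({(x,y+1),(x,y-1)} : Finset Z2) := by
  obtain ⟨a,b⟩ := w
  simp only [combAdj, Finset.mem_insert, Finset.mem_singleton, Prod.mk.injEq]
  constructor
  · rintro (⟨h1,h2⟩|⟨h1,h2,h3⟩)
    · rcases (abs_eq (by norm_num)).1 h2 with h|h <;> omega
    · omega
  · rintro (⟨h1,h2⟩|⟨h1,h2⟩) <;> subst h1 <;> subst h2 <;> simp

lemma tsum_step_axis (x : ℤ) (G : Z2 → ℝ≥0∞) :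
    ∑' w, stepProb (x,0) w * G w = 4⁻¹ * (G (x+1,0) + G (x-1,0) + G (x,1) + G (x,-1)) := by
  classical
  rw [tsum_eq_sum (s := ({(x+1,0),(x-1,0),(x,1),(x,-1)} : Finset Z2))]
  · have h : ∀ w ∈ ({(x+1,0),(x-1,0),(x,1),(x,-1)} : Finset Z2),
        stepProb (x,0) w * G w = 4⁻¹ * G w := by
      intro w hw
      rw [stepProb, if_pos ((combAdj_iff_axis x w).2 hw)]
      simp [combDeg]
    rw [Finset.sum_congr rfl h, ← Finset.mul_sum]
    congr 1
    rw [Finset.sum_insert, Finset.sum_insert, Finset.sum_insert, Finset.sum_singleton]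
    · ring
    all_goals simp
    omega
  · intro w hw
    rw [stepProb, if_neg (fun h => hw ((combAdj_iff_axis x w).1 h)), zero_mul]

lemma tsum_step_off (x y : ℤ) (hy : y ≠ 0) (G : Z2 → ℝ≥0∞) :
    ∑' w, stepProb (x,y) w * G w = 2⁻¹ * (G (x,y+1) + G (x,y-1)) := by
  classical
  rw [tsum_eq_sum (s := ({(x,y+1),(x,y-1)} : Finset Z2))]
  · have h : ∀ w ∈ ({(x,y+1),(x,y-1)} : Finset Z2),
        stepProb (x,y) w * G w = 2⁻¹ * G w := by
      intro w hw
      rw [stepProb, if_pos ((combAdj_iff_off x y hy w).2 hw)]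
      simp [combDeg, hy]
    rw [Finset.sum_congr rfl h, ← Finset.mul_sum]
    congr 1
    rw [Finset.sum_insert, Finset.sum_singleton]
    simp
    omega
  · intro w hw
    rw [stepProb, if_neg (fun h => hw ((combAdj_iff_off x y hy w).1 h)), zero_mul]

lemma tsum_step (z : Z2) (G : Z2 → ℝ) (hG : ∀ w, combAdj z w → 0 ≤ G w) :
    ∑' w, stepProb z w * ENNReal.ofReal (G w) = ENNReal.ofReal (cavg G z) := by
  obtain ⟨x,y⟩ := z
  by_cases hy : y = 0
  · subst hy
    have h := fun w hw => hG w ((combAdj_iff_axis x w).2 hw)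
    simp only [Finset.mem_insert, Finset.mem_singleton, forall_eq_or_imp, forall_eq] at h
    obtain ⟨h1,h2,h3,h4⟩ := h
    rw [tsum_step_axis, ← ENNReal.ofReal_add h1 h2, ← ENNReal.ofReal_add (by positivity) h3,
      ← ENNReal.ofReal_add (by positivity) h4, cavg, if_pos rfl, div_eq_inv_mul,
      ENNReal.ofReal_mul (by norm_num), ENNReal.ofReal_inv_of_pos (by norm_num)]
    simp
  · have h := fun w hw => hG w ((combAdj_iff_off x y hy w).2 hw)
    simp only [Finset.mem_insert, Finset.mem_singleton, forall_eq_or_imp, forall_eq] at h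
    obtain ⟨h1,h2⟩ := h
    rw [tsum_step_off x y hy, ← ENNReal.ofReal_add h1 h2, cavg, if_neg hy, div_eq_inv_mul,
      ENNReal.ofReal_mul (by norm_num), ENNReal.ofReal_inv_of_pos (by norm_num)]
    simp

section walk
variable {Ω : Type*} [MeasurableSpace Ω] {P : Measure Ω} {S : ℕ → Ω → Z2} {v : Z2}

lemma walk_lintegral (hS : IsCombWalk P S v) (n : ℕ) (F : (Fin (n+1) → Z2) → ℝ≥0∞) :
    ∫⁻ ω, F (fun i => S i ω) ∂P = ∑' q, F q * pathProb v q := by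
  obtain ⟨hP, hm, hp⟩ := hS
  have hX : Measurable (fun ω => (fun i : Fin (n+1) => S i ω)) :=
    measurable_pi_lambda _ (fun i => hm _)
  rw [← lintegral_map (f := F) (measurable_of_countable _) hX, lintegral_countable']
  refine tsum_congr fun q => ?_
  rw [Measure.map_apply hX (measurableSet_singleton q), ← hp]
  congr 2
  ext ω
  simp [funext_iff]

lemma pathProb_snoc (n : ℕ) (q : Fin (n+1) → Z2) (w : Z2) :
    pathProb v (Fin.snoc q w : Fin (n+1+1) → Z2) = pathProb v q * stepProb (q (Fin.last n)) w := by
  unfold pathProb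
  rw [Fin.prod_univ_castSucc]
  have h0 : (Fin.snoc q w : Fin (n+1+1) → Z2) 0 = q 0 := by
    have := Fin.snoc_castSucc (α := fun _ => Z2) w q 0
    simp
  have h1 : ∀ i : Fin n, (Fin.snoc q w : Fin (n+1+1) → Z2) (i.castSucc).succ = q i.succ := by
    intro i
    have := Fin.snoc_castSucc (α := fun _ => Z2) w q i.succ
    rw [← this]; rfl
  have h2 : (Fin.snoc q w : Fin (n+1+1) → Z2) (Fin.last n).succ = w := by
    have := Fin.snoc_last (α := fun _ => Z2) w q
    simp
  rw [h0, h2, mul_assoc]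
  congr 2
  · refine Finset.prod_congr rfl fun i _ => ?_
    rw [h1, Fin.snoc_castSucc]
  · rw [Fin.snoc_castSucc]

lemma tsum_snoc (n : ℕ) (F : (Fin (n+1+1) → Z2) → ℝ≥0∞) :
    ∑' q, F q = ∑' q : Fin (n+1) → Z2, ∑' w, F (Fin.snoc q w) := by
  rw [← (Fin.snocEquiv (fun _ : Fin (n+1+1) => Z2)).tsum_eq F, ENNReal.tsum_prod', ENNReal.tsum_comm]
  rfl

/-- Markov step -/
lemma walk_step (hS : IsCombWalk P S v) (T : ℕ) (B : Set Z2) (G G' : Z2 → ℝ≥0∞)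
    (h : ∀ z ∈ B, ∑' w, stepProb z w * G w ≤ G' z) :
    ∫⁻ ω, {ω | ∀ i ≤ T, S i ω ∈ B}.indicator (fun ω => G (S (T+1) ω)) ω ∂P ≤
    ∫⁻ ω, {ω | ∀ i ≤ T, S i ω ∈ B}.indicator (fun ω => G' (S T ω)) ω ∂P := by
  classical
  have e1 : ∀ ω, {ω | ∀ i ≤ T, S i ω ∈ B}.indicator (fun ω => G (S (T+1) ω)) ω =
      (fun q : Fin (T+1+1) → Z2 => if ∀ i : Fin (T+1), q i.castSucc ∈ B then G (q (Fin.last (T+1))) else 0)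
        (fun i => S i ω) := by
    intro ω
    rw [Set.indicator_apply]
    refine if_congr ?_ rfl rfl
    simp only [Set.mem_ofPred_eq, Fin.forall_iff, Fin.val_castSucc, Nat.lt_succ_iff]
  have e2 : ∀ ω, {ω | ∀ i ≤ T, S i ω ∈ B}.indicator (fun ω => G' (S T ω)) ω =
      (fun q : Fin (T+1) → Z2 => if ∀ i : Fin (T+1), q i ∈ B then G' (q (Fin.last T)) else 0)
        (fun i => S i ω) := by
    intro ω
    rw [Set.indicator_apply]
    refine if_congr ?_ rfl rfl
    simp only [Set.mem_ofPred_eq, Fin.forall_iff, Nat.lt_succ_iff]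
  rw [lintegral_congr e1, lintegral_congr e2]
  refine (walk_lintegral hS (T+1) (fun q : Fin (T+1+1) → Z2 => if ∀ i : Fin (T+1), q i.castSucc ∈ B then G (q (Fin.last (T+1))) else 0)).le.trans (le_trans ?_ (walk_lintegral hS T (fun q : Fin (T+1) → Z2 => if ∀ i : Fin (T+1), q i ∈ B then G' (q (Fin.last T)) else 0)).ge)
  rw [tsum_snoc]
  refine ENNReal.tsum_le_tsum fun q => ?_
  simp only [Fin.snoc_castSucc, Fin.snoc_last, pathProb_snoc]
  split_ifs with hq
  · calc ∑' w, G w * (pathProb v q * stepProb (q (Fin.last T)) w)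
        = ∑' w, pathProb v q * (stepProb (q (Fin.last T)) w * G w) := by
          refine tsum_congr fun w => ?_
          ring
      _ = pathProb v q * ∑' w, (stepProb (q (Fin.last T)) w * G w) := ENNReal.tsum_mul_left
      _ ≤ pathProb v q * G' (q (Fin.last T)) := by gcongr; exact h _ (hq _)
      _ = _ := mul_comm _ _
  · simp

lemma walk_start (hS : IsCombWalk P S v) : ∀ᵐ ω ∂P, S 0 ω = v := by
  obtain ⟨hP, hm, hp⟩ := hS
  have := hp 0 (fun _ => v)
  simp [pathProb] at this
  rw [← prob_compl_eq_zero_iff] at this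
  · exact this
  · exact (hm 0) (measurableSet_singleton v)

lemma walk_adj (hS : IsCombWalk P S v) : ∀ᵐ ω ∂P, ∀ t, combAdj (S t ω) (S (t+1) ω) := by
  classical
  rw [ae_all_iff]
  intro T
  have hz : ∑' q : Fin (T+1+1) → Z2, (if combAdj (q (Fin.last T).castSucc) (q (Fin.last T).succ) then 0 else 1) * pathProb v q = 0 := by
    rw [ENNReal.tsum_eq_zero]
    intro q
    split_ifs with h
    · simp
    · rw [one_mul, pathProb, Fin.prod_univ_castSucc]
      rw [stepProb, if_neg h]
      simp
  have hz := (walk_lintegral hS (T+1) (fun q => if combAdj (q (Fin.last T).castSucc) (q (Fin.last T).succ) then 0 else 1)).trans hz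
  rw [lintegral_eq_zero_iff'] at hz
  · filter_upwards [hz] with ω hω
    by_contra hcon
    simp only [Fin.val_castSucc, Fin.val_last, Fin.val_succ, Pi.zero_apply] at hω
    rw [if_neg hcon] at hω
    exact one_ne_zero hω
  · have hX : Measurable (fun ω => (fun i : Fin (T+1+1) => S i ω)) :=
      measurable_pi_lambda _ (fun i => hS.2.1 _)
    exact ((measurable_of_countable (fun q : Fin (T+1+1) → Z2 => if combAdj (q (Fin.last T).castSucc) (q (Fin.last T).succ) then (0:ℝ≥0∞) else 1)).comp hX).aemeasurable

end walk


section walk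
variable {Ω : Type*} [MeasurableSpace Ω] {P : Measure Ω} {S : ℕ → Ω → Z2}

lemma meas_inB {S : ℕ → Ω → Z2} (hm : ∀ t, Measurable (S t)) (B : Set Z2) (T : ℕ) :
    MeasurableSet {ω | ∀ i ≤ T, S i ω ∈ B} := by
  have : {ω | ∀ i ≤ T, S i ω ∈ B} = ⋂ i, ⋂ (_ : i ≤ T), (S i) ⁻¹' B := by
    ext; simp
  rw [this]
  exact MeasurableSet.iInter fun i => MeasurableSet.iInter fun _ => (hm i) (Set.to_countable B).measurableSet

lemma walk_exit (hS : IsCombWalk P S (0,0)) (B : Finset Z2) :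
    ∀ᵐ ω ∂P, ∃ t, S t ω ∉ B := by
  have hP := hS.1
  -- bound on heights
  obtain ⟨M, hM⟩ : ∃ M : ℝ, ∀ z ∈ B, |(z.2:ℝ)| ≤ M := by
    obtain ⟨M, hM⟩ := (B.image (fun z => |(z.2:ℝ)|)).bddAbove
    exact ⟨M, fun z hz => hM (by simpa using ⟨z.1, z.2, hz, rfl⟩)⟩
  set K : ℝ := (|M|+1)^2 with hK
  set G : Z2 → ℝ := fun z => K - (z.2:ℝ)^2 with hG
  have hnb : ∀ z ∈ B, ∀ w, combAdj z w → 0 ≤ G w := by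
    intro z hz w hw
    have h1 : |(w.2:ℝ)| ≤ |M| + 1 := by
      have h2 : |(z.2 - w.2 : ℤ)| ≤ 1 := by
        rcases hw with ⟨_, h⟩ | ⟨h, h', _⟩
        · exact h.le
        · rw [h, h']; norm_num
      have h3 : |((z.2:ℝ) - w.2)| ≤ 1 := by exact_mod_cast h2
      have h4 := (hM z hz).trans (le_abs_self M)
      rw [abs_le] at *
      constructor <;> linarith [h3.1, h3.2, h4.1, h4.2]
    have : (w.2:ℝ)^2 ≤ (|M|+1)^2 := by
      rw [← sq_abs]; gcongr
    simp only [hG, hK]; linarith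
  have hnn : ∀ z ∈ B, 1 ≤ G z := by
    intro z hz
    have h4 := (hM z hz).trans (le_abs_self M)
    have : (z.2:ℝ)^2 ≤ |M|^2 := by
      rw [← sq_abs]; gcongr
    simp only [hG, hK]; nlinarith [abs_nonneg M]
  have hav : ∀ z ∈ B, cavg G z ≤ G z - 1/2 := by
    intro z hz
    simp only [cavg, hG]
    split_ifs with h
    · rw [h]; push_cast; linarith
    · push_cast; nlinarith
  have hst : ∀ z ∈ (B : Set Z2), ∑' w, stepProb z w * ENNReal.ofReal (G w) ≤ ENNReal.ofReal (G z - 1/2) := by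
    intro z hz
    rw [tsum_step z G (hnb z hz)]
    exact ENNReal.ofReal_le_ofReal (hav z hz)
  set I : ℕ → Set Ω := fun T => {ω | ∀ i ≤ T, S i ω ∈ (B : Set Z2)} with hI
  have hIm : ∀ T, MeasurableSet (I T) := fun T => meas_inB hS.2.1 _ T
  have hanti : ∀ T, I (T+1) ⊆ I T := fun T ω h i hi => h i (by omega)
  set g : ℕ → ℝ≥0∞ := fun T => ∫⁻ ω, (I T).indicator (fun ω => ENNReal.ofReal (G (S T ω))) ω ∂P with hg
  have hstep : ∀ T, g (T+1) + ENNReal.ofReal (1/2) * P (I T) ≤ g T := by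
    intro T
    have e : ENNReal.ofReal (1/2) * P (I T) = ∫⁻ ω, (I T).indicator (fun _ => ENNReal.ofReal (1/2)) ω ∂P := by
      rw [lintegral_indicator_const (hIm T)]
    calc g (T+1) + ENNReal.ofReal (1/2) * P (I T)
        ≤ (∫⁻ ω, (I T).indicator (fun ω => ENNReal.ofReal (G (S (T+1) ω))) ω ∂P) + ENNReal.ofReal (1/2) * P (I T) := by
          refine add_le_add (lintegral_mono fun ω => ?_) le_rfl
          exact Set.indicator_le_indicator_of_subset (hanti T) (fun _ => bot_le) _
      _ ≤ (∫⁻ ω, (I T).indicator (fun ω => ENNReal.ofReal (G (S T ω) - 1/2)) ω ∂P) + ENNReal.ofReal (1/2) * P (I T) := by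
          refine add_le_add ?_ le_rfl
          exact walk_step hS T B (fun w => ENNReal.ofReal (G w)) (fun w => ENNReal.ofReal (G w - 1/2)) hst
      _ = ∫⁻ ω, ((I T).indicator (fun ω => ENNReal.ofReal (G (S T ω) - 1/2)) ω + (I T).indicator (fun _ => ENNReal.ofReal (1/2)) ω) ∂P := by
          rw [e, lintegral_add_right _ (measurable_const.indicator (hIm T))]
      _ = g T := by
          refine lintegral_congr fun ω => ?_
          by_cases hω : ω ∈ I T
          · simp only [Set.indicator_of_mem hω]
            have := hnn _ (hω T le_rfl)
            rw [← ENNReal.ofReal_add (by linarith) (by norm_num)]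
            congr 1; ring
          · simp only [Set.indicator_of_notMem hω, add_zero]
  have hsum : ∀ T, g T + T * (ENNReal.ofReal (1/2) * P (⋂ T, I T)) ≤ g 0 := by
    intro T
    induction T with
    | zero => simp
    | succ T ih =>
      refine le_trans ?_ ih
      push_cast
      calc g (T+1) + (T+1) * (ENNReal.ofReal (1/2) * P (⋂ T, I T))
          = (g (T+1) + ENNReal.ofReal (1/2) * P (⋂ T, I T)) + T * (ENNReal.ofReal (1/2) * P (⋂ T, I T)) := by ring
        _ ≤ (g (T+1) + ENNReal.ofReal (1/2) * P (I T)) + T * (ENNReal.ofReal (1/2) * P (⋂ T, I T)) := by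
            gcongr; exact Set.iInter_subset _ _
        _ ≤ _ := by gcongr; exact hstep T
  have hg0 : g 0 ≠ ∞ := by
    have : g 0 ≤ ∫⁻ ω, ENNReal.ofReal K ∂P := by
      refine lintegral_mono fun ω => ?_
      refine (Set.indicator_le_self _ _ _).trans (ENNReal.ofReal_le_ofReal ?_)
      simp only [hG]; nlinarith [sq_nonneg ((S 0 ω).2 : ℝ)]
    refine ne_top_of_le_ne_top ?_ this
    simp
  have hzero : P (⋂ T, I T) = 0 := by
    by_contra hne
    have h1 : ENNReal.ofReal (1/2) * P (⋂ T, I T) ≠ 0 := mul_ne_zero (by simp) hne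
    obtain ⟨n, hn⟩ := ENNReal.exists_nat_mul_gt h1 hg0
    exact absurd ((le_add_self).trans (hsum n)) (not_le.2 hn)
  rw [ae_iff]
  refine measure_mono_null ?_ hzero
  intro ω hω
  simp only [not_exists, not_not, Set.mem_ofPred_eq] at hω
  simp only [Set.mem_iInter]
  intro T i _
  exact hω i

open Classical in
/-- walk stopped at exit from B -/
noncomputable def stopAt (B : Set Z2) (s : ℕ → Z2) : ℕ → Z2
  | 0 => s 0
  | T+1 => if ∀ i ≤ T, s i ∈ B then s (T+1) else stopAt B s T

lemma stopAt_in (B : Set Z2) (s : ℕ → Z2) (T : ℕ) (h : ∀ i ≤ T, s i ∈ B) : stopAt B s T = s T := by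
  cases T with
  | zero => rfl
  | succ T => rw [stopAt, if_pos (fun i hi => h i (by omega))]

lemma stopAt_eventually (B : Set Z2) (s : ℕ → Z2) (h : ∃ t, s t ∉ B) :
    ∀ T ≥ sInf {n | s n ∉ B}, stopAt B s T = settlePoint B s := by
  intro T hT
  have hmem : s (sInf {n | s n ∉ B}) ∉ B := Nat.sInf_mem (s := {n | s n ∉ B}) h
  have hlt : ∀ i < sInf {n | s n ∉ B}, s i ∈ B := fun i hi => by
    have := Nat.notMem_of_lt_sInf hi
    simpa using this
  induction T, hT using Nat.le_induction with
  | base =>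
    rw [settlePoint]
    generalize hk : sInf {n | s n ∉ B} = k at *
    cases k with
    | zero => rfl
    | succ k => rw [stopAt, if_pos (fun i hi => hlt i (by omega))]
  | succ T hT ih => rw [stopAt, if_neg, ih]; exact fun h => hmem (h _ hT)

lemma stopAt_meas {S : ℕ → Ω → Z2} (hm : ∀ t, Measurable (S t)) (B : Set Z2) (T : ℕ) :
    Measurable (fun ω => stopAt B (fun t => S t ω) T) := by
  induction T with
  | zero => exact hm 0
  | succ T ih => exact Measurable.ite (meas_inB hm B T) (hm _) ih

lemma settle_le (hS : IsCombWalk P S (0,0)) (B : Finset Z2) (G : Z2 → ℝ≥0∞)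
    (h : ∀ z ∈ B, ∑' w, stepProb z w * G w ≤ G z) :
    ∫⁻ ω, G (settlePoint B (fun t => S t ω)) ∂P ≤ G (0,0) := by
  have hP := hS.1
  have hstep : ∀ T, ∫⁻ ω, G (stopAt B (fun t => S t ω) T) ∂P ≤ G (0,0) := by
    intro T
    induction T with
    | zero =>
      simp only [stopAt]
      rw [lintegral_congr_ae (g := fun _ => G (0,0))]
      · simp
      · filter_upwards [walk_start hS] with ω hω
        rw [hω]
    | succ T ih =>
      refine le_trans ?_ ih
      have hI := meas_inB hS.2.1 (B : Set Z2) T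
      have hG : Measurable (fun ω => G (stopAt B (fun t => S t ω) T)) :=
        (measurable_of_countable G).comp (stopAt_meas hS.2.1 _ T)
      set I := {ω | ∀ i ≤ T, S i ω ∈ (B : Set Z2)}
      calc ∫⁻ ω, G (stopAt B (fun t => S t ω) (T+1)) ∂P
          = ∫⁻ ω, (I.indicator (fun ω => G (S (T+1) ω)) ω + Iᶜ.indicator (fun ω => G (stopAt B (fun t => S t ω) T)) ω) ∂P := by
            refine lintegral_congr fun ω => ?_
            by_cases hω : ω ∈ I
            · rw [Set.indicator_of_mem hω, Set.indicator_of_notMem (by simpa using hω), add_zero, stopAt, if_pos (show ∀ i ≤ T, S i ω ∈ (B : Set Z2) from hω)]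
            · rw [Set.indicator_of_notMem hω, Set.indicator_of_mem (by simpa using hω), zero_add, stopAt, if_neg (show ¬ ∀ i ≤ T, S i ω ∈ (B : Set Z2) from hω)]
        _ = ∫⁻ ω, I.indicator (fun ω => G (S (T+1) ω)) ω ∂P + ∫⁻ ω, Iᶜ.indicator (fun ω => G (stopAt B (fun t => S t ω) T)) ω ∂P :=
            lintegral_add_right _ (hG.indicator hI.compl)
        _ ≤ ∫⁻ ω, I.indicator (fun ω => G (S T ω)) ω ∂P + ∫⁻ ω, Iᶜ.indicator (fun ω => G (stopAt B (fun t => S t ω) T)) ω ∂P := by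
            refine add_le_add ?_ le_rfl
            exact walk_step hS T B G G h
        _ = ∫⁻ ω, (I.indicator (fun ω => G (S T ω)) ω + Iᶜ.indicator (fun ω => G (stopAt B (fun t => S t ω) T)) ω) ∂P :=
            (lintegral_add_right _ (hG.indicator hI.compl)).symm
        _ = ∫⁻ ω, G (stopAt B (fun t => S t ω) T) ∂P := by
            refine lintegral_congr fun ω => ?_
            by_cases hω : ω ∈ I
            · rw [Set.indicator_of_mem hω, Set.indicator_of_notMem (by simpa using hω), add_zero, stopAt_in _ _ _ hω]
            · rw [Set.indicator_of_notMem hω, Set.indicator_of_mem (by simpa using hω), zero_add]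
  calc ∫⁻ ω, G (settlePoint B (fun t => S t ω)) ∂P
      ≤ ∫⁻ ω, Filter.liminf (fun T => G (stopAt B (fun t => S t ω) T)) Filter.atTop ∂P := by
        refine lintegral_mono_ae ?_
        filter_upwards [walk_exit hS B] with ω hω
        refine Filter.le_liminf_of_le (by isBoundedDefault) ?_
        filter_upwards [Filter.eventually_ge_atTop (sInf {n | S n ω ∉ (B : Set Z2)})] with T hT
        rw [stopAt_eventually _ (fun t => S t ω) hω T hT]
    _ ≤ Filter.liminf (fun T => ∫⁻ ω, G (stopAt B (fun t => S t ω) T) ∂P) Filter.atTop :=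
        lintegral_liminf_le (fun T => (measurable_of_countable G).comp (stopAt_meas hS.2.1 _ T))
    _ ≤ G (0,0) := by
        refine Filter.liminf_le_of_le (by isBoundedDefault) ?_
        intro b hb
        obtain ⟨T, hT⟩ := hb.exists
        exact hT.trans (hstep T)

end walk


section iid
variable {Ω : Type*} [mΩ : MeasurableSpace Ω] {P : Measure Ω} {W : ℕ → ℕ → Ω → Z2}

/-- first k walks up to time n -/
def fstW (W : ℕ → ℕ → Ω → Z2) (k n : ℕ) (ω : Ω) : Fin k → Fin (n+1) → Z2 := fun i t => W i t ω
def sndW (W : ℕ → ℕ → Ω → Z2) (k n : ℕ) (ω : Ω) : Fin (n+1) → Z2 := fun t => W k t ω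

lemma fstW_meas (h : IsIIDCombWalks P W) (k n : ℕ) : Measurable (fstW W k n) :=
  measurable_pi_lambda _ fun i => measurable_pi_lambda _ fun t => h.2.1 _ _
lemma sndW_meas (h : IsIIDCombWalks P W) (k n : ℕ) : Measurable (sndW W k n) :=
  measurable_pi_lambda _ fun t => h.2.1 _ _

lemma fstW_prob (h : IsIIDCombWalks P W) (k n : ℕ) (p : Fin k → Fin (n+1) → Z2) :
    P (fstW W k n ⁻¹' {p}) = ∏ i, pathProb (0,0) (p i) := by
  rw [← h.2.2 k n p]
  congr 1
  ext ω
  simp [fstW, funext_iff]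

lemma joint_prob (h : IsIIDCombWalks P W) (k n : ℕ) (p : Fin k → Fin (n+1) → Z2) (q : Fin (n+1) → Z2) :
    P (fstW W k n ⁻¹' {p} ∩ sndW W k n ⁻¹' {q}) = P (fstW W k n ⁻¹' {p}) * pathProb (0,0) q := by
  have := h.2.2 (k+1) n (Fin.snoc p q)
  rw [Fin.prod_univ_castSucc] at this
  simp only [Fin.snoc_castSucc, Fin.snoc_last] at this
  rw [fstW_prob h, ← this]
  congr 1
  ext ω
  simp only [fstW, sndW, Set.mem_inter_iff, Set.mem_preimage, Set.mem_singleton_iff, funext_iff, Set.mem_ofPred_eq]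
  rw [Fin.forall_fin_succ' (P := fun i : Fin (k+1) => ∀ t : Fin (n+1), W i t ω = (Fin.snoc p q : Fin (k+1) → Fin (n+1) → Z2) i t)]
  simp only [Fin.snoc_castSucc, Fin.snoc_last, Fin.val_castSucc, Fin.val_last]

lemma sndW_prob (h : IsIIDCombWalks P W) (k n : ℕ) (q : Fin (n+1) → Z2) :
    P (sndW W k n ⁻¹' {q}) = pathProb (0,0) q := by
  have hP := h.1
  have h1 : ∑' p, P.restrict (sndW W k n ⁻¹' {q}) (fstW W k n ⁻¹' {p}) = P.restrict (sndW W k n ⁻¹' {q}) Set.univ := by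
    rw [← Set.preimage_univ (f := fstW W k n), ← Measure.map_apply (fstW_meas h k n) MeasurableSet.univ,
      ← Set.biUnion_of_singleton (Set.univ), measure_biUnion (Set.to_countable _) (by
        intro a _ b _ hab; simpa using hab) (fun _ _ => measurableSet_singleton _), tsum_univ (f := fun p => (Measure.map (fstW W k n) (P.restrict (sndW W k n ⁻¹' {q}))) {p})]
    refine tsum_congr fun p => ?_
    rw [Measure.map_apply (fstW_meas h k n) (measurableSet_singleton _)]
  have h2 : ∑' p, P (fstW W k n ⁻¹' {p}) = 1 := by
    rw [← measure_univ (μ := P), ← Set.preimage_univ (f := fstW W k n), ← Measure.map_apply (fstW_meas h k n) MeasurableSet.univ,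
      ← Set.biUnion_of_singleton (Set.univ), measure_biUnion (Set.to_countable _) (by
        intro a _ b _ hab; simpa using hab) (fun _ _ => measurableSet_singleton _), tsum_univ (f := fun p => (Measure.map (fstW W k n) P) {p})]
    refine tsum_congr fun p => ?_
    rw [Measure.map_apply (fstW_meas h k n) (measurableSet_singleton _)]
  rw [Measure.restrict_apply_univ] at h1
  rw [← h1]
  simp_rw [Measure.restrict_apply (fstW_meas h k n (measurableSet_singleton _)), joint_prob h]
  rw [ENNReal.tsum_mul_right, h2, one_mul]

lemma iid_walk (h : IsIIDCombWalks P W) (k : ℕ) : IsCombWalk P (W k) (0,0) := by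
  refine ⟨h.1, h.2.1 k, fun n q => ?_⟩
  rw [← sndW_prob h k n q]
  congr 1
  ext ω
  simp [sndW, funext_iff]

/-- sigma algebra of the first k walks -/
def FF (W : ℕ → ℕ → Ω → Z2) (k : ℕ) : MeasurableSpace Ω :=
  ⨆ n, MeasurableSpace.comap (fstW W k n) inferInstance
def GG (W : ℕ → ℕ → Ω → Z2) (k : ℕ) : MeasurableSpace Ω :=
  ⨆ n, MeasurableSpace.comap (sndW W k n) inferInstance

lemma comap_fst_mono (k : ℕ) : Monotone (fun n => MeasurableSpace.comap (fstW W k n) inferInstance) := by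
  intro n m hnm
  have : fstW W k n = (fun (p : Fin k → Fin (m+1) → Z2) i t => p i (Fin.castLE (by omega) t)) ∘ fstW W k m := by
    ext ω i t <;> simp [fstW]
  simp only
  rw [this, ← MeasurableSpace.comap_comp]
  exact MeasurableSpace.comap_mono (measurable_of_countable _).comap_le

lemma comap_snd_mono (k : ℕ) : Monotone (fun n => MeasurableSpace.comap (sndW W k n) inferInstance) := by
  intro n m hnm
  have : sndW W k n = (fun (p : Fin (m+1) → Z2) t => p (Fin.castLE (by omega) t)) ∘ sndW W k m := by
    ext ω t <;> simp [sndW]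
  simp only
  rw [this, ← MeasurableSpace.comap_comp]
  exact MeasurableSpace.comap_mono (measurable_of_countable _).comap_le

lemma FF_le (h : IsIIDCombWalks P W) (k : ℕ) : FF W k ≤ mΩ := iSup_le fun n => (fstW_meas h k n).comap_le
lemma GG_le (h : IsIIDCombWalks P W) (k : ℕ) : GG W k ≤ mΩ := iSup_le fun n => (sndW_meas h k n).comap_le

lemma indep_n (h : IsIIDCombWalks P W) (k n : ℕ) :
    ProbabilityTheory.IndepFun (fstW W k n) (sndW W k n) P := by
  have hP := h.1
  rw [ProbabilityTheory.indepFun_iff_map_prod_eq_prod_map_map (fstW_meas h k n).aemeasurable (sndW_meas h k n).aemeasurable]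
  refine Measure.ext_of_singleton fun ⟨p, q⟩ => ?_
  have hs : ({(p,q)} : Set ((Fin k → Fin (n+1) → Z2) × (Fin (n+1) → Z2))) = {p} ×ˢ {q} := by simp
  rw [hs, Measure.prod_prod, Measure.map_apply (fstW_meas h k n) (measurableSet_singleton _),
    Measure.map_apply (sndW_meas h k n) (measurableSet_singleton _), ← hs,
    Measure.map_apply ((fstW_meas h k n).prodMk (sndW_meas h k n)) (measurableSet_singleton _), sndW_prob h, ← joint_prob h]
  congr 1
  ext ω; simp

lemma indep_FG (h : IsIIDCombWalks P W) (k : ℕ) : ProbabilityTheory.Indep (FF W k) (GG W k) P := by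
  have hP := h.1
  refine ProbabilityTheory.indep_iSup_of_monotone (fun n => ?_) (fun n => (fstW_meas h k n).comap_le) (GG_le h k) (comap_fst_mono k)
  refine ProbabilityTheory.Indep.symm ?_
  refine ProbabilityTheory.indep_iSup_of_monotone (fun m => ?_) (fun n => (sndW_meas h k n).comap_le) ((fstW_meas h k n).comap_le) (comap_snd_mono k)
  refine ProbabilityTheory.Indep.symm ?_
  have := indep_n h k (max n m)
  rw [ProbabilityTheory.IndepFun_iff_Indep] at this
  exact ProbabilityTheory.indep_of_indep_of_le_right (ProbabilityTheory.indep_of_indep_of_le_left this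
    (comap_fst_mono k (le_max_left n m))) (comap_snd_mono k (le_max_right n m))

lemma FF_W (k i t : ℕ) (hi : i < k) : Measurable[FF W k] (W i t) := by
  have h1 : Measurable[FF W k] (fstW W k t) :=
    (comap_measurable (fstW W k t)).mono (le_iSup (fun n => MeasurableSpace.comap (fstW W k n) inferInstance) t) le_rfl
  have : W i t = (fun p : Fin k → Fin (t+1) → Z2 => p ⟨i,hi⟩ (Fin.last t)) ∘ fstW W k t := by
    ext ω <;> simp [fstW]
  rw [this]
  exact (measurable_of_countable _).comp h1

lemma GG_W (k t : ℕ) : Measurable[GG W k] (W k t) := by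
  have h1 : Measurable[GG W k] (sndW W k t) :=
    (comap_measurable (sndW W k t)).mono (le_iSup (fun n => MeasurableSpace.comap (sndW W k n) inferInstance) t) le_rfl
  have : W k t = (fun p : Fin (t+1) → Z2 => p (Fin.last t)) ∘ sndW W k t := by
    ext ω <;> simp [sndW]
  rw [this]
  exact (measurable_of_countable _).comp h1

end iid

/-- The cluster as a finset -/
noncomputable def clF (w : ℕ → ℕ → Z2) : ℕ → Finset Z2
  | 0 => ∅
  | k+1 => insert (settlePoint (clF w k) (w k)) (clF w k)

lemma clF_eq (w : ℕ → ℕ → Z2) (k : ℕ) : dlaCluster w k = (clF w k : Set Z2) := by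
  induction k with
  | zero => simp [dlaCluster, clF]
  | succ k ih => rw [dlaCluster, ih, clF]; simp [Set.union_comm]

instance : MeasurableSpace (Finset Z2) := ⊤
instance : MeasurableSingletonClass (Finset Z2) := ⟨fun _ => trivial⟩

lemma settle_meas {Ω : Type*} {m : MeasurableSpace Ω} {S : ℕ → Ω → Z2} (hm : ∀ t, Measurable (S t)) (B : Set Z2) :
    Measurable (fun ω => settlePoint B (fun t => S t ω)) := by
  have h1 : Measurable (fun ω => sInf {n | S n ω ∉ B}) := by
    refine measurable_to_countable' fun n => ?_
    have hmem : ∀ t, MeasurableSet {ω | S t ω ∉ B} := fun t => (hm t) (Set.to_countable Bᶜ).measurableSet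
    have : ((fun ω => sInf {n | S n ω ∉ B}) ⁻¹' {n}) =
      ({ω | S n ω ∉ B} ∩ ⋂ i, ⋂ (_ : i < n), {ω | S i ω ∉ B}ᶜ) ∪ (if n = 0 then ⋂ i, {ω | S i ω ∉ B}ᶜ else ∅) := by
      ext ω
      simp only [Set.mem_preimage, Set.mem_singleton_iff, Set.mem_union, Set.mem_inter_iff, Set.mem_iInter, Set.mem_compl_iff, Set.mem_ofPred_eq]
      constructor
      · rintro rfl
        by_cases hne : {n | S n ω ∉ B}.Nonempty
        · left
          exact ⟨Nat.sInf_mem hne, fun i hi => Nat.notMem_of_lt_sInf hi⟩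
        · right
          rw [Set.not_nonempty_iff_eq_empty] at hne
          rw [hne]
          simp only [Nat.sInf_empty, if_true, Set.mem_iInter, Set.mem_compl_iff]
          intro i hi
          have : i ∈ {n | S n ω ∉ B} := hi
          rw [hne] at this
          exact this
      · rintro (⟨h1, h2⟩ | h)
        · refine le_antisymm (Nat.sInf_le h1) ?_
          by_contra hlt
          push Not at hlt
          exact h2 _ hlt (Nat.sInf_mem (s := {n | S n ω ∉ B}) ⟨n, h1⟩)
        · split_ifs at h with hn
          · subst hn
            rw [Nat.sInf_eq_zero]
            right
            simp only [Set.mem_iInter, Set.mem_compl_iff] at h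
            ext i; simpa using h i
          · simp at h
    rw [this]
    refine MeasurableSet.union ((hmem n).inter (MeasurableSet.iInter fun i => MeasurableSet.iInter fun _ => (hmem i).compl)) ?_
    split_ifs
    · exact MeasurableSet.iInter fun i => (hmem i).compl
    · exact MeasurableSet.empty
  exact (measurable_from_prod_countable_left (f := fun p : Ω × ℕ => S p.2 p.1) (fun n => hm n)).comp (measurable_id.prodMk h1)

lemma clF_meas {Ω : Type*} {m : MeasurableSpace Ω} {W : ℕ → ℕ → Ω → Z2} (k : ℕ) (hm : ∀ i < k, ∀ t, Measurable (W i t)) :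
    Measurable (fun ω => clF (fun i t => W i t ω) k) := by
  induction k with
  | zero => exact measurable_const
  | succ k ih =>
    have h1 := ih (fun i hi => hm i (by omega))
    have h2 : Measurable (fun ω => (ω, clF (fun i t => W i t ω) k)) := Measurable.prodMk measurable_id h1
    have h3 : Measurable (fun p : Ω × Finset Z2 => insert (settlePoint p.2 (fun t => W k t p.1)) p.2) := by
      refine measurable_from_prod_countable_left (fun B => ?_)
      exact (measurable_of_countable (fun z : Z2 => insert z B)).comp (settle_meas (fun t => hm k (Nat.lt_succ_self k) t) (B : Set Z2))
    have h4 := h3.comp h2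
    simp only [Function.comp_def] at h4
    simp only [clF]
    exact h4


def PClosed (B : Finset Z2) : Prop := ∀ z ∈ B, z ≠ (0,0) → parent z ∈ B

lemma adj_parent {w y : Z2} (h : combAdj w y) : (w = parent y ∧ y ≠ (0,0)) ∨ (y = parent w ∧ w ≠ (0,0)) := by
  obtain ⟨a,b⟩ := w
  obtain ⟨c,d⟩ := y
  have key : ∀ t : ℤ, (0 < t ∧ Int.sign t = 1) ∨ (t = 0 ∧ Int.sign t = 0) ∨ (t < 0 ∧ Int.sign t = -1) := by
    intro t
    rcases lt_trichotomy t 0 with h|h|h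
    · right; right; exact ⟨h, Int.sign_eq_neg_one_of_neg h⟩
    · right; left; subst h; simp
    · left; exact ⟨h, Int.sign_eq_one_of_pos h⟩
  simp only [combAdj] at h
  simp only [parent, ne_eq, Prod.mk.injEq]
  rcases h with ⟨h1,h2⟩|⟨h1,h2,h3⟩
  · subst h1
    rcases (abs_eq (by norm_num)).1 h2 with h|h <;> rcases key b with hb|hb|hb <;> rcases key d with hd|hd|hd <;>
     grind
  · subst h1; subst h2
    simp only [if_true, Prod.mk.injEq]
    rcases (abs_eq (by norm_num)).1 h3 with h|h <;> rcases key a with hb|hb|hb <;> rcases key c with hd|hd|hd <;>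
    grind

/-- good trajectories -/
structure GoodW (w : ℕ → ℕ → Z2) : Prop where
  start : ∀ i, w i 0 = (0,0)
  adj : ∀ i t, combAdj (w i t) (w i (t+1))
  exits : ∀ i (B : Finset Z2), ∃ t, w i t ∉ B

lemma iid_good {Ω : Type*} [mΩ : MeasurableSpace Ω] {P : Measure Ω} {W : ℕ → ℕ → Ω → Z2} (h : IsIIDCombWalks P W) :
    ∀ᵐ ω ∂P, GoodW (fun i t => W i t ω) := by
  have h1 : ∀ᵐ ω ∂P, ∀ i, W i 0 ω = (0,0) := ae_all_iff.2 fun i => walk_start (iid_walk h i)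
  have h2 : ∀ᵐ ω ∂P, ∀ i, ∀ t, combAdj (W i t ω) (W i (t+1) ω) := ae_all_iff.2 fun i => walk_adj (iid_walk h i)
  have h3 : ∀ᵐ ω ∂P, ∀ i, ∀ B : Finset Z2, ∃ t, W i t ω ∉ B :=
    ae_all_iff.2 fun i => ae_all_iff.2 fun B => walk_exit (iid_walk h i) B
  filter_upwards [h1,h2,h3] with ω a b c
  exact ⟨a,b,c⟩

lemma settle_notMem {w : ℕ → ℕ → Z2} (h : GoodW w) (k : ℕ) (B : Finset Z2) : settlePoint B (w k) ∉ B := by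
  have := Nat.sInf_mem (s := {n | w k n ∉ (B : Set Z2)}) (h.exits k B)
  exact this

lemma clF_card {w : ℕ → ℕ → Z2} (h : GoodW w) (k : ℕ) : (clF w k).card = k := by
  induction k with
  | zero => rfl
  | succ k ih => rw [clF, Finset.card_insert_of_notMem (settle_notMem h k _), ih]

lemma clF_mono (w : ℕ → ℕ → Z2) {k l : ℕ} (hkl : k ≤ l) : clF w k ⊆ clF w l := by
  induction l, hkl using Nat.le_induction with
  | base => exact Finset.Subset.refl _
  | succ l _ ih => rw [clF]; exact ih.trans (Finset.subset_insert _ _)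

lemma clF_pclosed {w : ℕ → ℕ → Z2} (h : GoodW w) (k : ℕ) : PClosed (clF w k) := by
  induction k with
  | zero => intro z hz; simp [clF] at hz
  | succ k ih =>
    intro z hz hz0
    rw [clF, Finset.mem_insert] at hz
    rw [clF, Finset.mem_insert]
    right
    rcases hz with hz | hz
    · set B := clF w k
      have hnm := settle_notMem h k B
      rw [← hz] at hnm
      rw [settlePoint] at hz
      have hlt : ∀ i < sInf {n | w k n ∉ (B : Set Z2)}, w k i ∈ B := fun i hi => by
        have := Nat.notMem_of_lt_sInf hi
        simpa using this
      generalize hs : sInf {n | w k n ∉ (B : Set Z2)} = s at *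
      cases s with
      | zero => rw [h.start] at hz; exact absurd hz hz0
      | succ s =>
        have ha := h.adj k s
        rw [← hz] at ha
        have hb := hlt s (by omega)
        rcases adj_parent ha with ⟨h1, h2⟩ | ⟨h1, h2⟩
        · rw [← h1]; exact hb
        · exact absurd (h1 ▸ ih _ hb h2) hnm
    · exact ih z hz hz0

section master
variable {Ω : Type*} [mΩ : MeasurableSpace Ω] {P : Measure Ω} {W : ℕ → ℕ → Ω → Z2}

/-- random cluster -/
noncomputable def CL (W : ℕ → ℕ → Ω → Z2) (k : ℕ) (ω : Ω) : Finset Z2 := clF (fun i t => W i t ω) k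

lemma CL_meas (h : IsIIDCombWalks P W) (k : ℕ) : Measurable (CL W k) :=
  clF_meas k (fun i _ t => h.2.1 i t)

lemma CL_FF (k l : ℕ) (hkl : l ≤ k) : Measurable[FF W k] (CL W l) :=
  @clF_meas Ω (FF W k) W l (fun i hi t => FF_W k i t (by omega))

lemma hist_FF (Good : Finset Z2 → Prop) (k : ℕ) : MeasurableSet[FF W k] {ω | ∀ i < k, Good (CL W i ω)} := by
  have : {ω | ∀ i < k, Good (CL W i ω)} = ⋂ i, ⋂ (_ : i < k), CL W i ⁻¹' {B | Good B} := by ext; simp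
  rw [this]
  exact MeasurableSet.iInter fun i => MeasurableSet.iInter fun hi => CL_FF k i hi.le trivial

open Classical in
noncomputable def Psi (W : ℕ → ℕ → Ω → Z2) (Good : Finset Z2 → Prop) (φ : Z2 → ℝ) (k : ℕ) : Ω → ℝ≥0∞ :=
  {ω | ∀ i < k, Good (CL W i ω)}.indicator (fun ω => ∏ y ∈ CL W k ω, ENNReal.ofReal (φ y))

lemma Psi_FF (Good : Finset Z2 → Prop) (φ : Z2 → ℝ) (k : ℕ) : Measurable[FF W k] (Psi W Good φ k) := by
  refine Measurable.indicator ?_ (hist_FF Good k)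
  exact (measurable_from_top (f := fun B : Finset Z2 => ∏ y ∈ B, ENNReal.ofReal (φ y))).comp (CL_FF k k le_rfl)

lemma Psi_step (h : IsIIDCombWalks P W) (Good : Finset Z2 → Prop) (φ : Z2 → ℝ) (c : ℝ)
    (hG : ∀ B : Finset Z2, PClosed B → Good B → ∃ G : Z2 → ℝ, G (0,0) ≤ c ∧
      (∀ z ∈ B, cavg G z ≤ G z) ∧ (∀ z ∈ B, ∀ w, combAdj z w → 0 ≤ G w) ∧
      (∀ y, y ∉ B → φ y ≤ max (G y) 0)) (k : ℕ) :
    ∫⁻ ω, Psi W Good φ (k+1) ω ∂P ≤ ENNReal.ofReal c * ∫⁻ ω, Psi W Good φ k ω ∂P := by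
  classical
  have hP := h.1
  have hgood := iid_good h
  have hset : ∀ B : Finset Z2, MeasurableSet[FF W k] (CL W k ⁻¹' {B}) := fun B => CL_FF k k le_rfl trivial
  have hPs : ∀ k, Measurable (Psi W Good φ k) := fun k => (Psi_FF Good φ k).mono (FF_le h k) le_rfl
  have hdec : ∀ F : Ω → ℝ≥0∞, ∫⁻ ω, F ω ∂P = ∑' B : Finset Z2, ∫⁻ ω in CL W k ⁻¹' {B}, F ω ∂P := by
    intro F
    rw [← lintegral_iUnion (fun B => CL_meas h k trivial)]
    · have : (⋃ B, CL W k ⁻¹' {B}) = Set.univ := by ext; simp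
      rw [this, Measure.restrict_univ]
    · intro a b hab
      exact Disjoint.preimage _ (by simpa using hab)
  rw [hdec, hdec (Psi W Good φ k), ← ENNReal.tsum_mul_left]
  refine ENNReal.tsum_le_tsum fun B => ?_
  by_cases hB : PClosed B ∧ Good B
  · obtain ⟨G, hG0, hG1, hG2, hG3⟩ := hG B hB.1 hB.2
    have hs : ∫⁻ ω, ENNReal.ofReal (φ (settlePoint B (fun t => W k t ω))) ∂P ≤ ENNReal.ofReal c := by
      have h1 := settle_le (iid_walk h k) B (fun z => ENNReal.ofReal (G z)) (fun z hz => by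
        rw [tsum_step z G (hG2 z hz)]
        exact ENNReal.ofReal_le_ofReal (hG1 z hz))
      refine le_trans (lintegral_mono_ae ?_) (h1.trans (ENNReal.ofReal_le_ofReal hG0))
      filter_upwards [hgood] with ω hω
      have := ENNReal.ofReal_le_ofReal (hG3 _ (settle_notMem hω k B))
      rwa [ENNReal.ofReal_max, ENNReal.ofReal_zero, max_zero] at this
    calc ∫⁻ ω in CL W k ⁻¹' {B}, Psi W Good φ (k+1) ω ∂P
        = ∫⁻ ω, (CL W k ⁻¹' {B}).indicator (Psi W Good φ (k+1)) ω ∂P := (lintegral_indicator (CL_meas h k trivial) _).symm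
      _ ≤ ∫⁻ ω, (CL W k ⁻¹' {B}).indicator (Psi W Good φ k) ω * ENNReal.ofReal (φ (settlePoint B (fun t => W k t ω))) ∂P := by
          refine lintegral_mono_ae ?_
          filter_upwards [hgood] with ω hω
          by_cases hk : CL W k ω = B
          · rw [Set.indicator_of_mem (by exact hk), Set.indicator_of_mem (by exact hk)]
            simp only [Psi]
            by_cases hh : ∀ i < k + 1, Good (CL W i ω)
            · rw [Set.indicator_of_mem (by exact hh), Set.indicator_of_mem (by exact fun i hi => hh i (by omega))]
              have e : CL W (k+1) ω = insert (settlePoint B (fun t => W k t ω)) B := by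
                rw [CL, clF]; change insert (settlePoint (CL W k ω) _) (CL W k ω) = _
                rw [hk]
              rw [e, hk, Finset.prod_insert (settle_notMem hω k B), mul_comm]
            · rw [Set.indicator_of_notMem (by exact hh)]
              exact bot_le
          · rw [Set.indicator_of_notMem (by exact hk)]
            exact bot_le
      _ = (∫⁻ ω, (CL W k ⁻¹' {B}).indicator (Psi W Good φ k) ω ∂P) * ∫⁻ ω, ENNReal.ofReal (φ (settlePoint B (fun t => W k t ω))) ∂P := by
          refine ProbabilityTheory.lintegral_mul_eq_lintegral_mul_lintegral_of_independent_measurableSpace (FF_le h k) (GG_le h k) (indep_FG h k) ?_ ?_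
          · exact (Psi_FF Good φ k).indicator (hset B)
          · have := @settle_meas Ω (GG W k) (W k) (GG_W k) B
            exact (measurable_of_countable (fun z => ENNReal.ofReal (φ z))).comp this
      _ ≤ (∫⁻ ω, (CL W k ⁻¹' {B}).indicator (Psi W Good φ k) ω ∂P) * ENNReal.ofReal c := by gcongr
      _ = _ := by rw [lintegral_indicator (CL_meas h k trivial), mul_comm]
  · have : ∫⁻ ω in CL W k ⁻¹' {B}, Psi W Good φ (k+1) ω ∂P = 0 := by
      rw [← lintegral_indicator (CL_meas h k trivial), lintegral_eq_zero_iff ((hPs _).indicator (CL_meas h k trivial))]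
      filter_upwards [hgood] with ω hω
      by_cases hk : CL W k ω = B
      · rw [Set.indicator_of_mem (by exact hk), Psi, Set.indicator_of_notMem]
        · rfl
        · intro hh
          refine hB ⟨hk ▸ clF_pclosed hω k, hk ▸ hh k (by omega)⟩
      · rw [Set.indicator_of_notMem (by exact hk)]; rfl
    rw [this]
    exact bot_le

theorem master (h : IsIIDCombWalks P W) (Good : Finset Z2 → Prop) (φ : Z2 → ℝ) (c : ℝ) (hc : 0 < c)
    (hG : ∀ B : Finset Z2, PClosed B → Good B → ∃ G : Z2 → ℝ, G (0,0) ≤ c ∧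
      (∀ z ∈ B, cavg G z ≤ G z) ∧ (∀ z ∈ B, ∀ w, combAdj z w → 0 ≤ G w) ∧
      (∀ y, y ∉ B → φ y ≤ max (G y) 0)) (k : ℕ) (E : Finset Z2 → Prop) (ε : ℝ)
    (hφ : ∀ y, 0 ≤ φ y) (hε : 0 ≤ ε)
    (hE : ∀ B : Finset Z2, PClosed B → B.card = k → E B → c^k ≤ ε * ∏ y ∈ B, φ y) :
    P {ω | E (CL W k ω) ∧ ∀ i < k, Good (CL W i ω)} ≤ ENNReal.ofReal ε := by
  have hP := h.1
  have h1 : ∀ k, ∫⁻ ω, Psi W Good φ k ω ∂P ≤ ENNReal.ofReal (c^k) := by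
    intro k
    induction k with
    | zero => simp [Psi, CL, clF]
    | succ k ih =>
      refine (Psi_step h Good φ c hG k).trans ?_
      rw [pow_succ', ENNReal.ofReal_mul hc.le]
      gcongr
  set Ev := {ω | E (CL W k ω) ∧ ∀ i < k, Good (CL W i ω)} with hEv
  have hEm : MeasurableSet Ev := by
    refine MeasurableSet.inter (CL_meas h k (t := {B | E B}) trivial) (FF_le h k _ (hist_FF Good k))
  have h2 : ENNReal.ofReal (c^k) * P Ev ≤ ENNReal.ofReal ε * ENNReal.ofReal (c^k) := by
    calc ENNReal.ofReal (c^k) * P Ev = ∫⁻ ω, Ev.indicator (fun _ => ENNReal.ofReal (c^k)) ω ∂P := by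
          rw [lintegral_indicator_const hEm]
      _ ≤ ∫⁻ ω, ENNReal.ofReal ε * Psi W Good φ k ω ∂P := by
          refine lintegral_mono_ae ?_
          filter_upwards [iid_good h] with ω hω
          by_cases hw : ω ∈ Ev
          · rw [Set.indicator_of_mem hw, Psi, Set.indicator_of_mem (by exact hw.2), ← ENNReal.ofReal_prod_of_nonneg (fun y _ => hφ y),
              ← ENNReal.ofReal_mul hε]
            exact ENNReal.ofReal_le_ofReal (hE _ (clF_pclosed hω k) (clF_card hω k) hw.1)
          · rw [Set.indicator_of_notMem hw]; exact bot_le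
      _ = ENNReal.ofReal ε * ∫⁻ ω, Psi W Good φ k ω ∂P := lintegral_const_mul _ ((Psi_FF Good φ k).mono (FF_le h k) le_rfl)
      _ ≤ _ := by gcongr; exact h1 k
  rw [mul_comm] at h2
  refine (ENNReal.mul_le_mul_iff_left ?_ ?_).1 h2
  · have : 0 < c^k := by positivity
    simp [this]
  · simp
end master


/-- a reflection of the comb -/
structure IsCombRefl (σ : Z2 ≃ Z2) : Prop where
  adj : ∀ z w, combAdj (σ z) (σ w) ↔ combAdj z w
  ax : ∀ z, (σ z).2 = 0 ↔ z.2 = 0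
  zero : σ (0,0) = (0,0)

def flipX : Z2 ≃ Z2 := ⟨fun z => (-z.1, z.2), fun z => (-z.1, z.2), fun z => by simp, fun z => by simp⟩
def flipY : Z2 ≃ Z2 := ⟨fun z => (z.1, -z.2), fun z => (z.1, -z.2), fun z => by simp, fun z => by simp⟩

lemma flipX_refl : IsCombRefl flipX := by
  refine ⟨fun z w => ?_, fun z => by simp [flipX], by simp [flipX]⟩
  have : |(-z.1 + w.1)| = |z.1 - w.1| := by rw [← abs_neg]; congr 1; ring
  simp [flipX, combAdj, this]

lemma flipY_refl : IsCombRefl flipY := by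
  refine ⟨fun z w => ?_, fun z => by simp [flipY], by simp [flipY]⟩
  have : |(-z.2 + w.2)| = |z.2 - w.2| := by rw [← abs_neg]; congr 1; ring
  simp [flipY, combAdj, this]

lemma refl_trans {σ τ : Z2 ≃ Z2} (h : IsCombRefl σ) (h' : IsCombRefl τ) : IsCombRefl (σ.trans τ) :=
  ⟨fun z w => by simp [h'.adj, h.adj], fun z => by simp [h'.ax, h.ax], by simp [h.zero, h'.zero]⟩

lemma refl_path {σ : Z2 ≃ Z2} (h : IsCombRefl σ) {n : ℕ} (p : Fin (n+1) → Z2) :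
    pathProb (0,0) (fun i => σ.symm (p i)) = pathProb (0,0) p := by
  unfold pathProb
  congr 1
  · refine if_congr ?_ rfl rfl
    rw [Equiv.symm_apply_eq, h.zero]
  · refine Finset.prod_congr rfl fun i _ => ?_
    unfold stepProb
    classical
    refine if_congr ?_ ?_ rfl
    · rw [← h.adj]; simp
    · congr 2
      unfold combDeg
      refine if_congr ?_ rfl rfl
      rw [← h.ax]; simp

lemma refl_iid {Ω : Type*} [mΩ : MeasurableSpace Ω] {P : Measure Ω} {W : ℕ → ℕ → Ω → Z2} (hW : IsIIDCombWalks P W)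
    {σ : Z2 ≃ Z2} (h : IsCombRefl σ) : IsIIDCombWalks P (fun i t ω => σ (W i t ω)) := by
  refine ⟨hW.1, fun i t => (measurable_of_countable σ).comp (hW.2.1 i t), fun k n p => ?_⟩
  have := hW.2.2 k n (fun i t => σ.symm (p i t))
  simp_rw [refl_path h] at this
  rw [← this]
  congr 1
  ext ω
  simp [Equiv.eq_symm_apply]

lemma refl_CL {Ω : Type*} {W : ℕ → ℕ → Ω → Z2} (σ : Z2 ≃ Z2) (k : ℕ) (ω : Ω) :
    CL (fun i t ω => σ (W i t ω)) k ω = (CL W k ω).map σ.toEmbedding := by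
  unfold CL
  induction k with
  | zero => simp [clF]
  | succ k ih =>
    simp only [clF]
    rw [ih, Finset.map_insert]
    congr 1
    unfold settlePoint
    simp

lemma refl_CL_mem {Ω : Type*} {W : ℕ → ℕ → Ω → Z2} (σ : Z2 ≃ Z2) (k : ℕ) (ω : Ω) (z : Z2) :
    z ∈ CL (fun i t ω => σ (W i t ω)) k ω ↔ σ.symm z ∈ CL W k ω := by
  rw [refl_CL, Finset.mem_map_equiv]


noncomputable def aseq (n : ℕ) : ℕ → ℝ
  | 0 => (n:ℝ)^3
  | 1 => ((n:ℝ)+1)^3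
  | k+2 => (2 + 6/((n:ℝ)-k-1)^2) * aseq n (k+1) - aseq n k

lemma ptilde (s : ℝ) (hs : 1 ≤ s) :
    s^2+1 ≤ ((2+6/s^2) - (s^2+1)/((s+1)^2+1)) * ((s-1)^2+1) := by
  have h1 : 0 < s^2 := by positivity
  have h2 : 0 < (s+1)^2+1 := by positivity
  have e : ((2+6/s^2) - (s^2+1)/((s+1)^2+1)) * ((s-1)^2+1) - (s^2+1)
     = ((2*s^2+6)*(s^4+4) - (2*s^2+4)*(s^4+s^2)) / (s^2 * ((s+1)^2+1)) := by
    field_simp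
    ring
  have : 0 ≤ ((2*s^2+6)*(s^4+4) - (2*s^2+4)*(s^4+s^2)) / (s^2 * ((s+1)^2+1)) := by
    apply div_nonneg _ (by positivity)
    nlinarith [pow_pos (by linarith : 0 < s) 4]
  linarith

lemma aseq_growth (n : ℕ) : ∀ k : ℕ, k < n →
    0 < aseq n k ∧ aseq n k * (((n:ℝ)-k)^2+1) ≤ aseq n (k+1) * (((n:ℝ)-k-1)^2+1) := by
  intro k
  induction k with
  | zero =>
    intro hn
    have h1 : (1:ℝ) ≤ n := by exact_mod_cast hn
    refine ⟨by simp only [aseq]; positivity, ?_⟩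
    simp only [aseq, Nat.cast_zero, sub_zero]
    nlinarith [pow_pos (by linarith : (0:ℝ) < n) 2, pow_pos (by linarith : (0:ℝ) < n) 3, pow_pos (by linarith : (0:ℝ) < n) 4]
  | succ k ih =>
    intro hk
    obtain ⟨h1, h2⟩ := ih (by omega)
    have hs : (1:ℝ) ≤ (n:ℝ)-k-1 := by
      have : ((k+1+1:ℕ):ℝ) ≤ n := by exact_mod_cast hk
      push_cast at this; linarith
    have hpos : 0 < aseq n (k+1) := by
      have : 0 < aseq n k * (((n:ℝ)-k)^2+1) := by positivity
      by_contra hcon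
      push Not at hcon
      have : aseq n (k+1) * (((n:ℝ)-k-1)^2+1) ≤ 0 := mul_nonpos_of_nonpos_of_nonneg hcon (by positivity)
      linarith
    refine ⟨hpos, ?_⟩
    simp only [aseq]
    push_cast
    set s := (n:ℝ)-k-1 with hsd
    have e1 : (n:ℝ)-(k+1) = s := by rw [hsd]; ring
    have e2 : (n:ℝ)-(k+1)-1 = s-1 := by rw [hsd]; ring
    have e3 : (n:ℝ)-k = s+1 := by rw [hsd]; ring
    rw [e1]
    rw [e3] at h2
    have h3 : aseq n k ≤ aseq n (k+1) * ((s^2+1)/((s+1)^2+1)) := by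
      rw [← mul_div_assoc, le_div_iff₀ (by positivity)]; exact h2
    have h4 := ptilde s hs
    calc aseq n (k+1) * (s^2+1) ≤ aseq n (k+1) * (((2+6/s^2) - (s^2+1)/((s+1)^2+1)) * ((s-1)^2+1)) := by gcongr
      _ = ((2+6/s^2) * aseq n (k+1) - aseq n (k+1) * ((s^2+1)/((s+1)^2+1))) * ((s-1)^2+1) := by ring
      _ ≤ _ := by gcongr

structure Axis (n h : ℕ) (x0 : ℤ) (f : ℤ → ℝ) (κ : ℝ) : Prop where
  x0n : 0 ≤ x0
  hn : x0 + h = n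
  h1 : 1 ≤ h
  nn : ∀ x, 0 ≤ f x
  le1 : ∀ x, f x ≤ 1
  one : f x0 = 1
  zero : ∀ x : ℤ, (n:ℤ) ≤ |x| → f x = 0
  recu : ∀ x : ℤ, |x| < n → x ≠ x0 → f (x+1) + f (x-1) = (2 + 6/((n:ℝ)-|(x:ℝ)|)^2) * f x
  rec0 : f (x0+1) + f (x0-1) = 2 + 6/(h:ℝ)^2 - κ
  kap : 1/(h:ℝ) ≤ κ
  sq : ∀ x : ℤ, |x| < n → f x * (((n:ℝ)-|(x:ℝ)|)^2+1) ≤ (h:ℝ)^2+1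
  left : ∀ x : ℤ, x ≤ 0 → f x ≤ ((h:ℝ)^2+1)/((n:ℝ)^2+1)

lemma aseq_mono (n : ℕ) (k l : ℕ) (hkl : k ≤ l) (hl : l ≤ n) :
    aseq n k * (((n:ℝ)-k)^2+1) ≤ aseq n l * (((n:ℝ)-l)^2+1) := by
  induction l, hkl using Nat.le_induction with
  | base => exact le_rfl
  | succ l hkl ih =>
    refine (ih (by omega)).trans ?_
    have := (aseq_growth n l (by omega)).2
    push_cast
    rw [← sub_sub]; exact this

lemma aseq_pos (n : ℕ) (k : ℕ) (hk : k < n) : 0 < aseq n k := (aseq_growth n k hk).1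

lemma aseq_pos' (n : ℕ) (hn : 1 ≤ n) (k : ℕ) (hk : k ≤ n) : 0 < aseq n k := by
  have h1 := aseq_mono n 0 k (by omega) hk
  have h2 := aseq_pos n 0 (by omega)
  have : 0 < aseq n 0 * (((n:ℝ)-(0:ℕ))^2+1) := by positivity
  by_contra hcon
  push Not at hcon
  have : aseq n k * (((n:ℝ)-k)^2+1) ≤ 0 := mul_nonpos_of_nonpos_of_nonneg hcon (by positivity)
  linarith

lemma aseq_le (n : ℕ) (hn : 1 ≤ n) (k l : ℕ) (hkl : k ≤ l) (hl : l ≤ n) : aseq n k ≤ aseq n l := by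
  have h1 := aseq_mono n k l hkl hl
  have h2 := aseq_pos' n hn l hl
  have h3 : (k:ℝ) ≤ l := by exact_mod_cast hkl
  have h4 : (l:ℝ) ≤ n := by exact_mod_cast hl
  have h5 : aseq n l * (((n:ℝ)-l)^2+1) ≤ aseq n l * (((n:ℝ)-k)^2+1) := by
    gcongr
  exact le_of_mul_le_mul_right (h1.trans h5) (by positivity)

/-- unnormalized left solution -/
noncomputable def fU (n : ℕ) (x : ℤ) : ℝ := if x ≤ 0 then ((n:ℝ)+x)^3 else aseq n x.toNat

lemma fU_nat (n k : ℕ) : fU n k = aseq n k := by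
  unfold fU
  split_ifs with h
  · have : k = 0 := by omega
    subst this; simp [aseq]
  · simp

lemma cube_rec (s : ℝ) (hs : s ≠ 0) : (s+1)^3 + (s-1)^3 = (2+6/s^2)*s^3 := by
  field_simp; ring

lemma fU_rec (n : ℕ) (x : ℤ) (hx : -(n:ℤ) < x) (hx' : x < n) :
    fU n (x+1) + fU n (x-1) = (2 + 6/((n:ℝ)-|(x:ℝ)|)^2) * fU n x := by
  rcases lt_trichotomy x 0 with h | h | h
  · have hs : ((n:ℝ)+x) ≠ 0 := by
      have : (0:ℤ) < n + x := by omega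
      have : (0:ℝ) < n + x := by exact_mod_cast this
      exact this.ne'
    have hxr : (x:ℝ) < 0 := by exact_mod_cast h
    rw [abs_of_neg hxr]
    unfold fU
    rw [if_pos (by omega), if_pos (by omega), if_pos h.le]
    have := cube_rec _ hs
    push_cast
    rw [sub_neg_eq_add, ← this]; ring
  · subst h
    have hs : (n:ℝ) ≠ 0 := by
      have : n ≠ 0 := by omega
      exact_mod_cast this
    have := cube_rec _ hs
    simp only [fU, zero_add, zero_sub]
    norm_num [aseq]
    rw [← this]; ring
  · obtain ⟨k, rfl⟩ : ∃ k : ℕ, x = (k+1:ℕ) := ⟨(x-1).toNat, by omega⟩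
    have e1 : (((k+1:ℕ):ℤ)+1) = ((k+2:ℕ):ℤ) := by push_cast; ring
    have e2 : (((k+1:ℕ):ℤ)-1) = ((k:ℕ):ℤ) := by push_cast; ring
    rw [e1, e2, fU_nat, fU_nat, fU_nat]
    simp only [aseq]
    push_cast
    rw [abs_of_nonneg (by positivity), ← sub_sub]
    ring

lemma axis_exists (n h : ℕ) (x0 : ℤ) (hx0 : 0 ≤ x0) (hn : x0 + h = n) (h1 : 1 ≤ h) :
    ∃ f κ, Axis n h x0 f κ := by
  obtain ⟨k0, rfl⟩ : ∃ k : ℕ, x0 = k := ⟨x0.toNat, by omega⟩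
  have hn1 : 1 ≤ n := by omega
  have hnr : (n:ℝ) = k0 + h := by exact_mod_cast hn.symm
  have hh : (1:ℝ) ≤ h := by exact_mod_cast h1
  set A := aseq n k0 with hA
  have hApos : 0 < A := aseq_pos' n hn1 k0 (by omega)
  set f : ℤ → ℝ := fun x => if x ≤ k0 then (if -(n:ℤ) ≤ x then fU n x / A else 0) else
    (if x ≤ n then (((n:ℝ)-x)/h)^3 else 0) with hf
  have hfL : ∀ x : ℤ, x ≤ k0 → -(n:ℤ) ≤ x → f x = fU n x / A := fun x h h' => by
    simp only [hf]; rw [if_pos h, if_pos h']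
  have hfk : f k0 = 1 := by rw [hfL _ le_rfl (by omega), fU_nat, div_self hApos.ne']
  have hfR : ∀ x : ℤ, (k0:ℤ) ≤ x → x ≤ n → f x = (((n:ℝ)-x)/h)^3 := fun x h h' => by
    rcases eq_or_lt_of_le h with rfl | hlt
    · rw [hfk]; push_cast; rw [hnr]; field_simp; ring
    · simp only [hf]; rw [if_neg (by omega), if_pos h']
  have hA3 : (n:ℝ)^3 * ((n:ℝ)^2+1) ≤ A * ((h:ℝ)^2+1) := by
    have := aseq_mono n 0 k0 (by omega) (by omega)
    simp only [aseq, Nat.cast_zero, sub_zero] at this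
    rw [show (n:ℝ) - k0 = h by rw [hnr]; ring] at this
    exact this
  have hfUnn : ∀ x : ℤ, x ≤ k0 → -(n:ℤ) ≤ x → 0 ≤ fU n x ∧ fU n x ≤ A := by
    intro x hx hx'
    rcases le_or_gt x 0 with h | h
    · have h2 : (0:ℝ) ≤ n + x := by
        have : (0:ℤ) ≤ n + x := by omega
        exact_mod_cast this
      have h3 : (x:ℝ) ≤ 0 := by exact_mod_cast h
      unfold fU
      rw [if_pos h]
      refine ⟨by positivity, ?_⟩
      have h4 : ((n:ℝ)+x)^3 ≤ (n:ℝ)^3 := by gcongr; linarith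
      exact h4.trans (aseq_le n hn1 0 k0 (by omega) (by omega))
    · obtain ⟨k, rfl⟩ : ∃ k : ℕ, x = k := ⟨x.toNat, by omega⟩
      rw [fU_nat]
      exact ⟨(aseq_pos' n hn1 k (by omega)).le, aseq_le n hn1 k k0 (by omega) (by omega)⟩
  have hbounds : ∀ x, 0 ≤ f x ∧ f x ≤ 1 := by
    intro x
    simp only [hf]
    split_ifs with a b c
    · exact ⟨div_nonneg (hfUnn x a b).1 hApos.le, (div_le_one hApos).2 (hfUnn x a b).2⟩
    · simp
    · have h2 : (0:ℝ) ≤ ((n:ℝ)-x)/h := by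
        have : (x:ℝ) ≤ n := by exact_mod_cast c
        apply div_nonneg <;> linarith
      refine ⟨by positivity, pow_le_one₀ h2 ?_⟩
      rw [div_le_one (by linarith)]
      have : (k0:ℝ) ≤ x := by exact_mod_cast (by omega : (k0:ℤ) ≤ x)
      linarith
    · simp
  set κ := aseq n (k0+1) / A - (((h:ℝ)-1)/h)^3 with hκ
  refine ⟨f, κ, by omega, hn, h1, fun x => (hbounds x).1, fun x => (hbounds x).2, hfk, ?_, ?_, ?_, ?_, ?_, ?_⟩
  · intro x hx
    rcases le_abs.1 hx with h | h
    · rcases eq_or_lt_of_le h with h | h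
      · rw [hfR x (by omega) (by omega), ← h]; simp
      · simp only [hf]; rw [if_neg (by omega), if_neg (by omega)]
    · rcases eq_or_lt_of_le h with h | h
      · rw [hfL x (by omega) (by omega)]
        have : x = -(n:ℤ) := by omega
        subst this
        unfold fU; rw [if_pos (by omega)]; simp
      · simp only [hf]; rw [if_pos (by omega), if_neg (by omega)]
  · intro x hx hne
    rw [abs_lt] at hx
    rcases lt_or_gt_of_ne hne with h | h
    · rw [hfL _ (by omega) (by omega), hfL _ (by omega) (by omega), hfL _ (by omega) (by omega), ← add_div,
        fU_rec n x hx.1 hx.2]; ring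
    · rw [hfR _ (by omega) (by omega), hfR _ (by omega) (by omega), hfR _ (by omega) (by omega)]
      have hs : ((n:ℝ)-x) ≠ 0 := by
        have : (x:ℝ) < n := by exact_mod_cast hx.2
        intro h; linarith
      have hxr : (0:ℝ) < x := by exact_mod_cast (by omega : 0 < x)
      rw [abs_of_pos hxr, div_pow, div_pow, div_pow, mul_div_assoc', ← cube_rec _ hs]
      push_cast; ring
  · rw [hfR _ (by omega) (by omega), hfL _ (by omega) (by omega), hκ]
    have := fU_rec n k0 (by omega) (by omega)
    rw [fU_nat, show ((k0:ℤ)+1) = ((k0+1:ℕ):ℤ) by push_cast; ring, fU_nat] at this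
    have e : fU n ((k0:ℤ)-1) = (2+6/(h:ℝ)^2) * A - aseq n (k0+1) := by
      push_cast at this
      rw [abs_of_nonneg (by positivity), show (n:ℝ) - k0 = h by rw [hnr]; ring] at this
      linarith
    rw [e]; push_cast; rw [hnr]
    field_simp; ring
  · rw [hκ]
    have h2 : 1 ≤ aseq n (k0+1) / A := (one_le_div hApos).2 (aseq_le n hn1 k0 (k0+1) (by omega) (by omega))
    have h3 : (((h:ℝ)-1)/h)^3 ≤ ((h:ℝ)-1)/h := by
      have h4 : 0 ≤ ((h:ℝ)-1)/h := by apply div_nonneg <;> linarith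
      have h5 : ((h:ℝ)-1)/h ≤ 1 := (div_le_one (by linarith)).2 (by linarith)
      exact pow_le_of_le_one h4 h5 (by norm_num)
    have h6 : ((h:ℝ)-1)/h = 1 - 1/h := by field_simp
    linarith
  · intro x hx
    rw [abs_lt] at hx
    rcases le_or_gt x k0 with hk | hk
    · rcases le_or_gt x 0 with h0 | h0
      · have hx0 : (x:ℝ) ≤ 0 := by exact_mod_cast h0
        have hxn : (0:ℝ) ≤ n + x := by exact_mod_cast (by omega : 0 ≤ (n:ℤ) + x)
        rw [hfL x hk (by omega), abs_of_nonpos hx0, sub_neg_eq_add, div_mul_eq_mul_div, div_le_iff₀ hApos]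
        unfold fU; rw [if_pos h0]
        calc ((n:ℝ)+x)^3 * (((n:ℝ)+x)^2+1) ≤ (n:ℝ)^3 * ((n:ℝ)^2+1) := by gcongr <;> linarith
          _ ≤ _ := by linarith
      · obtain ⟨k, rfl⟩ : ∃ k : ℕ, x = k := ⟨x.toNat, by omega⟩
        rw [hfL _ hk (by omega), fU_nat]
        push_cast
        rw [abs_of_nonneg (by positivity), div_mul_eq_mul_div, div_le_iff₀ hApos]
        have := aseq_mono n k k0 (by omega) (by omega)
        rw [show (n:ℝ) - k0 = h by rw [hnr]; ring] at this
        linarith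
    · have hxr : (0:ℝ) < x := by exact_mod_cast (by omega : 0 < x)
      have hxk : (k0:ℝ) < x := by exact_mod_cast hk
      have hxn : (x:ℝ) < n := by exact_mod_cast hx.2
      rw [abs_of_pos hxr]
      have h2 : ((n:ℝ)-x)^2+1 ≤ (h:ℝ)^2+1 := by gcongr <;> linarith
      have := (hbounds x).2
      have h3 := (hbounds x).1
      nlinarith [sq_nonneg ((n:ℝ)-x)]
  · intro x hx
    have hx0 : (x:ℝ) ≤ 0 := by exact_mod_cast hx
    by_cases hxn : -(n:ℤ) ≤ x
    · have hxn' : (0:ℝ) ≤ n + x := by exact_mod_cast (by omega : 0 ≤ (n:ℤ) + x)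
      rw [hfL x (by omega) hxn, div_le_div_iff₀ hApos (by positivity)]
      unfold fU; rw [if_pos hx]
      calc ((n:ℝ)+x)^3 * ((n:ℝ)^2+1) ≤ (n:ℝ)^3 * ((n:ℝ)^2+1) := by gcongr; linarith
          _ ≤ _ := by linarith
    · simp only [hf]; rw [if_pos (by omega), if_neg hxn]; positivity


lemma tele (U F : ℤ → ℝ) (a b : ℤ) (hab : a ≤ b) (h : ∀ x, a ≤ x → x < b → F x = U (x+1) - U x) :
    ∑ x ∈ Finset.Ico a b, F x = U b - U a := by
  induction b, hab using Int.le_induction with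
  | base => simp
  | succ b hb ih =>
    have : Finset.Ico a (b+1) = insert b (Finset.Ico a b) := by ext; simp; omega
    rw [this, Finset.sum_insert (by simp), ih (fun x h1 h2 => h x h1 (by omega)), h b hb (by omega)]
    ring

lemma tele_le (U F : ℤ → ℝ) (a b : ℤ) (hab : a ≤ b) (h : ∀ x, a ≤ x → x < b → F x ≤ U (x+1) - U x) :
    ∑ x ∈ Finset.Ico a b, F x ≤ U b - U a := by
  rw [← tele U (fun x => U (x+1) - U x) a b hab (fun _ _ _ => rfl)]
  refine Finset.sum_le_sum fun x hx => ?_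
  rw [Finset.mem_Ico] at hx
  exact h x hx.1 hx.2

lemma sum_Ico_split (F : ℤ → ℝ) {a b c : ℤ} (hab : a ≤ b) (hbc : b ≤ c) :
    ∑ x ∈ Finset.Ico a c, F x = ∑ x ∈ Finset.Ico a b, F x + ∑ x ∈ Finset.Ico b c, F x := by
  rw [← Finset.Ico_union_Ico_eq_Ico hab hbc, Finset.sum_union (Finset.Ico_disjoint_Ico_consecutive a b c)]

/-- columns of D(n) -/
noncomputable def cols (n : ℕ) : Finset ℤ := Finset.Ico (1-(n:ℤ)) n

lemma mem_cols {n : ℕ} {x : ℤ} : x ∈ cols n ↔ |x| < n := by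
  rw [cols, Finset.mem_Ico, abs_lt]; omega

/-- ⌈s²/3⌉ -/
def LL (s : ℕ) : ℕ := (s^2+2)/3

lemma LL_lt (s : ℕ) (y : ℤ) : |y| < LL s ↔ 3*|y| < (s:ℤ)^2 := by
  unfold LL
  push_cast
  generalize (s:ℤ)^2 = q
  generalize |y| = w
  omega

lemma LL_bounds (s : ℕ) : (s:ℝ)^2/3 ≤ LL s ∧ (LL s : ℝ) ≤ (s:ℝ)^2/3 + 2/3 := by
  have h1 : s^2 ≤ 3 * LL s := by unfold LL; omega
  have h2 : 3 * LL s ≤ s^2 + 2 := by unfold LL; omega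
  have h1' : (s:ℝ)^2 ≤ 3 * LL s := by exact_mod_cast h1
  have h2' : 3 * (LL s:ℝ) ≤ (s:ℝ)^2 + 2 := by exact_mod_cast h2
  constructor <;> linarith

/-- height of column x in D(n) -/
def hgt (n : ℕ) (x : ℤ) : ℕ := (n:ℤ).toNat - x.natAbs

lemma hgt_cast {n : ℕ} {x : ℤ} (hx : |x| < n) : ((hgt n x : ℕ):ℝ) = (n:ℝ) - |(x:ℝ)| := by
  unfold hgt
  rw [Int.abs_eq_natAbs] at hx
  have : x.natAbs ≤ n := by omega
  rw [Int.toNat_natCast, Nat.cast_sub this]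
  simp

lemma hgt_int {n : ℕ} {x : ℤ} (hx : |x| < n) : ((hgt n x : ℕ):ℤ) = n - |x| := by
  rw [Int.abs_eq_natAbs] at *; unfold hgt; omega

noncomputable def DF (n : ℕ) : Finset Z2 :=
  (cols n).biUnion fun x => (Finset.Ioo (-(LL (hgt n x):ℤ)) (LL (hgt n x))).map ⟨Prod.mk x, fun a b h => by simpa using h⟩

lemma mem_DF {n : ℕ} {z : Z2} : z ∈ DF n ↔ z.1 ∈ cols n ∧ z.2 ∈ Finset.Ioo (-(LL (hgt n z.1):ℤ)) (LL (hgt n z.1)) := by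
  obtain ⟨x,y⟩ := z
  simp only [DF, Finset.mem_biUnion, Finset.mem_map]
  constructor
  · rintro ⟨a, ha, b, hb, h⟩
    have h' : (a,b) = (x,y) := h
    cases h'; exact ⟨ha, hb⟩
  · rintro ⟨ha, hb⟩; exact ⟨x, ha, y, hb, rfl⟩

lemma mem_DF' {n : ℕ} {x y : ℤ} : (x,y) ∈ DF n ↔ |x| < n ∧ 3*|y| < ((n:ℤ) - |x|)^2 := by
  rw [mem_DF]
  simp only [mem_cols]
  refine and_congr_right fun hx => ?_
  rw [← hgt_int hx, ← LL_lt, Finset.mem_Ioo, abs_lt]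

lemma combD_eq (n : ℕ) : combD n = (DF n : Set Z2) := by
  ext ⟨x,y⟩
  rw [Finset.mem_coe, mem_DF']
  simp only [combD, Set.mem_ofPred_eq]
  have h1 : |(x:ℝ)| < n ↔ |x| < (n:ℤ) := by
    rw [← Int.cast_abs]; exact_mod_cast Iff.rfl
  rw [h1]
  refine and_congr_right fun _ => ?_
  rw [lt_div_iff₀ (by norm_num), mul_comm]
  rw [← Int.cast_abs, ← Int.cast_abs]
  exact_mod_cast Iff.rfl

lemma sum_DF (n : ℕ) (g : Z2 → ℝ) :
    ∑ z ∈ DF n, g z = ∑ x ∈ cols n, ∑ y ∈ Finset.Ioo (-(LL (hgt n x):ℤ)) (LL (hgt n x)), g (x,y) :=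
  Finset.sum_finset_product' _ _ _ (fun p => mem_DF) (f := fun x y => g (x,y))

lemma sum_Ioo_abs (α β : ℝ) (L : ℕ) (hL : 1 ≤ L) :
    ∑ y ∈ Finset.Ioo (-(L:ℤ)) L, (α - β * |(y:ℝ)|) = (2*L-1)*α - β*(L*(L-1)) := by
  induction L, hL using Nat.le_induction with
  | base =>
    have : Finset.Ioo (-((1:ℕ):ℤ)) ((1:ℕ):ℤ) = {0} := by decide
    rw [this]; simp; ring
  | succ L hL ih =>
    have : Finset.Ioo (-((L+1:ℕ):ℤ)) ((L+1:ℕ):ℤ) = insert (L:ℤ) (insert (-(L:ℤ)) (Finset.Ioo (-(L:ℤ)) L)) := by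
      ext; simp; omega
    rw [this, Finset.sum_insert (by simp; omega), Finset.sum_insert (by simp), ih]
    push_cast
    rw [abs_neg, abs_of_nonneg (by positivity)]
    ring

lemma LL_pos {s : ℕ} (hs : 1 ≤ s) : 1 ≤ LL s := by
  unfold LL; have : 1 ≤ s^2 := Nat.one_le_pow _ _ hs; omega

lemma hgt_pos {n : ℕ} {x : ℤ} (hx : x ∈ cols n) : 1 ≤ hgt n x := by
  rw [mem_cols, Int.abs_eq_natAbs] at hx; unfold hgt; omega

/-- d(n) as a sum -/
lemma card_DF (n : ℕ) : ((DF n).card : ℝ) = ∑ x ∈ cols n, (2*(LL (hgt n x):ℝ)-1) := by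
  have := sum_DF n (fun _ => 1)
  rw [Finset.sum_const, nsmul_eq_mul, mul_one] at this
  rw [this]
  refine Finset.sum_congr rfl fun x hx => ?_
  have := sum_Ioo_abs 1 0 _ (LL_pos (hgt_pos hx))
  simp only [zero_mul, sub_zero, mul_one] at this
  exact this

lemma cols_card (n : ℕ) (hn : 1 ≤ n) : ((cols n).card : ℝ) = 2*n-1 := by
  rw [cols, Int.card_Ico]
  have : (((n:ℤ) - (1 - n)).toNat : ℤ) = 2*n-1 := by omega
  exact_mod_cast this

/-- even sums -/
lemma sum_cols_hgt (n : ℕ) (hn : 1 ≤ n) : ∑ x ∈ cols n, ((n:ℝ) - |(x:ℝ)|)^2 = (2/3)*n^3 + n/3 := by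
  rw [cols, sum_Ico_split (b := 0) _ (by omega) (by omega)]
  rw [tele (fun x => (((n:ℝ)+x)*((n:ℝ)+x-1)*(2*((n:ℝ)+x)-1))/6) _ _ _ (by omega), tele (fun x => -(((n:ℝ)-x)*((n:ℝ)-x+1)*(2*((n:ℝ)-x)+1))/6) _ _ _ (by omega)]
  · push_cast; ring
  · intro x h1 h2
    have : (0:ℝ) ≤ x := by exact_mod_cast h1
    rw [abs_of_nonneg this]; push_cast; ring
  · intro x h1 h2
    have : (x:ℝ) ≤ 0 := by exact_mod_cast h2.le
    rw [abs_of_nonpos this]; push_cast; ring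

lemma card_DF_bounds (n : ℕ) (hn : 1 ≤ n) :
    (4/9)*(n:ℝ)^3 - 2*n ≤ (DF n).card ∧ ((DF n).card : ℝ) ≤ (4/9)*(n:ℝ)^3 + 3*n := by
  have h1 := sum_cols_hgt n hn
  have h2 := cols_card n hn
  have hn' : (1:ℝ) ≤ n := by exact_mod_cast hn
  rw [card_DF]
  constructor
  · have : ∑ x ∈ cols n, ((2/3)*((n:ℝ) - |(x:ℝ)|)^2 - 1) ≤ ∑ x ∈ cols n, (2*(LL (hgt n x):ℝ)-1) := by
      refine Finset.sum_le_sum fun x hx => ?_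
      have h3 := LL_bounds (hgt n x)
      rw [hgt_cast (mem_cols.1 hx)] at h3
      linarith
    rw [Finset.sum_sub_distrib, ← Finset.mul_sum, h1, Finset.sum_const, nsmul_eq_mul, h2] at this
    linarith
  · have : ∑ x ∈ cols n, (2*(LL (hgt n x):ℝ)-1) ≤ ∑ x ∈ cols n, ((2/3)*((n:ℝ) - |(x:ℝ)|)^2 + 1/3) := by
      refine Finset.sum_le_sum fun x hx => ?_
      have h3 := LL_bounds (hgt n x)
      rw [hgt_cast (mem_cols.1 hx)] at h3
      linarith
    rw [Finset.sum_add_distrib, ← Finset.mul_sum, h1, Finset.sum_const, nsmul_eq_mul, h2] at this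
    linarith

section axis
variable {n h : ℕ} {x0 : ℤ} {f : ℤ → ℝ} {κ : ℝ}

lemma Axis.sum_le (H : Axis n h x0 f κ) : ∑ x ∈ cols n, f x ≤ 5*h := by
  have hh : (1:ℝ) ≤ h := by exact_mod_cast H.h1
  have hnr : (x0:ℝ) + h = n := by exact_mod_cast H.hn
  have hx0 : (0:ℝ) ≤ x0 := by exact_mod_cast H.x0n
  have := H.x0n
  have := H.hn
  have := H.h1
  have hq : ((h:ℝ)^2+1)/h ≤ 2*h := by rw [div_le_iff₀ (by linarith)]; nlinarith
  rw [cols, sum_Ico_split (b := 0) _ (by omega) (by omega), sum_Ico_split (b := x0) (a := 0) _ (by omega) (by omega)]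
  have a1 : ∑ x ∈ Finset.Ico (1-(n:ℤ)) 0, f x ≤ 2*h := by
    refine (tele_le (fun x => x * (((h:ℝ)^2+1)/((n:ℝ)^2+1))) _ _ _ (by omega) ?_).trans ?_
    · intro x h1 h2
      have := H.left x (by omega)
      push_cast; linarith
    · push_cast
      have e1 : ((h:ℝ)^2+1)/((n:ℝ)^2+1) * n ≤ ((h:ℝ)^2+1)/h := by
        rw [div_mul_eq_mul_div, div_le_div_iff₀ (by positivity) (by linarith)]
        have : (n:ℝ)*h ≤ (n:ℝ)^2+1 := by nlinarith
        nlinarith [sq_nonneg (h:ℝ)]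
      have e2 : 0 ≤ ((h:ℝ)^2+1)/((n:ℝ)^2+1) := by positivity
      linarith
  have a2 : ∑ x ∈ Finset.Ico 0 x0, f x ≤ 2*h := by
    refine (tele_le (fun x => ((h:ℝ)^2+1)/((n:ℝ)-x)) _ _ _ (by omega) ?_).trans ?_
    · intro x h1 h2
      have hxr : (0:ℝ) ≤ x := by exact_mod_cast h1
      have hxr2 : (x:ℝ)+1 ≤ x0 := by exact_mod_cast h2
      have := H.sq x (by rw [abs_lt]; omega)
      rw [abs_of_nonneg hxr] at this
      push_cast
      have hs : 2 ≤ (n:ℝ) - x := by linarith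
      rw [← sub_sub]
      set s := (n:ℝ)-x
      have e : ((h:ℝ)^2+1)/(s-1) - ((h:ℝ)^2+1)/s = ((h:ℝ)^2+1)/(s*(s-1)) := by
        have : s ≠ 0 := by linarith
        have : s - 1 ≠ 0 := by intro h; linarith
        field_simp; ring
      rw [e, le_div_iff₀ (by nlinarith)]
      have := H.nn x
      nlinarith
    · push_cast
      have : 0 ≤ ((h:ℝ)^2+1)/((n:ℝ)-0) := by rw [sub_zero]; positivity
      rw [show (n:ℝ)-x0 = h by linarith]
      linarith
  have a3 : ∑ x ∈ Finset.Ico x0 n, f x ≤ h := by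
    refine (tele_le (fun x => x) _ _ _ (by omega) ?_).trans ?_
    · intro x h1 h2
      have := H.le1 x
      push_cast; linarith
    · push_cast; linarith
  linarith

lemma Axis.sum_sq_le (H : Axis n h x0 f κ) : ∑ x ∈ cols n, (f x)^2 * ((n:ℝ)-|(x:ℝ)|)^2 ≤ 10*h^3 := by
  have hh : (1:ℝ) ≤ h := by exact_mod_cast H.h1
  calc ∑ x ∈ cols n, (f x)^2 * ((n:ℝ)-|(x:ℝ)|)^2 ≤ ∑ x ∈ cols n, ((h:ℝ)^2+1) * f x := by
        refine Finset.sum_le_sum fun x hx => ?_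
        have := H.sq x (mem_cols.1 hx)
        have h0 := H.nn x
        nlinarith
    _ = ((h:ℝ)^2+1) * ∑ x ∈ cols n, f x := by rw [Finset.mul_sum]
    _ ≤ ((h:ℝ)^2+1) * (5*h) := by gcongr; exact H.sum_le
    _ ≤ 10*h^3 := by nlinarith [pow_pos (by linarith : (0:ℝ)<h) 3]

lemma Axis.f0_le (H : Axis n h x0 f κ) : f 0 ≤ 2*(h:ℝ)^2/(n:ℝ)^2 := by
  have hh : (1:ℝ) ≤ h := by exact_mod_cast H.h1
  have hn : (1:ℝ) ≤ n := by
    have := H.hn; have := H.x0n; have := H.h1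
    exact_mod_cast (by omega : 1 ≤ n)
  refine (H.left 0 le_rfl).trans ?_
  rw [div_le_div_iff₀ (by positivity) (by positivity)]
  have : (1:ℝ) ≤ (h:ℝ)^2 := by nlinarith
  nlinarith [sq_nonneg (n:ℝ), mul_nonneg (sub_nonneg.2 this) (sq_nonneg (n:ℝ))]

/-- Green identity -/
lemma Axis.green (H : Axis n h x0 f κ) (n' : ℕ) (h1' : 1 ≤ n') (hn' : n' ≤ n) :
    (8*(n':ℝ)^3+8*n') * f 0 = ∑ x ∈ cols n', f x * (12*((n':ℝ)-|(x:ℝ)|)^2 + 2 - 6*((n':ℝ)-|(x:ℝ)|)^4/((n:ℝ)-|(x:ℝ)|)^2)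
      + κ * (if x0 < n' then ((n':ℝ)-x0)^4 else 0) + f n' + f (-n') := by
  set v : ℤ → ℝ := fun x => ((n':ℝ)-|(x:ℝ)|)^4 with hv
  have key := tele (fun x => f (x-1) * v x - v (x-1) * f x)
    (fun x => f x * (v (x+1) + v (x-1) - 2 * v x) - v x * (f (x+1) + f (x-1) - 2 * f x)) (1-(n':ℤ)) n' (by omega)
    (fun x _ _ => by simp only [add_sub_cancel_right]; ring)
  have hvx : ∀ x ∈ cols n', f x * (v (x+1) + v (x-1) - 2 * v x) - v x * (f (x+1) + f (x-1) - 2 * f x) =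
      f x * (12*((n':ℝ)-|(x:ℝ)|)^2 + 2 - 6*((n':ℝ)-|(x:ℝ)|)^4/((n:ℝ)-|(x:ℝ)|)^2)
      - (if x = 0 then (8*(n':ℝ)^3+8*n') * f 0 else 0) + (if x = x0 then κ * v x0 else 0) := by
    intro x hx
    rw [mem_cols] at hx
    have e1 : f x * (v (x+1) + v (x-1) - 2 * v x) = f x * (12*((n':ℝ)-|(x:ℝ)|)^2 + 2) - (if x = 0 then (8*(n':ℝ)^3+8*n') * f 0 else 0) := by
      simp only [hv]
      rcases lt_trichotomy x 0 with h | h | h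
      · have a1 : (x:ℝ)+1 ≤ 0 := by exact_mod_cast h
        rw [if_neg h.ne]; push_cast
        rw [abs_of_nonpos a1, abs_of_nonpos (by linarith), abs_of_nonpos (by linarith)]; ring
      · subst h; simp; ring
      · have a1 : (1:ℝ) ≤ x := by exact_mod_cast h
        rw [if_neg h.ne']; push_cast
        rw [abs_of_nonneg (by linarith), abs_of_nonneg (by linarith), abs_of_nonneg (by linarith)]; ring
    have e2 : v x * (f (x+1) + f (x-1) - 2 * f x) = f x * (6*((n':ℝ)-|(x:ℝ)|)^4/((n:ℝ)-|(x:ℝ)|)^2) - (if x = x0 then κ * v x0 else 0) := by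
      by_cases hx0 : x = x0
      · subst hx0
        have hnr : (n:ℝ) - |(x:ℝ)| = h := by
          rw [abs_of_nonneg (by exact_mod_cast H.x0n)]
          have : (x:ℝ) + h = n := by exact_mod_cast H.hn
          linarith
        rw [if_pos rfl, H.rec0, H.one, hnr]; simp only [hv]; ring
      · rw [if_neg hx0, H.recu x (by omega) hx0]; simp only [hv]; ring
    rw [e1, e2]; ring
  have hcols : Finset.Ico (1-(n':ℤ)) n' = cols n' := rfl
  rw [hcols, Finset.sum_congr rfl hvx, Finset.sum_add_distrib, Finset.sum_sub_distrib, Finset.sum_ite_eq' , Finset.sum_ite_eq',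
    if_pos (mem_cols.2 (by simp; omega))] at key
  have c1 : v n' = 0 := by simp [hv]
  have c2 : v ((n':ℤ)-1) = 1 := by
    have : (1:ℝ) ≤ n' := by exact_mod_cast h1'
    simp only [hv]; push_cast; rw [abs_of_nonneg (by linarith)]; ring
  have c3 : v (1-(n':ℤ)) = 1 := by
    have : (1:ℝ) ≤ n' := by exact_mod_cast h1'
    simp only [hv]; push_cast; rw [abs_of_nonpos (by linarith)]; ring
  have c4 : v (1-(n':ℤ)-1) = 0 := by
    have : (1:ℝ) ≤ n' := by exact_mod_cast h1'
    simp only [hv]; push_cast; rw [abs_of_nonpos (by linarith)]; ring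
  rw [c1, c2, c3, c4, show 1-(n':ℤ)-1 = -n' by ring] at key
  have c5 : (if x0 ∈ cols n' then κ * v x0 else 0) = κ * (if x0 < n' then ((n':ℝ)-x0)^4 else 0) := by
    have hx0 := H.x0n
    rw [mul_ite, mul_zero]
    refine if_congr ?_ ?_ rfl
    · rw [mem_cols, abs_of_nonneg hx0]
    · simp only [hv]; rw [abs_of_nonneg (by exact_mod_cast hx0)]
  rw [c5] at key
  linarith
end axis


lemma exp_quad (v : ℝ) (hv : -(1/2) ≤ v) : Real.exp (v - 2*v^2) ≤ 1 + v := by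
  have h1 : 0 < 1 + v := by linarith
  rw [← Real.le_log_iff_exp_le h1]
  refine le_trans ?_ (Real.one_sub_inv_le_log_of_pos h1)
  have : 1 - (1+v)⁻¹ = v/(1+v) := by field_simp; ring
  rw [this, le_div_iff₀ h1]
  nlinarith [sq_nonneg v, mul_nonneg (sq_nonneg v) (by linarith : 0 ≤ 1+2*v)]

lemma cavg_lin (H : Z2 → ℝ) (a b : ℝ) (z : Z2) : cavg (fun w => a + b * H w) z = a + b * cavg H z := by
  unfold cavg; split_ifs <;> ring

/-- The half-column quantities -/
lemma half_col (L : ℕ) (c : ℝ) (hL : 1 ≤ L) :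
    ∑ y ∈ Finset.Ico (1-(L:ℤ)) 1, (1 - c*|(y:ℝ)|) = L - c*(L*(L-1))/2 := by
  rw [tele (fun y => (y:ℝ) + c*(y*(y-1))/2) _ _ _ (by omega)]
  · push_cast; ring
  · intro x _ h2
    have : (x:ℝ) ≤ 0 := by exact_mod_cast (by omega : x ≤ 0)
    rw [abs_of_nonpos this]; push_cast; ring

lemma half_col_le (s : ℕ) (hs : 1 ≤ s) : (LL s:ℝ) - 3/(s:ℝ)^2*(LL s*(LL s-1))/2 ≤ (s:ℝ)^2/6+1 := by
  obtain ⟨h1,h2⟩ := LL_bounds s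
  have hs' : (1:ℝ) ≤ s := by exact_mod_cast hs
  set l := (s:ℝ)^2/3 with hl
  have hlp : 1/3 ≤ l := by rw [hl]; nlinarith
  have e : 3/(s:ℝ)^2 = 1/l := by rw [hl]; field_simp
  have e2 : (s:ℝ)^2/6 = l/2 := by rw [hl]; ring
  rw [e, e2]
  set e := (LL s:ℝ) - l with he
  have : (LL s:ℝ) = l + e := by rw [he]; ring
  rw [this] at *
  have h3 : (l+e)*(l+e-1)/(2*l) ≥ l/2 + e - 1 := by
    rw [ge_iff_le, le_div_iff₀ (by linarith)]
    nlinarith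
  have : 1/l*((l+e)*(l+e-1))/2 = (l+e)*(l+e-1)/(2*l) := by field_simp
  linarith

lemma full_col_le (s : ℕ) (hs : 1 ≤ s) : (2*(LL s:ℝ)-1) - 3/(s:ℝ)^2*(LL s*(LL s-1)) ≤ (s:ℝ)^2/3+1 := by
  have := half_col_le s hs
  linarith

/-- parameters of the ramp function -/
structure Ramp (h y0 : ℕ) (κ f0 : ℝ) : Prop where
  pos : 0 < f0
  le1 : f0 ≤ 1
  eq : κ * f0 = (1-f0)/y0 + 3*f0/(h:ℝ)^2

lemma ramp_exists (h y0 : ℕ) (κ : ℝ) (h3 : 3 ≤ h) (hy : 1 ≤ y0) (hκ : 1/(h:ℝ) ≤ κ)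
    (c : ℝ) (hc : 0 < c) (hb : c ≤ h * (1/h + 1/y0 - 3/(h:ℝ)^2)) :
    ∃ f0, Ramp h y0 κ f0 ∧ f0 ≤ h/(c*y0) := by
  have hh : (3:ℝ) ≤ h := by exact_mod_cast h3
  have hyr : (1:ℝ) ≤ y0 := by exact_mod_cast hy
  set den := κ + 1/y0 - 3/(h:ℝ)^2 with hden
  have hd : c/h ≤ den := by
    rw [div_le_iff₀ (by linarith)]
    have : 1/(h:ℝ) + 1/y0 - 3/(h:ℝ)^2 ≤ den := by rw [hden]; linarith
    nlinarith
  have hdp : 0 < den := lt_of_lt_of_le (by positivity) hd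
  have hk3 : 3/(h:ℝ)^2 ≤ κ := by
    refine le_trans ?_ hκ
    rw [div_le_div_iff₀ (by positivity) (by linarith)]; nlinarith
  have he : (1/(y0:ℝ))/den * den = 1/y0 := div_mul_cancel₀ _ hdp.ne'
  refine ⟨(1/y0)/den, ⟨by positivity, (div_le_one hdp).2 (by rw [hden]; linarith), ?_⟩, ?_⟩
  · rw [hden] at he
    rw [← hden] at he
    set f0 := (1/(y0:ℝ))/den
    have : f0 * κ + f0/y0 - 3*f0/(h:ℝ)^2 = 1/y0 := by rw [← he, hden]; ring
    rw [sub_div]; linarith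
  · rw [div_div, div_le_div_iff₀ (by positivity) (by positivity)]
    have := mul_le_mul_of_nonneg_right hd (by linarith : (0:ℝ) ≤ h)
    rw [div_mul_cancel₀ _ (by linarith)] at this
    nlinarith

/-- inner test function -/
noncomputable def HI (n y0 : ℕ) (x0 : ℤ) (f : ℤ → ℝ) (f0 : ℝ) (w : Z2) : ℝ :=
  if w.1 = x0 ∧ 0 < w.2 then (if w.2 ≤ y0 then f0 + (1-f0)*w.2/y0 else 0)
  else f0 * f w.1 * max 0 (1 - 3*|(w.2:ℝ)|/((n:ℝ)-|(w.1:ℝ)|)^2)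

section inner
variable {n h y0 : ℕ} {x0 : ℤ} {f : ℤ → ℝ} {κ f0 : ℝ}

lemma HI_nn (H : Axis n h x0 f κ) (R : Ramp h y0 κ f0) (w : Z2) : 0 ≤ HI n y0 x0 f f0 w := by
  have := R.pos
  have := R.le1
  unfold HI
  split_ifs with h1 h2
  · have : (0:ℝ) < w.2 := by exact_mod_cast h1.2
    have : 0 ≤ (1-f0)*w.2/y0 := by apply div_nonneg _ (by positivity); nlinarith
    linarith
  · exact le_rfl
  · have := H.nn w.1
    positivity

lemma HI_le (H : Axis n h x0 f κ) (R : Ramp h y0 κ f0) (hy : 1 ≤ y0) (w : Z2) : HI n y0 x0 f f0 w ≤ 1 := by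
  have := R.pos
  have := R.le1
  have hyr : (1:ℝ) ≤ y0 := by exact_mod_cast hy
  unfold HI
  split_ifs with h1 h2
  · have : (w.2:ℝ) ≤ y0 := by exact_mod_cast h2
    have : (1-f0)*w.2/y0 ≤ 1-f0 := by rw [div_le_iff₀ (by linarith)]; nlinarith
    linarith
  · norm_num
  · have a := H.nn w.1
    have b := H.le1 w.1
    have c : max 0 (1 - 3*|(w.2:ℝ)|/((n:ℝ)-|(w.1:ℝ)|)^2) ≤ 1 := by
      apply max_le (by norm_num)
      have : 0 ≤ 3*|(w.2:ℝ)|/((n:ℝ)-|(w.1:ℝ)|)^2 := by positivity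
      linarith
    have d : f0 * f w.1 ≤ 1 := by nlinarith
    exact mul_le_one₀ d (le_max_left _ _) c

lemma HI_tooth {x y : ℤ} (hxy : ¬ (x = x0 ∧ 0 < y)) :
    HI n y0 x0 f f0 (x,y) = f0 * f x * max 0 (1 - 3*|(y:ℝ)|/((n:ℝ)-|(x:ℝ)|)^2) := by
  unfold HI; rw [if_neg hxy]

lemma HI_ramp (y : ℤ) (h0 : 0 ≤ y) (hy : y ≤ y0) (H : Axis n h x0 f κ) :
    HI n y0 x0 f f0 (x0,y) = f0 + (1-f0)*y/y0 := by
  rcases eq_or_lt_of_le h0 with h | h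
  · subst h; rw [HI_tooth (by simp), H.one]; simp
  · unfold HI; rw [if_pos ⟨rfl, h⟩, if_pos hy]

lemma HI_sub (H : Axis n h x0 f κ) (R : Ramp h y0 κ f0) (hy : 1 ≤ y0) (w : Z2) (hw : w ≠ (x0, (y0:ℤ))) :
    HI n y0 x0 f f0 w ≤ cavg (HI n y0 x0 f f0) w := by
  have hnn := HI_nn H R
  obtain ⟨x,y⟩ := w
  have hyr : (1:ℝ) ≤ y0 := by exact_mod_cast hy
  have hf0 := R.pos
  unfold cavg
  by_cases hy0 : y = 0
  · subst hy0
    simp only [if_true]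
    rw [HI_tooth (by simp), HI_tooth (by simp), HI_tooth (by simp), HI_tooth (y := -1) (by simp)]
    by_cases hx : x = x0
    · subst hx
      rw [HI_ramp 1 (by norm_num) (by omega) H, H.one]
      have hnr : (n:ℝ) - |(x:ℝ)| = h := by
        rw [abs_of_nonneg (by exact_mod_cast H.x0n)]
        have : (x:ℝ) + h = n := by exact_mod_cast H.hn
        linarith
      rw [hnr]
      have e1 := H.rec0
      have e2 := R.eq
      have e3 : 1 - 3/(h:ℝ)^2 ≤ max 0 (1 - 3/(h:ℝ)^2) := le_max_right _ _
      have e4 := mul_le_mul_of_nonneg_left e3 hf0.le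
      have e5 : f (x-1) = 2 + 6/(h:ℝ)^2 - κ - f (x+1) := by linarith
      rw [e5]
      norm_num
      have e6 : f0*κ = (1-f0)/y0 + f0*(3/(h:ℝ)^2) := by rw [mul_comm, e2]; ring
      have e7 : f0 * (6/(h:ℝ)^2) = 2*(f0*(3/(h:ℝ)^2)) := by ring
      nlinarith
    · rw [HI_tooth (y := 1) (by simp [hx])]
      norm_num
      by_cases hxn : |x| < n
      · have e1 := H.recu x hxn hx
        have e3 : 1 - 3/((n:ℝ)-|(x:ℝ)|)^2 ≤ max 0 (1 - 3/((n:ℝ)-|(x:ℝ)|)^2) := le_max_right _ _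
        have e4 := mul_le_mul_of_nonneg_left e3 (mul_nonneg hf0.le (H.nn x))
        have e5 : f (x-1) = (2 + 6/((n:ℝ)-|(x:ℝ)|)^2) * f x - f (x+1) := by linarith
        rw [e5]
        have e7 : f0 * f x * (3/((n:ℝ)-|(x:ℝ)|)^2)*2 = f0 * f x * (6/((n:ℝ)-|(x:ℝ)|)^2) := by ring
        nlinarith
      · rw [H.zero x (by omega)]
        have := H.nn (x+1)
        have := H.nn (x-1)
        norm_num
        positivity
  · rw [if_neg hy0]
    simp only
    by_cases hx : x = x0 ∧ 0 < y
    · obtain ⟨rfl, hpos⟩ := hx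
      rcases lt_trichotomy y y0 with hl | hl | hl
      · rw [HI_ramp y (by omega) (by omega) H, HI_ramp (y+1) (by omega) (by omega) H, HI_ramp (y-1) (by omega) (by omega) H]
        push_cast
        apply le_of_eq; ring
      · subst hl; exact absurd rfl hw
      · have : HI n y0 x f f0 (x,y) = 0 := by
          unfold HI; rw [if_pos ⟨rfl, hpos⟩, if_neg (by simpa using hl)]
        rw [this]
        have := hnn (x,y+1)
        have := hnn (x,y-1)
        linarith
    · rw [HI_tooth hx, HI_tooth (by omega), HI_tooth (by omega)]
      have efac : ∀ A X Y : ℝ, (A*X+A*Y)/2 = A*((X+Y)/2) := fun A X Y => by ring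
      rw [efac]
      refine mul_le_mul_of_nonneg_left ?_ (mul_nonneg hf0.le (H.nn x))
      push_cast
      set q := ((n:ℝ)-|(x:ℝ)|)^2 with hq
      have h1 := le_max_right 0 (1 - 3*|(y:ℝ)+1|/q)
      have h2 := le_max_right 0 (1 - 3*|(y:ℝ)-1|/q)
      have h3 := le_max_left 0 (1 - 3*|(y:ℝ)+1|/q)
      have h4 := le_max_left 0 (1 - 3*|(y:ℝ)-1|/q)
      have h5 : |(y:ℝ)+1| + |(y:ℝ)-1| = 2*|(y:ℝ)| := by
        rcases lt_or_gt_of_ne hy0 with h | h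
        · have : (y:ℝ)+1 ≤ 0 := by exact_mod_cast h
          rw [abs_of_nonpos this, abs_of_nonpos (by linarith), abs_of_nonpos (by linarith)]; ring
        · have : (1:ℝ) ≤ y := by exact_mod_cast h
          rw [abs_of_nonneg (by linarith), abs_of_nonneg (by linarith), abs_of_nonneg (by linarith)]; ring
      have h6 : 3*|(y:ℝ)+1|/q + 3*|(y:ℝ)-1|/q = 2*(3*|(y:ℝ)|/q) := by
        rw [← add_div, ← mul_add, h5]; ring
      refine max_le ?_ ?_ <;> linarith

lemma HI_supp (H : Axis n h x0 f κ) (h3 : 3*y0 ≤ h^2) (w : Z2) (hw : w ≠ (x0,(y0:ℤ)))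
    (hne : HI n y0 x0 f f0 w ≠ 0) : w ∈ DF n := by
  obtain ⟨x,y⟩ := w
  rw [mem_DF']
  by_cases hx : x = x0 ∧ 0 < y
  · obtain ⟨rfl, hp⟩ := hx
    unfold HI at hne
    rw [if_pos ⟨rfl, hp⟩] at hne
    simp only at hne
    split_ifs at hne with hl
    · have hxn := H.x0n
      have hhn := H.hn
      have h1 := H.h1
      have hlt : y < y0 := lt_of_le_of_ne hl (fun h => hw (by rw [h]))
      rw [abs_of_nonneg hxn, abs_of_pos hp]
      refine ⟨by omega, ?_⟩
      rw [show (n:ℤ) - x = h by omega]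
      have : (3*(y0:ℤ)) ≤ (h:ℤ)^2 := by exact_mod_cast h3
      linarith
    · exact absurd rfl hne
  · rw [HI_tooth hx] at hne
    by_cases hxn : |x| < n
    · refine ⟨hxn, ?_⟩
      by_contra hcon
      push Not at hcon
      apply hne
      have hxr : |(x:ℝ)| < n := by rw [← Int.cast_abs]; exact_mod_cast hxn
      have : ((n:ℝ)-|(x:ℝ)|)^2 ≤ 3*|(y:ℝ)| := by
        rw [← Int.cast_abs, ← Int.cast_abs]; exact_mod_cast hcon
      rw [max_eq_left, mul_zero]
      have h2 : 1 ≤ 3*|(y:ℝ)|/((n:ℝ)-|(x:ℝ)|)^2 := by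
        rw [one_le_div (pow_pos (by linarith) 2)]; exact this
      linarith
    · rw [H.zero x (by omega)] at hne; simp at hne
end inner


lemma sum_le_of_supp (B D : Finset Z2) (g : Z2 → ℝ) (hg : ∀ w, 0 ≤ g w) (hs : ∀ w, g w ≠ 0 → w ∈ D) :
    ∑ w ∈ B, g w ≤ ∑ w ∈ D, g w := by
  have h1 : ∑ w ∈ B, g w ≤ ∑ w ∈ B ∪ D, g w :=
    Finset.sum_le_sum_of_subset_of_nonneg Finset.subset_union_left (fun w _ _ => hg w)
  have h2 : ∑ w ∈ D, g w = ∑ w ∈ B ∪ D, g w := by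
    apply Finset.sum_subset Finset.subset_union_right
    intro w _ hw
    by_contra h
    exact hw (hs w h)
  linarith

noncomputable def HJ (n y0 : ℕ) (x0 : ℤ) (f : ℤ → ℝ) (f0 : ℝ) (w : Z2) : ℝ :=
  if w = (x0,(y0:ℤ)) then 0 else HI n y0 x0 f f0 w

lemma lin_pos {n : ℕ} {x y : ℤ} (hx : |x| < n) (hy : 3*|y| < ((n:ℤ) - |x|)^2) :
    0 ≤ 1 - 3*|(y:ℝ)|/((n:ℝ)-|(x:ℝ)|)^2 := by
  have hxr : |(x:ℝ)| < n := by rw [← Int.cast_abs]; exact_mod_cast hx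
  have : 3*|(y:ℝ)| < ((n:ℝ)-|(x:ℝ)|)^2 := by
    rw [← Int.cast_abs, ← Int.cast_abs]; exact_mod_cast hy
  have h2 : 3*|(y:ℝ)|/((n:ℝ)-|(x:ℝ)|)^2 ≤ 1 := by
    rw [div_le_one (pow_pos (by linarith) 2)]; exact this.le
  linarith

lemma Ioo_lt {n : ℕ} {x y : ℤ} (hx : |x| < n) (hy : y ∈ Finset.Ioo (-(LL (hgt n x):ℤ)) (LL (hgt n x))) :
    3*|y| < ((n:ℤ) - |x|)^2 := by
  rw [Finset.mem_Ioo, ← abs_lt, LL_lt, hgt_int hx] at hy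
  exact hy

section inner
variable {n h y0 : ℕ} {x0 : ℤ} {f : ℤ → ℝ} {κ f0 : ℝ}

lemma Axis.habs (H : Axis n h x0 f κ) : (n:ℝ) - |(x0:ℝ)| = h := by
  rw [abs_of_nonneg (by exact_mod_cast H.x0n)]
  have : (x0:ℝ) + h = n := by exact_mod_cast H.hn
  linarith

lemma Axis.x0lt (H : Axis n h x0 f κ) : |x0| < n := by
  have := H.hn; have := H.x0n; have := H.h1
  rw [abs_of_nonneg H.x0n]; omega

lemma Axis.hgt0 (H : Axis n h x0 f κ) : hgt n x0 = h := by
  have h1 := hgt_int H.x0lt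
  have := H.hn
  rw [abs_of_nonneg H.x0n] at h1; omega

lemma HJ_nn (H : Axis n h x0 f κ) (R : Ramp h y0 κ f0) (w : Z2) : 0 ≤ HJ n y0 x0 f f0 w := by
  unfold HJ; split_ifs
  · exact le_rfl
  · exact HI_nn H R w

lemma HJ_col_ne (H : Axis n h x0 f κ) (R : Ramp h y0 κ f0) {x : ℤ} (hx : x ∈ cols n) (hne : x ≠ x0) :
    ∑ y ∈ Finset.Ioo (-(LL (hgt n x):ℤ)) (LL (hgt n x)), HJ n y0 x0 f f0 (x,y)
      ≤ f0 * f x * (((n:ℝ)-|(x:ℝ)|)^2/3+1) := by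
  have hxn := mem_cols.1 hx
  have hs := hgt_pos hx
  have := sum_Ioo_abs (f0 * f x) (f0 * f x * (3/((n:ℝ)-|(x:ℝ)|)^2)) (LL (hgt n x)) (LL_pos hs)
  have e : ∑ y ∈ Finset.Ioo (-(LL (hgt n x):ℤ)) (LL (hgt n x)), HJ n y0 x0 f f0 (x,y)
      = ∑ y ∈ Finset.Ioo (-(LL (hgt n x):ℤ)) (LL (hgt n x)), (f0 * f x - f0 * f x * (3/((n:ℝ)-|(x:ℝ)|)^2) * |(y:ℝ)|) := by
    apply Finset.sum_congr rfl
    intro y hy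
    have := lin_pos hxn (Ioo_lt hxn hy)
    unfold HJ
    rw [if_neg (by simp [hne]), HI_tooth (by simp [hne]), max_eq_right this]
    ring
  rw [e, this]
  have hc := full_col_le _ hs
  rw [hgt_cast hxn] at hc
  have := mul_le_mul_of_nonneg_left hc (mul_nonneg R.pos.le (H.nn x))
  refine le_trans (le_of_eq ?_) this
  ring

lemma HJ_col_eq (H : Axis n h x0 f κ) (R : Ramp h y0 κ f0) (hy1 : 1 ≤ y0) (h3 : 3*y0 ≤ h^2) :
    ∑ y ∈ Finset.Ioo (-(LL (hgt n x0):ℤ)) (LL (hgt n x0)), HJ n y0 x0 f f0 (x0,y)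
      ≤ f0 * f x0 * (((n:ℝ)-|(x0:ℝ)|)^2/3+1) + ((1+f0)*y0/2 - f0*(h:ℝ)^2/6) := by
  have hpos := R.pos
  have hle := R.le1
  have hL : (y0:ℤ) ≤ LL h := by
    have h1 := (LL_bounds h).1
    have : (3*y0:ℝ) ≤ (h:ℝ)^2 := by exact_mod_cast h3
    have : (y0:ℝ) ≤ LL h := by linarith
    exact_mod_cast this
  have hlo : ∀ y ∈ Finset.Ioo (-(LL (hgt n x0):ℤ)) (LL (hgt n x0)), 0 ≤ 1 - 3*|(y:ℝ)|/((n:ℝ)-|(x0:ℝ)|)^2 :=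
    fun y hy => lin_pos H.x0lt (Ioo_lt H.x0lt hy)
  rw [H.hgt0] at *
  rw [H.habs] at *
  have eI : Finset.Ioo (-(LL h:ℤ)) (LL h) = Finset.Ico (1-(LL h:ℤ)) (LL h) := by
    ext y; simp only [Finset.mem_Ioo, Finset.mem_Ico]; omega
  have hL1 : 1 ≤ LL h := LL_pos H.h1
  rw [eI]
  rw [sum_Ico_split (fun y => HJ n y0 x0 f f0 (x0,y)) (b := 1) (by omega) (by omega),
    sum_Ico_split (fun y => HJ n y0 x0 f f0 (x0,y)) (a := 1) (b := y0) (by omega) hL]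
  have s1 : ∑ y ∈ Finset.Ico (1-(LL h:ℤ)) 1, HJ n y0 x0 f f0 (x0,y)
      = f0 * ∑ y ∈ Finset.Ico (1-(LL h:ℤ)) 1, (1 - 3/(h:ℝ)^2*|(y:ℝ)|) := by
    rw [Finset.mul_sum]
    apply Finset.sum_congr rfl
    intro y hy
    rw [Finset.mem_Ico] at hy
    have := hlo y (by rw [Finset.mem_Ioo]; omega)
    unfold HJ
    rw [if_neg (by simp; omega), HI_tooth (by omega), H.habs, max_eq_right this, H.one]
    ring
  have s3 : ∑ y ∈ Finset.Ico (y0:ℤ) (LL h:ℤ), HJ n y0 x0 f f0 (x0,y) = 0 := by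
    apply Finset.sum_eq_zero
    intro y hy
    rw [Finset.mem_Ico] at hy
    unfold HJ
    split_ifs with h1
    · rfl
    · unfold HI
      have : y ≠ y0 := by intro h; exact h1 (by rw [h])
      rw [if_pos ⟨rfl, by simp only; omega⟩, if_neg (by simp only; omega)]
  have s2 : ∑ y ∈ Finset.Ico (1:ℤ) y0, HJ n y0 x0 f f0 (x0,y) = f0*(y0-1) + (1-f0)*(y0-1)/2 := by
    have hyr : (1:ℝ) ≤ y0 := by exact_mod_cast hy1
    rw [tele (fun y => f0*y + (1-f0)*(y*(y-1))/(2*y0)) _ _ _ (by omega)]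
    · push_cast; field_simp; ring
    · intro y h1 h2
      unfold HJ
      rw [if_neg (by simp; omega), HI_ramp y (by omega) (by omega) H]
      push_cast; field_simp; ring
  rw [s1, s2, s3, half_col _ _ hL1, H.one]
  have hc := mul_le_mul_of_nonneg_left (half_col_le h H.h1) hpos.le
  nlinarith

lemma HJ_sum (H : Axis n h x0 f κ) (R : Ramp h y0 κ f0) (hy1 : 1 ≤ y0) (h3 : 3*y0 ≤ h^2) (hf0 : f0 * h ≤ 16) :
    ∑ w ∈ DF n, HJ n y0 x0 f f0 w ≤ (DF n).card * (f0 * f 0) - ((h:ℝ)^2/3 - y0 - 160) := by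
  have hpos := R.pos
  have hle := R.le1
  have hn1 : 1 ≤ n := by have := H.hn; have := H.x0n; have := H.h1; omega
  have hnr : (1:ℝ) ≤ n := by exact_mod_cast hn1
  have hyr : (1:ℝ) ≤ y0 := by exact_mod_cast hy1
  have hhr : (1:ℝ) ≤ h := by exact_mod_cast H.h1
  have c1 : ∑ w ∈ DF n, HJ n y0 x0 f f0 w ≤ ∑ x ∈ cols n, (f0 * f x * (((n:ℝ)-|(x:ℝ)|)^2/3+1)
      + if x = x0 then ((1+f0)*y0/2 - f0*(h:ℝ)^2/6) else 0) := by
    rw [sum_DF]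
    apply Finset.sum_le_sum
    intro x hx
    by_cases hxe : x = x0
    · subst hxe; rw [if_pos rfl]; exact HJ_col_eq H R hy1 h3
    · rw [if_neg hxe, add_zero]; exact HJ_col_ne H R hx hxe
  rw [Finset.sum_add_distrib, Finset.sum_ite_eq' , if_pos (mem_cols.2 H.x0lt)] at c1
  have g := H.green n hn1 le_rfl
  rw [if_pos (by have := H.hn; have := H.h1; omega), H.zero n (by simp), H.zero (-n) (by simp)] at g
  have hxh : (n:ℝ) - x0 = h := by have := H.habs; rwa [abs_of_nonneg (by exact_mod_cast H.x0n)] at this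
  rw [hxh] at g
  have e1 : ∑ x ∈ cols n, f x * (12*((n:ℝ)-|(x:ℝ)|)^2 + 2 - 6*((n:ℝ)-|(x:ℝ)|)^4/((n:ℝ)-|(x:ℝ)|)^2)
      = 18 * ∑ x ∈ cols n, f x * (((n:ℝ)-|(x:ℝ)|)^2/3+1) - 16 * ∑ x ∈ cols n, f x := by
    rw [Finset.mul_sum, Finset.mul_sum, ← Finset.sum_sub_distrib]
    apply Finset.sum_congr rfl
    intro x hx
    have : 0 < (n:ℝ)-|(x:ℝ)| := by rw [← hgt_cast (mem_cols.1 hx)]; exact_mod_cast hgt_pos hx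
    field_simp; ring
  have e2 : ∑ x ∈ cols n, f0 * f x * (((n:ℝ)-|(x:ℝ)|)^2/3+1) = f0 * ∑ x ∈ cols n, f x * (((n:ℝ)-|(x:ℝ)|)^2/3+1) := by
    rw [Finset.mul_sum]; apply Finset.sum_congr rfl; intro x _; ring
  rw [e1] at g
  rw [e2] at c1
  have hS := H.sum_le
  have h00 := H.f0_le
  have hf00 := H.nn 0
  have hcard := (card_DF_bounds n hn1).1
  set S := ∑ x ∈ cols n, f x
  set Q := ∑ x ∈ cols n, f x * (((n:ℝ)-|(x:ℝ)|)^2/3+1)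
  have hq : f 0 * n ≤ 2*h := by
    have : f 0 * n ≤ 2*(h:ℝ)^2/(n:ℝ)^2 * n := mul_le_mul_of_nonneg_right h00 (by linarith)
    refine this.trans ?_
    rw [div_mul_eq_mul_div, div_le_iff₀ (by positivity)]
    have hhn : (h:ℝ) ≤ n := by have := H.hn; have := H.x0n; exact_mod_cast (by omega : h ≤ n)
    nlinarith [mul_nonneg (mul_nonneg (by linarith : (0:ℝ) ≤ h) (by linarith : (0:ℝ) ≤ n)) (sub_nonneg.2 hhn)]
  have hk : κ * f0 * (h:ℝ)^4 = (1-f0)*(h:ℝ)^4/y0 + 3*f0*(h:ℝ)^2 := by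
    rw [R.eq]; field_simp
  have hL : (1-f0)*(6*(h:ℝ)^2 - 9*y0) ≤ (1-f0)*(h:ℝ)^4/y0 := by
    rw [mul_div_assoc]
    apply mul_le_mul_of_nonneg_left _ (by linarith)
    rw [le_div_iff₀ (by linarith)]
    nlinarith [sq_nonneg ((h:ℝ)^2-3*y0)]
  have hc2 : (4/9*(n:ℝ)^3 - 2*n) * (f0 * f 0) ≤ (DF n).card * (f0 * f 0) :=
    mul_le_mul_of_nonneg_right hcard (by positivity)
  have g2 : f0 * ((8*(n:ℝ)^3+8*n) * f 0) = 18*(f0*Q) - 16*(f0*S) + κ * f0 * (h:ℝ)^4 := by rw [g]; ring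
  have t1 : f0 * S ≤ 80 := by nlinarith
  have t2 : f0 * (f 0 * n) ≤ 32 := by nlinarith
  have hlt : 18*((4/9*(n:ℝ)^3 - 2*n) * (f0 * f 0)) = f0 * ((8*(n:ℝ)^3+8*n) * f 0) - 44*(f0 * (f 0 * n)) := by ring
  rw [g2, hk] at hlt
  have e9 : (1-f0)*(6*(h:ℝ)^2 - 9*y0) = 6*(h:ℝ)^2 - 9*y0 - 6*(f0*(h:ℝ)^2) + 9*(f0*y0) := by ring
  rw [e9] at hL
  linarith

lemma HJ_sq (H : Axis n h x0 f κ) (R : Ramp h y0 κ f0) (hy1 : 1 ≤ y0) (hf0 : f0 * h ≤ 16) (h3 : 3*y0 ≤ h^2) :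
    ∑ w ∈ DF n, (HJ n y0 x0 f f0 w)^2 ≤ 2561*(h:ℝ)^2 := by
  have hpos := R.pos
  have hle := R.le1
  have hhr : (1:ℝ) ≤ h := by exact_mod_cast H.h1
  have c1 : ∑ w ∈ DF n, (HJ n y0 x0 f f0 w)^2 ≤ ∑ w ∈ DF n, ((f0 * f w.1)^2 +
      if w ∈ (Finset.Ico (1:ℤ) y0).image (fun y => (x0,y)) then 1 else 0) := by
    apply Finset.sum_le_sum
    intro w hw
    unfold HJ
    split_ifs with h1 h2 h2
    · rw [zero_pow two_ne_zero]; positivity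
    · rw [zero_pow two_ne_zero]; positivity
    · have := HI_nn H R w
      have := HI_le H R hy1 w
      nlinarith [sq_nonneg (f0 * f w.1)]
    · rw [add_zero]
      have hf := H.nn w.1
      by_cases hx : w.1 = x0 ∧ 0 < w.2
      · unfold HI
        rw [if_pos hx, if_neg]
        · have : (0:ℝ) ≤ (f0 * f w.1)^2 := sq_nonneg _
          simpa using this
        · intro hl
          rcases eq_or_lt_of_le hl with h4 | h4
          · exact h1 (Prod.ext hx.1 h4)
          · exact h2 (Finset.mem_image.2 ⟨w.2, by rw [Finset.mem_Ico]; omega, Prod.ext hx.1.symm rfl⟩)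
      · obtain ⟨x,y⟩ := w
        rw [HI_tooth hx]
        have c : max 0 (1 - 3*|(y:ℝ)|/((n:ℝ)-|(x:ℝ)|)^2) ≤ 1 := by
          apply max_le (by norm_num)
          have : 0 ≤ 3*|(y:ℝ)|/((n:ℝ)-|(x:ℝ)|)^2 := by positivity
          linarith
        have c0 := le_max_left 0 (1 - 3*|(y:ℝ)|/((n:ℝ)-|(x:ℝ)|)^2)
        have hff : 0 ≤ f0 * f x := by positivity
        apply pow_le_pow_left₀ (by positivity)
        exact mul_le_of_le_one_right hff c
  refine c1.trans ?_
  rw [Finset.sum_add_distrib]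
  have a1 : ∑ w ∈ DF n, (f0 * f w.1)^2 ≤ f0^2 * (10*(h:ℝ)^3) := by
    rw [sum_DF]
    refine le_trans ?_ (mul_le_mul_of_nonneg_left H.sum_sq_le (sq_nonneg f0))
    rw [Finset.mul_sum]
    apply Finset.sum_le_sum
    intro x hx
    simp only [Finset.sum_const, nsmul_eq_mul]
    have hs := hgt_pos hx
    have hc : ((Finset.Ioo (-(LL (hgt n x):ℤ)) (LL (hgt n x))).card : ℝ) ≤ ((n:ℝ)-|(x:ℝ)|)^2 := by
      rw [Int.card_Ioo, ← hgt_cast (mem_cols.1 hx)]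
      have : ((LL (hgt n x):ℤ) - (-(LL (hgt n x):ℤ)) - 1).toNat ≤ (hgt n x)^2 := by
        unfold LL
        have : 1 ≤ (hgt n x)^2 := Nat.one_le_pow _ _ hs
        omega
      exact_mod_cast this
    calc _ ≤ ((n:ℝ)-|(x:ℝ)|)^2 * (f0 * f x)^2 := mul_le_mul_of_nonneg_right hc (sq_nonneg _)
      _ = _ := by ring
  have a2 : ∑ w ∈ DF n, (if w ∈ (Finset.Ico (1:ℤ) y0).image (fun y => (x0,y)) then (1:ℝ) else 0) ≤ y0 := by
    rw [Finset.sum_boole]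
    have : (Finset.filter (fun w => w ∈ (Finset.Ico (1:ℤ) y0).image (fun y => (x0,y))) (DF n)).card ≤ y0 := by
      refine (Finset.card_le_card (t := (Finset.Ico (1:ℤ) y0).image (fun y => (x0,y))) ?_).trans ?_
      · intro w hw; exact (Finset.mem_filter.1 hw).2
      · refine Finset.card_image_le.trans ?_
        rw [Int.card_Ico]; omega
    exact_mod_cast this
  have a3 : f0^2 * (10*(h:ℝ)^3) ≤ 2560 * h := by
    have : (f0*h)^2 ≤ 16^2 := pow_le_pow_left₀ (by positivity) hf0 2
    nlinarith
  have : (3*y0:ℝ) ≤ (h:ℝ)^2 := by exact_mod_cast h3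
  nlinarith

theorem inner_prob {Ω : Type*} [mΩ : MeasurableSpace Ω] {P : Measure Ω} {W : ℕ → ℕ → Ω → Z2}
    (hW : IsIIDCombWalks P W) (n h y0 : ℕ) (x0 : ℤ) (hx0 : 0 ≤ x0) (hn : x0 + h = n) (h3 : 3 ≤ h) (hy1 : 1 ≤ y0)
    (hy3 : 3*y0 ≤ h^2) (hy16 : h^2 ≤ 16*y0) (t : ℝ) (ht : 0 ≤ t) (ht2 : t ≤ 1/2) :
    P {ω | (x0,(y0:ℤ)) ∉ CL W (DF n).card ω} ≤
      ENNReal.ofReal (Real.exp (-t*((h:ℝ)^2/3-y0-160) + 2*t^2*(2561*(h:ℝ)^2))) := by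
  obtain ⟨f, κ, H⟩ := axis_exists n h x0 hx0 hn (by omega)
  have hhr : (3:ℝ) ≤ h := by exact_mod_cast h3
  have hyr : (1:ℝ) ≤ y0 := by exact_mod_cast hy1
  have hy3r : (3*y0:ℝ) ≤ (h:ℝ)^2 := by exact_mod_cast hy3
  have hy16r : (h:ℝ)^2 ≤ 16*y0 := by exact_mod_cast hy16
  obtain ⟨f0, R, hf0⟩ := ramp_exists h y0 κ h3 hy1 H.kap 1 one_pos (by
    have : 3/(h:ℝ)^2 ≤ 1/y0 := by rw [div_le_div_iff₀ (by positivity) (by positivity)]; linarith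
    have : 1/(h:ℝ) ≤ 1/h + 1/y0 - 3/(h:ℝ)^2 := by linarith
    calc (1:ℝ) = h*(1/h) := by field_simp
      _ ≤ _ := mul_le_mul_of_nonneg_left this (by linarith))
  have hf0h : f0 * h ≤ 16 := by
    rw [one_mul, le_div_iff₀ (by linarith)] at hf0
    have := R.pos
    by_contra hc
    push Not at hc
    nlinarith [mul_le_mul_of_nonneg_right hf0 (by linarith : (0:ℝ) ≤ h)]
  set z : Z2 := (x0,(y0:ℤ)) with hz
  have hsum := HJ_sum H R hy1 hy3 hf0h
  have hsq := HJ_sq H R hy1 hf0h hy3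
  have hnn := HI_nn H R
  have hle := HI_le H R hy1
  have hH0 : HI n y0 x0 f f0 (0,0) = f0 * f 0 := by
    rw [HI_tooth (by simp)]; simp
  set Hf := HI n y0 x0 f f0 with hHf
  have hcp := Real.exp_pos (-t*(f0 * f 0))
  have hm := master hW (fun B => z ∉ B) (fun w => Real.exp (-t*Hf w - 2*(-t*Hf w)^2)) (Real.exp (-t*(f0 * f 0))) hcp
    (fun B hB hz' => ⟨fun w => 1 + (-t) * Hf w, by
        simp only [hH0]
        have := Real.add_one_le_exp (-t*(f0 * f 0)); linarith, by
        intro w hw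
        rw [cavg_lin]
        have : Hf w ≤ cavg Hf w := HI_sub H R hy1 w (by rintro rfl; exact hz' hw)
        nlinarith, by
        intro w _ w' _
        simp only
        have := hle w'; have := hnn w'
        nlinarith, by
        intro w _
        refine le_trans (exp_quad _ ?_) (le_max_left _ _)
        have := hle w; have := hnn w
        nlinarith⟩) (DF n).card (fun B => z ∉ B) (Real.exp (-t*((h:ℝ)^2/3-y0-160) + 2*t^2*(2561*(h:ℝ)^2)))
    (fun y => (Real.exp_pos _).le) (Real.exp_pos _).le (by
      intro B _ hcard hzB
      rw [← Real.exp_sum, ← Real.exp_nat_mul, ← Real.exp_add, Real.exp_le_exp, Finset.sum_sub_distrib, ← Finset.mul_sum]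
      have e1 : ∑ w ∈ B, Hf w = ∑ w ∈ B, HJ n y0 x0 f f0 w := by
        apply Finset.sum_congr rfl
        intro w hw
        unfold HJ; rw [if_neg (by rintro rfl; exact hzB hw)]
      have e2 : ∑ w ∈ B, 2*(-t*Hf w)^2 = 2*t^2*∑ w ∈ B, (HJ n y0 x0 f f0 w)^2 := by
        rw [Finset.mul_sum]
        apply Finset.sum_congr rfl
        intro w hw
        unfold HJ; rw [if_neg (by rintro rfl; exact hzB hw)]; ring
      have hs : ∀ w, HJ n y0 x0 f f0 w ≠ 0 → w ∈ DF n := by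
        intro w hw
        unfold HJ at hw
        split_ifs at hw with h1
        · exact absurd rfl hw
        · exact HI_supp H hy3 w h1 hw
      have e3 := sum_le_of_supp B (DF n) _ (HJ_nn H R) hs
      have e4 := sum_le_of_supp B (DF n) (fun w => (HJ n y0 x0 f f0 w)^2) (fun w => sq_nonneg _)
        (fun w hw => hs w (fun h => hw (by simp [h])))
      rw [e1, e2]
      have e5 := mul_le_mul_of_nonneg_left (e3.trans hsum) ht
      have e6 := mul_le_mul_of_nonneg_left (e4.trans hsq) (by positivity : 0 ≤ 2*t^2)
      have : ((DF n).card:ℝ) * (-t*(f0 * f 0)) = -(t*((DF n).card * (f0 * f 0))) := by ring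
      rw [this]
      nlinarith)
  refine le_trans (measure_mono ?_) hm
  intro ω hω
  exact ⟨hω, fun i hi hc => hω (clF_mono _ hi.le hc)⟩
end inner


lemma PClosed.down {B : Finset Z2} (hB : PClosed B) (x : ℤ) (k : ℕ) : ∀ y : ℕ, k ≤ y → (x,(y:ℤ)) ∈ B → (x,(k:ℤ)) ∈ B := by
  intro y hy
  induction y, hy using Nat.le_induction with
  | base => exact id
  | succ y hy ih =>
    intro h
    apply ih
    have := hB _ h (by simp; omega)
    unfold parent at this
    rw [if_neg (by simp only; omega)] at this
    simp only at this
    rw [Int.sign_eq_one_of_pos (by omega)] at this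
    simpa using this

lemma PClosed.up {B : Finset Z2} (hB : PClosed B) (x : ℤ) (k : ℕ) : ∀ y : ℕ, k ≤ y → (x,-(y:ℤ)) ∈ B → (x,-(k:ℤ)) ∈ B := by
  intro y hy
  induction y, hy using Nat.le_induction with
  | base => exact id
  | succ y hy ih =>
    intro h
    apply ih
    have := hB _ h (by simp; omega)
    unfold parent at this
    rw [if_neg (by simp only; omega)] at this
    simp only at this
    rw [Int.sign_eq_neg_one_of_neg (by omega)] at this
    convert this using 2
    push_cast; ring

lemma PClosed.axis {B : Finset Z2} (hB : PClosed B) {x y : ℤ} (h : (x,y) ∈ B) : (x,0) ∈ B := by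
  rcases le_total 0 y with h0 | h0
  · lift y to ℕ using h0
    simpa using hB.down x 0 y (by omega) h
  · obtain ⟨m, hm⟩ := Int.eq_ofNat_of_zero_le (neg_nonneg.2 h0)
    have := hB.up x 0 m (by omega) (by rw [← hm]; simpa using h)
    simpa using this

lemma PClosed.left {B : Finset Z2} (hB : PClosed B) (k : ℕ) : ∀ x : ℕ, k ≤ x → ((x:ℤ),(0:ℤ)) ∈ B → ((k:ℤ),(0:ℤ)) ∈ B := by
  intro y hy
  induction y, hy using Nat.le_induction with
  | base => exact id
  | succ y hy ih =>
    intro h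
    apply ih
    have := hB _ h (by simp; omega)
    unfold parent at this
    rw [if_pos rfl] at this
    simp only at this
    rw [Int.sign_eq_one_of_pos (by omega)] at this
    simpa using this

lemma exists_refl (z : Z2) : ∃ σ : Z2 ≃ Z2, IsCombRefl σ ∧ σ z = (|z.1|, |z.2|) ∧ (∀ w, (σ w).1 = w.1 ∨ (σ w).1 = -w.1) ∧ (∀ w, |(σ w).1| = |w.1| ∧ |(σ w).2| = |w.2|) := by
  have hid : IsCombRefl (Equiv.refl Z2) := ⟨fun _ _ => Iff.rfl, fun _ => Iff.rfl, rfl⟩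
  rcases le_total 0 z.1 with h1 | h1 <;> rcases le_total 0 z.2 with h2 | h2
  · exact ⟨Equiv.refl _, hid, by simp [abs_of_nonneg h1, abs_of_nonneg h2], by simp, by simp⟩
  · exact ⟨flipY, flipY_refl, by simp [flipY, abs_of_nonneg h1, abs_of_nonpos h2], by simp [flipY], by simp [flipY]⟩
  · exact ⟨flipX, flipX_refl, by simp [flipX, abs_of_nonpos h1, abs_of_nonneg h2], by simp [flipX], by simp [flipX]⟩
  · exact ⟨flipX.trans flipY, refl_trans flipX_refl flipY_refl, by simp [flipX, flipY, abs_of_nonpos h1, abs_of_nonpos h2], by simp [flipX, flipY], by simp [flipX, flipY]⟩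

section
variable {Ω : Type*} [mΩ : MeasurableSpace Ω] {P : Measure Ω} {W : ℕ → ℕ → Ω → Z2}

lemma bc (s : ℕ → Set Ω) (N0 : ℕ) (C : ℝ) (hC : 0 ≤ C) (h : ∀ n, N0 ≤ n → P (s n) ≤ ENNReal.ofReal (C / (n:ℝ)^2)) :
    ∀ᵐ ω ∂P, ∃ N : ℕ, ∀ n, N ≤ n → ω ∉ s n := by
  have hsum : ∑' n, P (if N0 ≤ n then s n else ∅) ≠ ∞ := by
    have h1 : Summable (fun n : ℕ => C / (n:ℝ)^2) := by
      have := (Real.summable_nat_pow_inv (p := 2)).2 (by norm_num)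
      simpa [div_eq_mul_inv] using this.mul_left C
    refine ne_top_of_le_ne_top h1.tsum_ofReal_ne_top (ENNReal.tsum_le_tsum ?_)
    intro n
    split_ifs with hn
    · exact h n hn
    · simp
  filter_upwards [ae_eventually_notMem hsum] with ω hω
  obtain ⟨N, hN⟩ := Filter.eventually_atTop.1 hω
  refine ⟨max N N0, fun n hn => ?_⟩
  have := hN n (le_of_max_le_left hn)
  rwa [if_pos (le_of_max_le_right hn)] at this

lemma inner_site (hW : IsIIDCombWalks P W) (n q h : ℕ) (x y : ℤ) (hx : |x| + h = n) (hq : 18 ≤ q) (hh : 2*q ≤ h)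
    (hy : |y| = LL (h-q)) :
    P {ω | (x,y) ∉ CL W (DF n).card ω} ≤ ENNReal.ofReal (Real.exp (-((q:ℝ)^2/327808))) := by
  obtain ⟨σ, hσ, hz, -, -⟩ := exists_refl (x,y)
  have hW' := refl_iid hW hσ
  simp only at hz
  obtain ⟨hl1, hl2⟩ := LL_bounds (h-q)
  rw [Nat.cast_sub (by omega)] at hl1 hl2
  have hqr : (18:ℝ) ≤ q := by exact_mod_cast hq
  have hhr : (2*q:ℝ) ≤ h := by exact_mod_cast hh
  have hy1 : 1 ≤ LL (h-q) := LL_pos (by omega)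
  have hp := inner_prob hW' n h (LL (h-q)) |x| (abs_nonneg x) hx (by omega) hy1
    (by
      have : (3*(LL (h-q):ℝ)) ≤ (h:ℝ)^2 := by nlinarith
      exact_mod_cast this)
    (by
      have : (h:ℝ)^2 ≤ 16*(LL (h-q):ℝ) := by nlinarith
      exact_mod_cast this) ((q:ℝ)/(40976*h)) (by positivity) (by
        rw [div_le_div_iff₀ (by linarith) (by norm_num)]; nlinarith)
  have e : {ω | (x,y) ∉ CL W (DF n).card ω} = {ω | (|x|,((LL (h-q):ℕ):ℤ)) ∉ CL (fun i t ω => σ (W i t ω)) (DF n).card ω} := by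
    ext ω
    simp only [Set.mem_ofPred_eq]
    rw [← hy, ← hz, refl_CL_mem, Equiv.symm_apply_apply]
  rw [e]
  refine hp.trans (ENNReal.ofReal_le_ofReal (Real.exp_le_exp.2 ?_))
  have hpos : (0:ℝ) < h := by linarith
  have g1 : (h:ℝ)*q/4 ≤ (h:ℝ)^2/3 - (LL (h-q):ℝ) - 160 := by nlinarith
  have e1 : (q:ℝ)/(40976*h) * ((h:ℝ)*q/4) = (q:ℝ)^2/163904 := by field_simp; norm_num
  have e2 : 2*((q:ℝ)/(40976*h))^2*(2561*(h:ℝ)^2) = (q:ℝ)^2/327808 := by field_simp; norm_num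
  have := mul_le_mul_of_nonneg_left g1 (by positivity : 0 ≤ (q:ℝ)/(40976*h))
  rw [e1] at this
  rw [e2]
  linarith

lemma inner_n (hW : IsIIDCombWalks P W) (n q : ℕ) (hq : 18 ≤ q) :
    P {ω | ¬ DF (n-2*q) ⊆ CL W (DF n).card ω} ≤ ENNReal.ofReal (4*n*Real.exp (-((q:ℝ)^2/327808))) := by
  set S : Finset Z2 := (cols (n-2*q)).image (fun x => (x,(LL ((n - x.natAbs)-q):ℤ))) ∪
    (cols (n-2*q)).image (fun x => (x,-(LL ((n - x.natAbs)-q):ℤ))) with hS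
  have hsub : {ω | ¬ DF (n-2*q) ⊆ CL W (DF n).card ω} ≤ᵐ[P] ⋃ z ∈ S, {ω | z ∉ CL W (DF n).card ω} := by
    filter_upwards [iid_good hW] with ω hω hns
    have hpc : PClosed (CL W (DF n).card ω) := clF_pclosed hω _
    by_contra hcon
    apply hns
    have hall : ∀ z ∈ S, z ∈ CL W (DF n).card ω := by
      intro z hz
      by_contra h
      exact hcon (Set.mem_biUnion (x := z) hz h)
    rintro ⟨x,y⟩ hxy
    have hx := (mem_DF'.1 hxy).1
    have hy := (mem_DF'.1 hxy).2
    rw [Int.abs_eq_natAbs] at hx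
    rw [Int.abs_eq_natAbs x] at hy
    have hcol : x ∈ cols (n-2*q) := mem_cols.2 (by rw [Int.abs_eq_natAbs]; exact hx)
    have hy' : y.natAbs ≤ LL ((n - x.natAbs)-q) := by
      have h1 : 3*|y| < (((n - x.natAbs)-q : ℕ):ℤ)^2 := by
        refine hy.trans_le ?_
        apply pow_le_pow_left₀ (by omega); omega
      have := (LL_lt _ y).2 h1
      rw [Int.abs_eq_natAbs] at this
      omega
    rcases le_total 0 y with h0 | h0
    · have := hall (x,(LL ((n - x.natAbs)-q):ℤ)) (Finset.mem_union_left _ (Finset.mem_image_of_mem _ hcol))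
      have := hpc.down x y.natAbs _ hy' this
      rwa [show ((y.natAbs:ℕ):ℤ) = y by omega] at this
    · have := hall (x,-(LL ((n - x.natAbs)-q):ℤ)) (Finset.mem_union_right _ (Finset.mem_image_of_mem _ hcol))
      have := hpc.up x y.natAbs _ hy' this
      rwa [show -((y.natAbs:ℕ):ℤ) = y by omega] at this
  have hcard : S.card ≤ 4*n := by
    refine (Finset.card_union_le _ _).trans ?_
    have h1 : (cols (n-2*q)).card ≤ 2*n := by
      unfold cols; rw [Int.card_Ico]; omega
    have := Finset.card_image_le (s := cols (n-2*q)) (f := fun x => ((x,(LL ((n - x.natAbs)-q):ℤ)):Z2))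
    have := Finset.card_image_le (s := cols (n-2*q)) (f := fun x => ((x,-(LL ((n - x.natAbs)-q):ℤ)):Z2))
    omega
  refine (measure_mono_ae hsub).trans ((measure_biUnion_finset_le _ _).trans ?_)
  have hz : ∀ z ∈ S, P {ω | z ∉ CL W (DF n).card ω} ≤ ENNReal.ofReal (Real.exp (-((q:ℝ)^2/327808))) := by
    intro z hz
    have : ∃ x ∈ cols (n-2*q), z = (x,(LL ((n - x.natAbs)-q):ℤ)) ∨ z = (x,-(LL ((n - x.natAbs)-q):ℤ)) := by
      rw [hS, Finset.mem_union, Finset.mem_image, Finset.mem_image] at hz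
      rcases hz with ⟨x,hx,rfl⟩ | ⟨x,hx,rfl⟩
      · exact ⟨x,hx,Or.inl rfl⟩
      · exact ⟨x,hx,Or.inr rfl⟩
    obtain ⟨x,hx,hzx⟩ := this
    have hx := mem_cols.1 hx
    rw [Int.abs_eq_natAbs] at hx
    rcases hzx with rfl | rfl
    · exact inner_site hW n q (n - x.natAbs) x _ (by rw [Int.abs_eq_natAbs]; omega) hq (by omega) (by simp)
    · exact inner_site hW n q (n - x.natAbs) x _ (by rw [Int.abs_eq_natAbs]; omega) hq (by omega) (by simp)
  refine (Finset.sum_le_sum hz).trans ?_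
  rw [Finset.sum_const, nsmul_eq_mul, ENNReal.ofReal_mul (by positivity)]
  gcongr
  rw [show (4*(n:ℝ)) = ((4*n:ℕ):ℝ) by push_cast; ring, ENNReal.ofReal_natCast]
  exact_mod_cast hcard

/-- `rr n = ⌈√(log n)⌉` -/
noncomputable def rr (n : ℕ) : ℕ := ⌈Real.sqrt (Real.log n)⌉₊

lemma exp_rr (n : ℕ) (hn : 1 ≤ n) (a : ℝ) (ha : 0 ≤ a) : Real.exp (-(a * (rr n:ℝ)^2)) ≤ (n:ℝ)^(-a) := by
  have hn0 : (0:ℝ) < n := by exact_mod_cast hn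
  have hl : 0 ≤ Real.log n := Real.log_natCast_nonneg n
  rw [Real.rpow_def_of_pos hn0]
  apply Real.exp_le_exp.2
  have : Real.log n ≤ (rr n:ℝ)^2 := by
    have := Nat.le_ceil (Real.sqrt (Real.log n))
    calc Real.log n = (Real.sqrt (Real.log n))^2 := (Real.sq_sqrt hl).symm
      _ ≤ _ := pow_le_pow_left₀ (Real.sqrt_nonneg _) this 2
  nlinarith

lemma rr_pos (n : ℕ) (hn : 2 ≤ n) : 1 ≤ rr n := by
  unfold rr
  apply Nat.one_le_iff_ne_zero.2
  apply (Nat.ceil_pos.2 ?_).ne'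
  apply Real.sqrt_pos.2
  apply Real.log_pos
  exact_mod_cast (by omega : 1 < n)

lemma rr_mono {m n : ℕ} (hm : 1 ≤ m) (h : m ≤ n) : rr m ≤ rr n := by
  unfold rr
  apply Nat.ceil_mono
  apply Real.sqrt_le_sqrt
  apply Real.log_le_log (by exact_mod_cast hm)
  exact_mod_cast h

theorem inner_ae (hW : IsIIDCombWalks P W) :
    ∀ᵐ ω ∂P, ∃ N : ℕ, ∀ n, N ≤ n → DF (n-2000*rr n) ⊆ CL W (DF n).card ω := by
  have := bc (P := P) (fun n => {ω | ¬ DF (n-2*(1000*rr n)) ⊆ CL W (DF n).card ω}) 2 4 (by norm_num) (by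
    intro n hn
    refine (inner_n hW n (1000*rr n) (by have := rr_pos n hn; omega)).trans (ENNReal.ofReal_le_ofReal ?_)
    have hn0 : (0:ℝ) < n := by exact_mod_cast (by omega : 0 < n)
    have h1 : Real.exp (-(((1000*rr n:ℕ):ℝ)^2/327808)) ≤ (n:ℝ)^(-(3:ℝ)) := by
      refine le_trans ?_ (exp_rr n (by omega) 3 (by norm_num))
      apply Real.exp_le_exp.2
      push_cast
      nlinarith [sq_nonneg (rr n:ℝ)]
    calc 4*(n:ℝ)*Real.exp (-(((1000*rr n:ℕ):ℝ)^2/327808)) ≤ 4*(n:ℝ)*(n:ℝ)^(-(3:ℝ)) := by gcongr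
      _ = 4/(n:ℝ)^2 := by
        rw [Real.rpow_neg hn0.le, show (3:ℝ) = ((3:ℕ):ℝ) by norm_num, Real.rpow_natCast]; field_simp)
  filter_upwards [this] with ω ⟨N, hN⟩
  refine ⟨N, fun n hn => ?_⟩
  have := hN n hn
  simp only [Set.mem_ofPred_eq, not_not] at this
  rwa [show 2*(1000*rr n) = 2000*rr n by ring] at this
end


/-- outer test function -/
noncomputable def PS (m y0 : ℕ) (x0 : ℤ) (f : ℤ → ℝ) (f0 : ℝ) (w : Z2) : ℝ :=
  if w.1 = x0 ∧ 0 < w.2 then f0 + (1-f0)*w.2/y0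
  else f0 * f w.1 * (1 - 3*|(w.2:ℝ)|/((m:ℝ)-|(w.1:ℝ)|)^2)

noncomputable def STD (m : ℕ) (f : ℤ → ℝ) (f0 : ℝ) (w : Z2) : ℝ :=
  f0 * f w.1 * (1 - 3*|(w.2:ℝ)|/((m:ℝ)-|(w.1:ℝ)|)^2)

lemma abs_lap {y : ℤ} (hy0 : y ≠ 0) : |(y:ℝ)+1| + |(y:ℝ)-1| = 2*|(y:ℝ)| := by
  rcases lt_or_gt_of_ne hy0 with h | h
  · have : (y:ℝ)+1 ≤ 0 := by exact_mod_cast h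
    rw [abs_of_nonpos this, abs_of_nonpos (by linarith), abs_of_nonpos (by linarith)]; ring
  · have : (1:ℝ) ≤ y := by exact_mod_cast h
    rw [abs_of_nonneg (by linarith), abs_of_nonneg (by linarith), abs_of_nonneg (by linarith)]; ring

lemma col_ge (s' : ℕ) (s : ℝ) (hs' : 1 ≤ s') (hss : (s':ℝ) ≤ s) :
    2*(s':ℝ)^2/3 - (s':ℝ)^4/(3*s^2) - 1 ≤ (2*(LL s':ℝ)-1) - 3/s^2*(LL s'*(LL s'-1)) := by
  obtain ⟨h1,h2⟩ := LL_bounds s'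
  have hs1 : (1:ℝ) ≤ s' := by exact_mod_cast hs'
  have hs0 : 0 < s := by linarith
  set l' := (s':ℝ)^2/3 with hl'
  set l := s^2/3 with hl
  have hl0 : 0 < l := by positivity
  have hll : l' ≤ l := by rw [hl, hl']; nlinarith
  have hl'0 : 0 < l' := by rw [hl']; nlinarith
  set e := (LL s':ℝ) - l' with he
  have eL : (LL s':ℝ) = l' + e := by rw [he]; ring
  rw [eL] at *
  have e1 : (s':ℝ)^4/(3*s^2) = l'^2/l := by rw [hl, hl']; field_simp
  have e2 : 3/s^2*((l'+e)*(l'+e-1)) = ((l'+e)*(l'+e-1))/l := by rw [hl]; field_simp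
  have e3 : 2*(s':ℝ)^2/3 = 2*l' := by rw [hl']; ring
  rw [e1, e2, e3]
  have : ((l'+e)*(l'+e-1))/l ≤ l'^2/l + 2*e := by
    have e4 : (l'^2/l + 2*e)*l = l'^2 + 2*e*l := by field_simp
    rw [div_le_iff₀ hl0, e4]
    nlinarith [mul_nonneg (by linarith : 0 ≤ e) (sub_nonneg.2 hll)]
  linarith

lemma DF_nbr {m : ℕ} {x y : ℤ} {w : Z2} (h : (x,y) ∈ DF m) (ha : combAdj (x,y) w) (f : ℤ → ℝ)
    (hz : ∀ x : ℤ, (m:ℤ) ≤ |x| → f x = 0) (h0 : ∀ x, 0 ≤ f x) (h1 : ∀ x, f x ≤ 1) :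
    -2 ≤ f w.1 * (1 - 3*|(w.2:ℝ)|/((m:ℝ)-|(w.1:ℝ)|)^2) := by
  obtain ⟨hx, hy⟩ := mem_DF'.1 h
  obtain ⟨x', y'⟩ := w
  by_cases hx' : |x'| < m
  · have key : |y'| ≤ |y| + 1 ∧ (x' = x ∨ y' = 0) := by
      rcases ha with ⟨h1,h2⟩ | ⟨h1,h2,h3⟩
      · simp only at h1 h2
        refine ⟨?_, Or.inl h1.symm⟩
        have := abs_sub_abs_le_abs_sub y' y
        rw [abs_sub_comm] at h2; linarith
      · simp only at h2
        refine ⟨by rw [h2]; simp; positivity, Or.inr h2⟩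
    have hsp : (1:ℝ) ≤ (m:ℝ)-|(x':ℝ)| := by
      rw [← Int.cast_abs]
      have : (1:ℤ) ≤ m - |x'| := by omega
      exact_mod_cast this
    have hq : (1:ℝ) ≤ ((m:ℝ)-|(x':ℝ)|)^2 := by nlinarith
    have : 3*|(y':ℝ)|/((m:ℝ)-|(x':ℝ)|)^2 ≤ 3 := by
      rw [div_le_iff₀ (by linarith)]
      rcases key.2 with h5 | h5
      · subst h5
        have h6 : 3*|(y':ℝ)| ≤ 3*|(y:ℝ)| + 3 := by
          rw [← Int.cast_abs, ← Int.cast_abs]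
          have := key.1
          exact_mod_cast (by omega : 3*|y'| ≤ 3*|y| + 3)
        have h7 : 3*|(y:ℝ)| + 1 ≤ ((m:ℝ)-|(x':ℝ)|)^2 := by
          rw [← Int.cast_abs, ← Int.cast_abs]; exact_mod_cast hy
        nlinarith
      · rw [h5]; simp; positivity
    have := h0 x'; have := h1 x'
    simp only
    nlinarith
  · simp only
    rw [hz x' (by omega)]; simp

section outer
variable {m h : ℕ} {x0 : ℤ} {f : ℤ → ℝ} {κ f0 : ℝ}

lemma STD_harm (H : Axis m h x0 f κ) {w : Z2} (hw : w ∈ DF m) (hx : w.1 ≠ x0 ∨ w.2 ≠ 0) :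
    cavg (STD m f f0) w = STD m f f0 w := by
  obtain ⟨x,y⟩ := w
  have hxm := (mem_DF'.1 hw).1
  unfold cavg STD
  by_cases hy : y = 0
  · subst hy
    simp only at hx
    have e1 := H.recu x hxm (by simpa using hx)
    have e5 : f (x-1) = (2 + 6/((m:ℝ)-|(x:ℝ)|)^2) * f x - f (x+1) := by linarith
    simp [e5]; ring
  · rw [if_neg hy]
    simp only
    push_cast
    have h5 := abs_lap hy
    have : |(y:ℝ)+1| = 2*|(y:ℝ)| - |(y:ℝ)-1| := by linarith
    rw [this]; ring

lemma PS_tooth {y0 : ℕ} {w : Z2} (hxy : ¬ (w.1 = x0 ∧ 0 < w.2)) :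
    PS m y0 x0 f f0 w = STD m f f0 w := by
  unfold PS STD; rw [if_neg hxy]

lemma PS_ramp {y0 : ℕ} (y : ℤ) (h0 : 0 ≤ y) (H : Axis m h x0 f κ) :
    PS m y0 x0 f f0 (x0,y) = f0 + (1-f0)*y/y0 := by
  rcases eq_or_lt_of_le h0 with h | h
  · subst h; rw [PS_tooth (by simp), STD, H.one]; simp
  · unfold PS; rw [if_pos ⟨rfl, h⟩]

lemma PS_harm {y0 : ℕ} (H : Axis m h x0 f κ) (R : Ramp h y0 κ f0) {w : Z2} (hw : w ∈ DF m) :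
    cavg (PS m y0 x0 f f0) w = PS m y0 x0 f f0 w := by
  by_cases hc : w.1 = x0 ∧ 0 ≤ w.2
  · obtain ⟨x,y⟩ := w
    obtain ⟨rfl, hy⟩ := hc
    simp only at hy ⊢
    rcases eq_or_lt_of_le hy with h | h
    · subst h
      unfold cavg
      simp only [if_true]
      rw [PS_tooth (by simp), PS_tooth (by simp), PS_tooth (w := (x,-1)) (by simp), PS_ramp 1 (by norm_num) H, PS_ramp 0 le_rfl H]
      unfold STD
      simp only
      rw [H.habs, H.one]
      have e5 : f (x-1) = 2 + 6/(h:ℝ)^2 - κ - f (x+1) := by linarith [H.rec0]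
      rw [e5]
      norm_num
      have e6 : f0*κ = (1-f0)/y0 + f0*(3/(h:ℝ)^2) := by rw [mul_comm, R.eq]; ring
      have e7 : f0 * (6/(h:ℝ)^2) = 2*(f0*(3/(h:ℝ)^2)) := by ring
      nlinarith
    · unfold cavg
      rw [if_neg (by simp only; omega)]
      simp only
      rw [PS_ramp y hy H, PS_ramp (y+1) (by omega) H, PS_ramp (y-1) (by omega) H]
      push_cast; ring
  · have := STD_harm (f0 := f0) H hw (by by_contra hh; push Not at hh; exact hc ⟨hh.1, by omega⟩)
    rw [PS_tooth (by omega), ← this]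
    unfold cavg
    by_cases hy : w.2 = 0
    · have hx : w.1 ≠ x0 := by intro hx; exact hc ⟨hx, by omega⟩
      rw [if_pos hy, if_pos hy]
      rw [PS_tooth (by simp), PS_tooth (by simp), PS_tooth (by simp [hx]), PS_tooth (by simp)]
    · rw [if_neg hy, if_neg hy]
      rw [PS_tooth (by simp only; omega), PS_tooth (by simp only; omega)]

lemma STD_nn (H : Axis m h x0 f κ) (hf0 : 0 ≤ f0) {w : Z2} (hw : w ∈ DF m) : 0 ≤ STD m f f0 w := by
  obtain ⟨x,y⟩ := w
  obtain ⟨h1,h2⟩ := mem_DF'.1 hw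
  have := lin_pos h1 h2
  have := H.nn x
  unfold STD; simp only; positivity

lemma STD_le (H : Axis m h x0 f κ) (hf0 : 0 ≤ f0) (w : Z2) : STD m f f0 w ≤ f0 * f w.1 := by
  have : 0 ≤ 3*|(w.2:ℝ)|/((m:ℝ)-|(w.1:ℝ)|)^2 := by positivity
  have := H.nn w.1
  unfold STD
  exact mul_le_of_le_one_right (by positivity) (by linarith)

lemma Axis.sum_DF_sq (H : Axis m h x0 f κ) : ∑ w ∈ DF m, (f0 * f w.1)^2 ≤ f0^2 * (10*(h:ℝ)^3) := by
  rw [sum_DF]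
  refine le_trans ?_ (mul_le_mul_of_nonneg_left H.sum_sq_le (sq_nonneg f0))
  rw [Finset.mul_sum]
  apply Finset.sum_le_sum
  intro x hx
  simp only [Finset.sum_const, nsmul_eq_mul]
  have hs := hgt_pos hx
  have hc : ((Finset.Ioo (-(LL (hgt m x):ℤ)) (LL (hgt m x))).card : ℝ) ≤ ((m:ℝ)-|(x:ℝ)|)^2 := by
    rw [Int.card_Ioo, ← hgt_cast (mem_cols.1 hx)]
    have : ((LL (hgt m x):ℤ) - (-(LL (hgt m x):ℤ)) - 1).toNat ≤ (hgt m x)^2 := by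
      unfold LL
      have : 1 ≤ (hgt m x)^2 := Nat.one_le_pow _ _ hs
      omega
    exact_mod_cast this
  calc _ ≤ ((m:ℝ)-|(x:ℝ)|)^2 * (f0 * f x)^2 := mul_le_mul_of_nonneg_right hc (sq_nonneg _)
    _ = _ := by ring

lemma cols_mono {n' m : ℕ} (h : n' ≤ m) : cols n' ⊆ cols m := by
  intro x hx; rw [mem_cols] at *; omega

lemma DF_mono {n' m : ℕ} (h : n' ≤ m) : DF n' ⊆ DF m := by
  rintro ⟨x,y⟩ hx; rw [mem_DF'] at *
  refine ⟨by omega, hx.2.trans_le ?_⟩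
  apply pow_le_pow_left₀ (by omega); omega

/-- sum of the standard function over `DF n'` -/
lemma STD_sum (H : Axis m h x0 f κ) (hf0 : 0 ≤ f0) (n' : ℕ) (h1 : 1 ≤ n') (hn : n' ≤ m) :
    f0 * ((4/9*(n':ℝ)^3+4/9*n') * f 0 - κ * (if x0 < n' then ((n':ℝ)-x0)^4 else 0)/18 - 1/9 - 50/9*h)
      ≤ ∑ w ∈ DF n', STD m f f0 w := by
  have c1 : ∑ x ∈ cols n', f0 * f x * (2*((n':ℝ)-|(x:ℝ)|)^2/3 - ((n':ℝ)-|(x:ℝ)|)^4/(3*((m:ℝ)-|(x:ℝ)|)^2) - 1)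
      ≤ ∑ w ∈ DF n', STD m f f0 w := by
    rw [sum_DF]
    apply Finset.sum_le_sum
    intro x hx
    have hs := hgt_pos hx
    have := sum_Ioo_abs (f0 * f x) (f0 * f x * (3/((m:ℝ)-|(x:ℝ)|)^2)) (LL (hgt n' x)) (LL_pos hs)
    have e : ∑ y ∈ Finset.Ioo (-(LL (hgt n' x):ℤ)) (LL (hgt n' x)), STD m f f0 (x,y)
        = ∑ y ∈ Finset.Ioo (-(LL (hgt n' x):ℤ)) (LL (hgt n' x)), (f0 * f x - f0 * f x * (3/((m:ℝ)-|(x:ℝ)|)^2) * |(y:ℝ)|) := by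
      apply Finset.sum_congr rfl
      intro y hy
      unfold STD; simp only; ring
    rw [e, this]
    have hmn : (n':ℝ) ≤ m := by exact_mod_cast hn
    have hc := col_ge (hgt n' x) ((m:ℝ)-|(x:ℝ)|) hs (by rw [hgt_cast (mem_cols.1 hx)]; linarith)
    rw [hgt_cast (mem_cols.1 hx)] at hc
    have := mul_le_mul_of_nonneg_left hc (mul_nonneg hf0 (H.nn x))
    refine this.trans (le_of_eq ?_)
    ring
  refine le_trans ?_ c1
  have g := H.green n' h1 hn
  have e1 : ∑ x ∈ cols n', f0 * f x * (2*((n':ℝ)-|(x:ℝ)|)^2/3 - ((n':ℝ)-|(x:ℝ)|)^4/(3*((m:ℝ)-|(x:ℝ)|)^2) - 1)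
      = f0 * ((1/18) * ∑ x ∈ cols n', f x * (12*((n':ℝ)-|(x:ℝ)|)^2 + 2 - 6*((n':ℝ)-|(x:ℝ)|)^4/((m:ℝ)-|(x:ℝ)|)^2)
      - (10/9) * ∑ x ∈ cols n', f x) := by
    rw [Finset.mul_sum, Finset.mul_sum, ← Finset.sum_sub_distrib, Finset.mul_sum]
    apply Finset.sum_congr rfl
    intro x hx
    have h1 := hgt_pos hx
    have h2 := hgt_cast (mem_cols.1 hx)
    have : 0 < (m:ℝ)-|(x:ℝ)| := by
      have : (n':ℝ) ≤ m := by exact_mod_cast hn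
      have : (1:ℝ) ≤ (hgt n' x:ℝ) := by exact_mod_cast h1
      linarith
    field_simp; ring
  rw [e1]
  apply mul_le_mul_of_nonneg_left _ hf0
  have hS : ∑ x ∈ cols n', f x ≤ 5*h :=
    (Finset.sum_le_sum_of_subset_of_nonneg (cols_mono hn) (fun x _ _ => H.nn x)).trans H.sum_le
  have := H.le1 n'
  have := H.le1 (-n')
  set X := if x0 < (n':ℤ) then ((n':ℝ)-x0)^4 else 0
  linarith
end outer


section outer
variable {m h : ℕ} {x0 : ℤ} {f : ℤ → ℝ} {κ f0 : ℝ}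

lemma PS_bounds (H : Axis m h x0 f κ) (R : Ramp h (LL h) κ f0) {w : Z2} (hw : w ∈ insert (x0,((LL h:ℕ):ℤ)) (DF m)) :
    0 ≤ PS m (LL h) x0 f f0 w ∧ PS m (LL h) x0 f f0 w ≤ 1 := by
  have hpos := R.pos
  have hle := R.le1
  have hL := LL_pos H.h1
  have hLr : (1:ℝ) ≤ LL h := by exact_mod_cast hL
  by_cases hc : w.1 = x0 ∧ 0 < w.2
  · obtain ⟨x,y⟩ := w
    obtain ⟨rfl, hy⟩ := hc
    simp only at hy
    rw [PS_ramp y hy.le H]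
    have hyL : y ≤ LL h := by
      rcases Finset.mem_insert.1 hw with h1 | h1
      · exact le_of_eq (Prod.mk.inj h1).2
      · have := (mem_DF'.1 h1).2
        have h2 := H.hn
        rw [abs_of_nonneg H.x0n, show (m:ℤ) - x = h by omega, ← LL_lt] at this
        exact (le_abs_self y).trans this.le
    have : (0:ℝ) < y := by exact_mod_cast hy
    have : (y:ℝ) ≤ LL h := by exact_mod_cast hyL
    have e : (1-f0)*y/(LL h:ℝ) ≤ 1-f0 := by rw [div_le_iff₀ (by linarith)]; nlinarith
    have e2 : 0 ≤ (1-f0)*y/(LL h:ℝ) := by apply div_nonneg _ (by linarith); nlinarith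
    constructor <;> linarith
  · rw [PS_tooth hc]
    have hD : w ∈ DF m := by
      rcases Finset.mem_insert.1 hw with h1 | h1
      · exact absurd ⟨by rw [h1], by rw [h1]; simp only; omega⟩ hc
      · exact h1
    refine ⟨STD_nn H hpos.le hD, (STD_le H hpos.le w).trans ?_⟩
    have := H.le1 w.1; have := H.nn w.1
    nlinarith

lemma PS_ge (H : Axis m h x0 f κ) (R : Ramp h (LL h) κ f0) {w w' : Z2} (hw : w ∈ DF m) (ha : combAdj w w') :
    -2 ≤ PS m (LL h) x0 f f0 w' := by
  have hpos := R.pos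
  have hle := R.le1
  by_cases hc : w'.1 = x0 ∧ 0 < w'.2
  · have : (0:ℝ) < w'.2 := by exact_mod_cast hc.2
    have e2 : 0 ≤ (1-f0)*w'.2/(LL h:ℝ) := by apply div_nonneg _ (by positivity); nlinarith
    unfold PS; rw [if_pos hc]; linarith
  · rw [PS_tooth hc]
    have := DF_nbr (x := w.1) (y := w.2) hw ha (fun x => f0 * f x) (fun x hx => by simp [H.zero x hx])
      (fun x => mul_nonneg hpos.le (H.nn x)) (fun x => by have := H.le1 x; have := H.nn x; nlinarith)
    exact this

noncomputable def rampF (x0 : ℤ) (y0 : ℕ) : Finset Z2 := (Finset.Ico (1:ℤ) (y0+1)).image (fun y => (x0,y))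

lemma sum_rampF (x0 : ℤ) (y0 : ℕ) (g : Z2 → ℝ) : ∑ w ∈ rampF x0 y0, g w = ∑ y ∈ Finset.Ico (1:ℤ) (y0+1), g (x0,y) := by
  unfold rampF
  rw [Finset.sum_image]
  intro a _ b _ hab
  exact (Prod.mk.inj hab).2

lemma mem_rampF {x0 : ℤ} {y0 : ℕ} {w : Z2} : w ∈ rampF x0 y0 ↔ w.1 = x0 ∧ 0 < w.2 ∧ w.2 ≤ y0 := by
  unfold rampF
  rw [Finset.mem_image]
  constructor
  · rintro ⟨y, hy, rfl⟩; rw [Finset.mem_Ico] at hy; exact ⟨rfl, by simp only; omega, by simp only; omega⟩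
  · rintro ⟨h1,h2,h3⟩; exact ⟨w.2, by rw [Finset.mem_Ico]; omega, Prod.ext h1.symm rfl⟩

lemma PS_sum (H : Axis m h x0 f κ) (R : Ramp h (LL h) κ f0) (n' : ℕ) (h1 : 1 ≤ n') (hn : n' ≤ m) (hf0 : f0*h ≤ 6)
    (u : ℝ) (hu0 : 0 ≤ u) (huh : u ≤ h) (hud : u ≤ (m:ℝ)-n') :
    (4/9*(n':ℝ)^3) * (f0 * f 0) + h*u/6 - 34 ≤ ∑ w ∈ DF n' ∪ rampF x0 (LL h), PS m (LL h) x0 f f0 w := by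
  have hpos := R.pos
  have hle := R.le1
  have hL := LL_pos H.h1
  have hLr : (1:ℝ) ≤ LL h := by exact_mod_cast hL
  have hhr : (1:ℝ) ≤ h := by exact_mod_cast H.h1
  obtain ⟨hl1, hl2⟩ := LL_bounds h
  have e1 : ∑ w ∈ DF n' ∪ rampF x0 (LL h), PS m (LL h) x0 f f0 w =
      ∑ w ∈ DF n' \ rampF x0 (LL h), PS m (LL h) x0 f f0 w + ∑ w ∈ rampF x0 (LL h), PS m (LL h) x0 f f0 w := by
    rw [← Finset.sum_union Finset.sdiff_disjoint, Finset.sdiff_union_self_eq_union]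
  have e2 : ∑ w ∈ DF n' \ rampF x0 (LL h), PS m (LL h) x0 f f0 w = ∑ w ∈ DF n' \ rampF x0 (LL h), STD m f f0 w := by
    apply Finset.sum_congr rfl
    intro w hw
    rw [Finset.mem_sdiff, mem_rampF] at hw
    apply PS_tooth
    rintro ⟨hx, hy⟩
    apply hw.2
    refine ⟨hx, hy, ?_⟩
    have hm := DF_mono hn hw.1
    obtain ⟨x,y⟩ := w
    have := (mem_DF'.1 hm).2
    have h2 := H.hn
    simp only at hx hy ⊢
    subst hx
    rw [abs_of_nonneg H.x0n, show (m:ℤ) - x = h by omega, ← LL_lt] at this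
    exact (le_abs_self y).trans this.le
  have e3 : ∑ w ∈ DF n' \ rampF x0 (LL h), STD m f f0 w = ∑ w ∈ DF n', STD m f f0 w - ∑ w ∈ DF n' ∩ rampF x0 (LL h), STD m f f0 w := by
    rw [← Finset.sum_sdiff (Finset.inter_subset_left (s₁ := DF n') (s₂ := rampF x0 (LL h))), Finset.sdiff_inter_self_left]
    ring
  have e4 : ∑ w ∈ DF n' ∩ rampF x0 (LL h), STD m f f0 w ≤ f0*(h:ℝ)^2/6 := by
    have a1 : ∑ w ∈ DF n' ∩ rampF x0 (LL h), STD m f f0 w ≤ ∑ w ∈ (Finset.Ico (1:ℤ) (LL h)).image (fun y => (x0,y)), STD m f f0 w := by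
      have hmem : ∀ w : Z2, w ∈ (Finset.Ico (1:ℤ) (LL h)).image (fun y => (x0,y)) → w ∈ DF m := by
        intro w hw
        obtain ⟨y, hy, rfl⟩ := Finset.mem_image.1 hw
        rw [Finset.mem_Ico] at hy
        rw [mem_DF']
        refine ⟨H.x0lt, ?_⟩
        have h2 := H.hn
        rw [abs_of_nonneg H.x0n, show (m:ℤ) - x0 = h by omega, ← LL_lt, abs_of_pos (by omega)]
        exact hy.2
      apply Finset.sum_le_sum_of_subset_of_nonneg
      · intro w hw
        rw [Finset.mem_inter, mem_rampF] at hw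
        have hm := DF_mono hn hw.1
        obtain ⟨x,y⟩ := w
        obtain ⟨hw1, hx, hy, hy2⟩ := hw
        have := (mem_DF'.1 hm).2
        have h2 := H.hn
        simp only at hx hy hy2
        subst hx
        rw [abs_of_nonneg H.x0n, show (m:ℤ) - x = h by omega, ← LL_lt, abs_of_pos hy] at this
        exact Finset.mem_image.2 ⟨y, by rw [Finset.mem_Ico]; omega, rfl⟩
      · intro w hw _
        exact STD_nn H hpos.le (hmem w hw)
    refine a1.trans ?_
    rw [Finset.sum_image (fun a _ b _ hab => (Prod.mk.inj hab).2)]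
    rw [tele (fun y => f0*((y:ℝ) - 3/(h:ℝ)^2*(y*(y-1))/2)) _ _ _ (by omega)]
    · have := mul_le_mul_of_nonneg_left (half_col_le h H.h1) hpos.le
      push_cast
      simp only [sub_self, mul_zero, zero_div, sub_zero]
      linarith
    · intro y hy1 _
      unfold STD
      simp only
      rw [H.habs, H.one, abs_of_pos (by exact_mod_cast hy1)]
      push_cast; ring
  have e5 : ∑ w ∈ rampF x0 (LL h), PS m (LL h) x0 f f0 w = f0*(LL h) + (1-f0)*(LL h+1)/2 := by
    rw [sum_rampF, tele (fun y => f0*y + (1-f0)*(y*(y-1))/(2*(LL h:ℝ))) _ _ _ (by omega)]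
    · push_cast; field_simp; ring
    · intro y hy1 hy2
      rw [PS_ramp y (by omega) H]
      push_cast; field_simp; ring
  have e6 := STD_sum H hpos.le n' h1 hn
  set X := if x0 < (n':ℤ) then ((n':ℝ)-x0)^4 else 0 with hX
  have hXle : X ≤ (h:ℝ)^3*(h-u) := by
    rw [hX]
    split_ifs with hlt
    · have a1 : (0:ℝ) < (n':ℝ)-x0 := by
        have : (x0:ℝ) < n' := by exact_mod_cast hlt
        linarith
      have a2 : (x0:ℝ)+h = m := by exact_mod_cast H.hn
      have a3 : (n':ℝ)-x0 ≤ h-u := by linarith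
      calc ((n':ℝ)-x0)^4 = ((n':ℝ)-x0)^3*((n':ℝ)-x0) := by ring
        _ ≤ (h:ℝ)^3*(h-u) := by
          apply mul_le_mul _ a3 a1.le (by positivity)
          apply pow_le_pow_left₀ a1.le; linarith
    · apply mul_nonneg (by positivity); linarith
  have hX0 : 0 ≤ X := by rw [hX]; split_ifs <;> positivity
  have hk : κ*f0*X ≤ 3*h*(h-u) := by
    have : κ*f0 ≤ 3/(h:ℝ)^2 := by
      rw [R.eq]
      have : (1-f0)/(LL h:ℝ) ≤ (1-f0)*(3/(h:ℝ)^2) := by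
        rw [div_eq_mul_inv]
        apply mul_le_mul_of_nonneg_left _ (by linarith)
        rw [inv_eq_one_div, div_le_div_iff₀ (by linarith) (by positivity)]
        linarith
      calc _ ≤ (1-f0)*(3/(h:ℝ)^2) + 3*f0/(h:ℝ)^2 := by linarith
        _ = _ := by ring
    calc κ*f0*X ≤ 3/(h:ℝ)^2*X := mul_le_mul_of_nonneg_right this hX0
      _ ≤ 3/(h:ℝ)^2*((h:ℝ)^3*(h-u)) := mul_le_mul_of_nonneg_left hXle (by positivity)
      _ = _ := by field_simp
  rw [e1, e2, e3, e5]
  have hn0 : (0:ℝ) ≤ n' := by positivity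
  have h00 := H.nn 0
  have e7 : 0 ≤ f0 * (4/9*n' * f 0) := by positivity
  have e8 : f0 * ((4/9*(n':ℝ)^3+4/9*n') * f 0 - κ * X/18 - 1/9 - 50/9*h) =
    (4/9*(n':ℝ)^3) * (f0 * f 0) + f0 * (4/9*n' * f 0) - κ*f0*X/18 - f0/9 - 50/9*(f0*h) := by ring
  rw [e8] at e6
  have e9 : (1+f0)*((h:ℝ)^2/3)/2 ≤ (1+f0)*(LL h:ℝ)/2 := by nlinarith
  nlinarith

lemma PS_sq (H : Axis m h x0 f κ) (R : Ramp h (LL h) κ f0) (n' : ℕ) (hn : n' ≤ m) (hf0 : f0*h ≤ 6) :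
    ∑ w ∈ DF n' ∪ rampF x0 (LL h), (PS m (LL h) x0 f f0 w)^2 ≤ 361*(h:ℝ)^2 := by
  have hpos := R.pos
  have hle := R.le1
  have hhr : (1:ℝ) ≤ h := by exact_mod_cast H.h1
  obtain ⟨hl1, hl2⟩ := LL_bounds h
  have c1 : ∑ w ∈ DF n' ∪ rampF x0 (LL h), (PS m (LL h) x0 f f0 w)^2 ≤
      ∑ w ∈ DF m ∪ rampF x0 (LL h), ((if w ∈ DF m then (f0 * f w.1)^2 else 0) + if w ∈ rampF x0 (LL h) then 1 else 0) := by
    refine le_trans (Finset.sum_le_sum_of_subset_of_nonneg (Finset.union_subset_union_left (DF_mono hn)) (fun w _ _ => sq_nonneg _)) ?_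
    apply Finset.sum_le_sum
    intro w hw
    by_cases hr : w ∈ rampF x0 (LL h)
    · rw [if_pos hr]
      have hmem : w ∈ insert (x0,((LL h:ℕ):ℤ)) (DF m) := by
        obtain ⟨x,y⟩ := w
        obtain ⟨hx, hy, hy2⟩ := mem_rampF.1 hr
        simp only at hx hy hy2
        subst hx
        rw [Finset.mem_insert]
        rcases eq_or_lt_of_le hy2 with h4 | h4
        · left; rw [h4]
        · right
          rw [mem_DF']
          refine ⟨H.x0lt, ?_⟩
          have h2 := H.hn
          rw [abs_of_nonneg H.x0n, show (m:ℤ) - x = h by omega, ← LL_lt, abs_of_pos (by omega)]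
          exact h4
      have := PS_bounds H R hmem
      have : (0:ℝ) ≤ if w ∈ DF m then (f0 * f w.1)^2 else 0 := by split_ifs <;> positivity
      nlinarith
    · have hD : w ∈ DF m := (Finset.mem_union.1 hw).resolve_right hr
      rw [if_neg hr, if_pos hD, add_zero]
      have hc : ¬ (w.1 = x0 ∧ 0 < w.2) := by
        rintro ⟨hx, hy⟩
        apply hr
        obtain ⟨x,y⟩ := w
        have := (mem_DF'.1 hD).2
        have h2 := H.hn
        simp only at hx hy
        subst hx
        rw [abs_of_nonneg H.x0n, show (m:ℤ) - x = h by omega, ← LL_lt, abs_of_pos hy] at this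
        exact mem_rampF.2 ⟨rfl, hy, this.le⟩
      rw [PS_tooth hc]
      exact pow_le_pow_left₀ (STD_nn H hpos.le hD) (STD_le H hpos.le w) 2
  refine c1.trans ?_
  rw [Finset.sum_add_distrib, Finset.sum_ite_mem, Finset.sum_ite_mem, Finset.union_inter_cancel_left, Finset.union_inter_cancel_right]
  have a1 := H.sum_DF_sq (f0 := f0)
  have a2 : ∑ w ∈ rampF x0 (LL h), (1:ℝ) ≤ LL h := by
    rw [sum_rampF]; simp
  have a3 : f0^2 * (10*(h:ℝ)^3) ≤ 360 * h := by
    have : (f0*h)^2 ≤ 6^2 := pow_le_pow_left₀ (by positivity) hf0 2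
    nlinarith
  nlinarith

theorem outer_tooth {Ω : Type*} [mΩ : MeasurableSpace Ω] {P : Measure Ω} {W : ℕ → ℕ → Ω → Z2}
    (hW : IsIIDCombWalks P W) (m n' h T : ℕ) (x0 : ℤ) (hx0 : 0 ≤ x0) (hm : x0 + h = m) (h3 : 3 ≤ h) (h1 : 1 ≤ n')
    (hn : n' ≤ m) (t : ℝ) (ht : 0 ≤ t) (ht2 : t ≤ 1/3) (K : ℝ) (hT : (T:ℝ) ≤ 4/9*(n':ℝ)^3 + K) (hK : 0 ≤ K)
    (u : ℝ) (hu0 : 0 ≤ u) (huh : u ≤ h) (hud : u ≤ (m:ℝ)-n') :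
    P {ω | ((x0,((LL h:ℕ):ℤ)) ∈ CL W T ω ∧ DF n' ⊆ CL W T ω ∧ CL W T ω ⊆ insert (x0,((LL h:ℕ):ℤ)) (DF m)) ∧
      ∀ i < T, CL W i ω ⊆ DF m} ≤
      ENNReal.ofReal (Real.exp (-t*(h*u/6 - 12*K*h/(m:ℝ)^2 - 34) + 2*t^2*(361*(h:ℝ)^2))) := by
  obtain ⟨f, κ, H⟩ := axis_exists m h x0 hx0 hm (by omega)
  have hhr : (3:ℝ) ≤ h := by exact_mod_cast h3
  have hL := LL_pos H.h1
  have hLr : (1:ℝ) ≤ LL h := by exact_mod_cast hL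
  obtain ⟨hl1, hl2⟩ := LL_bounds h
  obtain ⟨f0, R, hf0⟩ := ramp_exists h (LL h) κ h3 hL H.kap (1/2) (by norm_num) (by
    have : (h:ℝ) * (1/h + 1/(LL h:ℝ) - 3/(h:ℝ)^2) = 1 + ((h:ℝ)^2 - 3*LL h)/(LL h*h) := by field_simp; ring
    rw [this]
    have : -(1/2) ≤ ((h:ℝ)^2 - 3*LL h)/(LL h*h) := by
      rw [le_div_iff₀ (by positivity)]; nlinarith
    linarith)
  have hpos := R.pos
  have hf0h : f0 * h ≤ 6 := by
    rw [le_div_iff₀ (by linarith)] at hf0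
    by_contra hc
    push Not at hc
    nlinarith [mul_le_mul_of_nonneg_right hf0 (by linarith : (0:ℝ) ≤ h)]
  set z : Z2 := (x0,((LL h:ℕ):ℤ)) with hz
  have h00 := H.nn 0
  have hmr : (1:ℝ) ≤ m := by exact_mod_cast h1.trans hn
  have hψ0 : PS m (LL h) x0 f f0 (0,0) = f0 * f 0 := by
    rw [PS_tooth (by simp)]; unfold STD; simp
  have hsum := PS_sum H R n' h1 hn hf0h u hu0 huh hud
  have hsq := PS_sq H R n' hn hf0h
  have hb := fun w hw => PS_bounds H R (w := w) hw
  set ψ := PS m (LL h) x0 f f0 with hψ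
  refine master hW (fun B => B ⊆ DF m) (fun w => max (1 + t * ψ w) 0) (1 + t*(f0 * f 0)) (by positivity)
    (fun B hB hG => ⟨fun w => 1 + t * ψ w, by simp only [hψ0]; exact le_rfl, by
        intro w hw
        rw [cavg_lin, PS_harm H R (hG hw)], by
        intro w hw w' ha
        have := PS_ge H R (hG hw) ha
        rw [← hψ] at this
        simp only; nlinarith, by
        intro w _; exact le_rfl⟩) T
    (fun B => z ∈ B ∧ DF n' ⊆ B ∧ B ⊆ insert z (DF m)) _ (fun w => le_max_right _ _) (Real.exp_pos _).le ?_
  rintro B hB hcard ⟨hzB, hnB, hBm⟩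
  have hsub : DF n' ∪ rampF x0 (LL h) ⊆ B := by
    apply Finset.union_subset hnB
    intro w hw
    obtain ⟨hx, hy, hy2⟩ := mem_rampF.1 hw
    have := hB.down x0 w.2.toNat (LL h) (by omega) hzB
    rw [Int.toNat_of_nonneg hy.le, ← hx] at this
    exact this
  have s1 : (1 + t*(f0 * f 0))^T ≤ Real.exp (T*(t*(f0*f 0))) := by
    rw [Real.exp_nat_mul]
    apply pow_le_pow_left₀ (by positivity)
    have := Real.add_one_le_exp (t*(f0*f 0)); linarith
  have s2 : Real.exp (∑ w ∈ B, (t*ψ w - 2*(t*ψ w)^2)) ≤ ∏ w ∈ B, max (1 + t * ψ w) 0 := by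
    rw [Real.exp_sum]
    apply Finset.prod_le_prod (fun w _ => (Real.exp_pos _).le)
    intro w hw
    refine le_trans (exp_quad _ ?_) (le_max_left _ _)
    have := (hb w (hBm hw)).1
    have : 0 ≤ t * ψ w := mul_nonneg ht this
    linarith
  have s3 : ∑ w ∈ DF n' ∪ rampF x0 (LL h), (t*ψ w - 2*(t*ψ w)^2) ≤ ∑ w ∈ B, (t*ψ w - 2*(t*ψ w)^2) := by
    apply Finset.sum_le_sum_of_subset_of_nonneg hsub
    intro w hw _
    obtain ⟨a,b⟩ := hb w (hBm hw)
    have : 0 ≤ t * ψ w := mul_nonneg ht a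
    have : t * ψ w ≤ 1/3 := by nlinarith
    nlinarith
  have s4 : ∑ w ∈ DF n' ∪ rampF x0 (LL h), (t*ψ w - 2*(t*ψ w)^2) =
      t * ∑ w ∈ DF n' ∪ rampF x0 (LL h), ψ w - 2*t^2 * ∑ w ∈ DF n' ∪ rampF x0 (LL h), (ψ w)^2 := by
    rw [Finset.mul_sum, Finset.mul_sum, ← Finset.sum_sub_distrib]
    apply Finset.sum_congr rfl; intro w _; ring
  refine s1.trans (le_trans ?_ (mul_le_mul_of_nonneg_left s2 (Real.exp_pos _).le))
  rw [← Real.exp_add]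
  apply Real.exp_le_exp.2
  refine le_trans ?_ (add_le_add_right s3 _)
  rw [s4]
  have k1 : (T:ℝ)*(f0*f 0) ≤ (4/9*(n':ℝ)^3) * (f0*f 0) + 12*K*h/(m:ℝ)^2 := by
    have a1 : f0 * f 0 ≤ 12*h/(m:ℝ)^2 := by
      calc f0 * f 0 ≤ f0 * (2*(h:ℝ)^2/(m:ℝ)^2) := mul_le_mul_of_nonneg_left H.f0_le hpos.le
        _ = (f0*h)*(2*h/(m:ℝ)^2) := by ring
        _ ≤ 6*(2*h/(m:ℝ)^2) := mul_le_mul_of_nonneg_right hf0h (by positivity)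
        _ = _ := by ring
    calc (T:ℝ)*(f0*f 0) ≤ (4/9*(n':ℝ)^3 + K)*(f0*f 0) := mul_le_mul_of_nonneg_right hT (by positivity)
      _ = (4/9*(n':ℝ)^3) * (f0*f 0) + K*(f0*f 0) := by ring
      _ ≤ (4/9*(n':ℝ)^3) * (f0*f 0) + K*(12*h/(m:ℝ)^2) := by gcongr
      _ = _ := by ring
  have k2 := mul_le_mul_of_nonneg_left k1 ht
  have k3 := mul_le_mul_of_nonneg_left hsum ht
  have k4 := mul_le_mul_of_nonneg_left hsq (by positivity : 0 ≤ 2*t^2)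
  nlinarith
end outer


noncomputable def PV (m n' : ℕ) (f : ℤ → ℝ) (w : Z2) : ℝ :=
  if (n':ℤ) ≤ w.1 then 1 else STD m f 1 w

section vol
variable {m h n' : ℕ} {f : ℤ → ℝ} {κ : ℝ}

lemma PV_le (H : Axis m h n' f κ) (w : Z2) : PV m n' f w ≤ 1 := by
  unfold PV; split_ifs
  · exact le_rfl
  · refine (STD_le H zero_le_one w).trans ?_
    rw [one_mul]; exact H.le1 _

lemma PV_nn (H : Axis m h n' f κ) {w : Z2} (hw : w ∈ DF m) : 0 ≤ PV m n' f w := by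
  unfold PV; split_ifs
  · exact zero_le_one
  · exact STD_nn H zero_le_one hw

lemma PV_super (H : Axis m h n' f κ) {w : Z2} (hw : w ∈ DF m) : cavg (PV m n' f) w ≤ PV m n' f w := by
  have hle := PV_le H
  by_cases hc : (n':ℤ) ≤ w.1
  · have : PV m n' f w = 1 := by unfold PV; rw [if_pos hc]
    rw [this]
    unfold cavg
    split_ifs
    · linarith [hle (w.1+1,0), hle (w.1-1,0), hle (w.1,1), hle (w.1,-1)]
    · linarith [hle (w.1,w.2+1), hle (w.1,w.2-1)]
  · have e := STD_harm (f0 := 1) H hw (Or.inl (by omega))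
    have ht : ∀ v : Z2, v.1 < n' → PV m n' f v = STD m f 1 v := by
      intro v hv; unfold PV; rw [if_neg (by omega)]
    rw [ht w (by omega), ← e]
    apply le_of_eq
    unfold cavg
    by_cases hy : w.2 = 0
    · rw [if_pos hy, if_pos hy, ht (w.1-1,0) (by simp only; omega), ht (w.1,1) (by simp only; omega), ht (w.1,-1) (by simp only; omega)]
      have : PV m n' f (w.1+1,0) = STD m f 1 (w.1+1,0) := by
        by_cases h2 : w.1+1 < n'
        · exact ht _ h2
        · have h3 : w.1+1 = n' := by omega
          unfold PV STD
          rw [h3, if_pos le_rfl, H.one]; simp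
      rw [this]
    · rw [if_neg hy, if_neg hy, ht _ (by simp only; omega), ht _ (by simp only; omega)]

lemma PV_ge (H : Axis m h n' f κ) {w w' : Z2} (hw : w ∈ DF m) (ha : combAdj w w') : -2 ≤ PV m n' f w' := by
  unfold PV; split_ifs
  · norm_num
  · have := DF_nbr (x := w.1) (y := w.2) hw ha (fun x => 1 * f x) (fun x hx => by simp [H.zero x hx])
      (fun x => by rw [one_mul]; exact H.nn x) (fun x => by rw [one_mul]; exact H.le1 x)
    exact this

theorem outer_volume {Ω : Type*} [mΩ : MeasurableSpace Ω] {P : Measure Ω} {W : ℕ → ℕ → Ω → Z2}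
    (hW : IsIIDCombWalks P W) (m n' h T : ℕ) (hm : n' + h = m) (h1 : 1 ≤ n') (hh : 1 ≤ h)
    (t : ℝ) (ht : 0 ≤ t) (ht2 : t ≤ 1/3) (K : ℝ) (hT : (T:ℝ) ≤ 4/9*(n':ℝ)^3 + K) (hK : 0 ≤ K) (v : ℝ) :
    P {ω | (DF n' ⊆ CL W T ω ∧ CL W T ω ⊆ DF m ∧ v ≤ ((CL W T ω).filter (fun w => (n':ℤ) ≤ w.1)).card) ∧
      ∀ i < T, CL W i ω ⊆ DF m} ≤
      ENNReal.ofReal (Real.exp (-t*(v*(1-2*t) - 2*K*(h:ℝ)^2/(m:ℝ)^2 - 6*h) + 20*t^2*(h:ℝ)^3)) := by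
  obtain ⟨f, κ, H⟩ := axis_exists m h n' (by omega) (by omega) hh
  have hhr : (1:ℝ) ≤ h := by exact_mod_cast hh
  have h00 := H.nn 0
  have hmr : (1:ℝ) ≤ m := by exact_mod_cast (by omega : 1 ≤ m)
  have hnm : n' ≤ m := by omega
  have hψ0 : PV m n' f (0,0) = f 0 := by
    unfold PV; rw [if_neg (by simp only; omega)]; unfold STD; simp
  have hsum := STD_sum H zero_le_one n' h1 hnm
  rw [if_neg (lt_irrefl _)] at hsum
  have hnear : ∀ w ∈ DF n', w.1 < n' := by
    rintro ⟨x,y⟩ hw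
    have := (mem_DF'.1 hw).1
    exact (abs_lt.1 this).2
  have hPS : ∀ w ∈ DF n', PV m n' f w = STD m f 1 w := by
    intro w hw; unfold PV; rw [if_neg (by have := hnear w hw; omega)]
  have hsq : ∑ w ∈ DF n', (PV m n' f w)^2 ≤ 10*(h:ℝ)^3 := by
    have a1 := H.sum_DF_sq (f0 := 1)
    rw [one_pow, one_mul] at a1
    refine le_trans ?_ a1
    refine le_trans ?_ (Finset.sum_le_sum_of_subset_of_nonneg (DF_mono hnm) (fun w _ _ => sq_nonneg _))
    apply Finset.sum_le_sum
    intro w hw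
    rw [hPS w hw]
    exact pow_le_pow_left₀ (STD_nn H zero_le_one (DF_mono hnm hw)) (STD_le H zero_le_one w) 2
  have hsum2 : (4/9*(n':ℝ)^3) * f 0 - 6*h ≤ ∑ w ∈ DF n', PV m n' f w := by
    rw [Finset.sum_congr rfl hPS]
    refine le_trans ?_ hsum
    have : 0 ≤ 4/9*(n':ℝ)*f 0 := by positivity
    nlinarith
  have hnn := fun w hw => PV_nn H (w := w) hw
  have hle := PV_le H
  have hone : ∀ w : Z2, (n':ℤ) ≤ w.1 → PV m n' f w = 1 := by
    intro w hw; unfold PV; rw [if_pos hw]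
  set ψ := PV m n' f with hψ
  refine master hW (fun B => B ⊆ DF m) (fun w => max (1 + t * ψ w) 0) (1 + t*f 0) (by positivity)
    (fun B hB hG => ⟨fun w => 1 + t * ψ w, by simp only [hψ0]; exact le_rfl, by
        intro w hw
        rw [cavg_lin]
        have := PV_super H (hG hw)
        rw [← hψ] at this
        nlinarith, by
        intro w hw w' ha
        have := PV_ge H (hG hw) ha
        rw [← hψ] at this
        simp only; nlinarith, by
        intro w _; exact le_rfl⟩) T
    (fun B => DF n' ⊆ B ∧ B ⊆ DF m ∧ v ≤ (B.filter (fun w => (n':ℤ) ≤ w.1)).card) _ (fun w => le_max_right _ _) (Real.exp_pos _).le ?_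
  rintro B hB hcard ⟨hnB, hBm, hv⟩
  have s1 : (1 + t*f 0)^T ≤ Real.exp (T*(t*f 0)) := by
    rw [Real.exp_nat_mul]
    apply pow_le_pow_left₀ (by positivity)
    have := Real.add_one_le_exp (t*f 0); linarith
  have s2 : Real.exp (∑ w ∈ B, (t*ψ w - 2*(t*ψ w)^2)) ≤ ∏ w ∈ B, max (1 + t * ψ w) 0 := by
    rw [Real.exp_sum]
    apply Finset.prod_le_prod (fun w _ => (Real.exp_pos _).le)
    intro w hw
    refine le_trans (exp_quad _ ?_) (le_max_left _ _)
    have : 0 ≤ t * ψ w := mul_nonneg ht (hnn w (hBm hw))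
    linarith
  set F := B.filter (fun w => (n':ℤ) ≤ w.1) with hF
  have hdis : Disjoint (DF n') F := by
    rw [Finset.disjoint_left]
    intro w hw hw2
    have := hnear w hw
    have := (Finset.mem_filter.1 hw2).2
    omega
  have s3 : ∑ w ∈ DF n' ∪ F, (t*ψ w - 2*(t*ψ w)^2) ≤ ∑ w ∈ B, (t*ψ w - 2*(t*ψ w)^2) := by
    apply Finset.sum_le_sum_of_subset_of_nonneg (Finset.union_subset hnB (Finset.filter_subset _ _))
    intro w hw _
    have a := hnn w (hBm hw)
    have b := hle w
    have : 0 ≤ t * ψ w := mul_nonneg ht a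
    have : t * ψ w ≤ 1/3 := by nlinarith
    nlinarith
  have s4 : ∑ w ∈ DF n', (t*ψ w - 2*(t*ψ w)^2) =
      t * ∑ w ∈ DF n', ψ w - 2*t^2 * ∑ w ∈ DF n', (ψ w)^2 := by
    rw [Finset.mul_sum, Finset.mul_sum, ← Finset.sum_sub_distrib]
    apply Finset.sum_congr rfl; intro w _; ring
  have s5 : ∑ w ∈ F, (t*ψ w - 2*(t*ψ w)^2) = F.card * (t - 2*t^2) := by
    rw [← nsmul_eq_mul, ← Finset.sum_const]
    apply Finset.sum_congr rfl
    intro w hw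
    rw [hone w (Finset.mem_filter.1 hw).2]; ring
  rw [Finset.sum_union hdis, s4, s5] at s3
  refine s1.trans (le_trans ?_ (mul_le_mul_of_nonneg_left s2 (Real.exp_pos _).le))
  rw [← Real.exp_add]
  apply Real.exp_le_exp.2
  refine le_trans ?_ (add_le_add_right s3 _)
  have k1 : (T:ℝ)*f 0 ≤ (4/9*(n':ℝ)^3) * f 0 + 2*K*(h:ℝ)^2/(m:ℝ)^2 := by
    calc (T:ℝ)*f 0 ≤ (4/9*(n':ℝ)^3 + K)*f 0 := mul_le_mul_of_nonneg_right hT (by positivity)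
      _ = (4/9*(n':ℝ)^3) * f 0 + K*f 0 := by ring
      _ ≤ (4/9*(n':ℝ)^3) * f 0 + K*(2*(h:ℝ)^2/(m:ℝ)^2) := by gcongr; exact H.f0_le
      _ = _ := by ring
  have k2 := mul_le_mul_of_nonneg_left k1 ht
  have k3 := mul_le_mul_of_nonneg_left hsum2 ht
  have k4 := mul_le_mul_of_nonneg_left hsq (by positivity : 0 ≤ 2*t^2)
  have k5 := mul_le_mul_of_nonneg_right hv (by nlinarith : 0 ≤ t - 2*t^2)
  nlinarith
end vol


noncomputable def es (τ : ℕ → ℝ) : ℕ → ℝ × ℝ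
  | 0 => (1,1)
  | i+1 => ((es τ i).2, 2*(es τ i).2 - (es τ i).1 + 2/τ (i+1) * (es τ i).2)

noncomputable def eE (τ : ℕ → ℝ) (i : ℕ) : ℝ := (es τ i).1

lemma eE_one (τ : ℕ → ℝ) : eE τ 1 = 1 := rfl
lemma eE_zero (τ : ℕ → ℝ) : eE τ 0 = 1 := rfl
lemma eE_rec (τ : ℕ → ℝ) (i : ℕ) : eE τ (i+2) = 2*eE τ (i+1) - eE τ i + 2/τ (i+1) * eE τ (i+1) := rfl

section grow
variable {τ : ℕ → ℝ}

lemma eE_mono1 (hτ : ∀ i, 1 ≤ τ i) : ∀ i, 1 ≤ eE τ i ∧ eE τ i ≤ eE τ (i+1) := by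
  intro i
  induction i with
  | zero => rw [eE_zero, eE_one]; simp
  | succ i ih =>
    rw [eE_rec]
    have : 0 ≤ 2/τ (i+1) * eE τ (i+1) := by
      have := hτ (i+1)
      apply mul_nonneg (by positivity); linarith
    constructor <;> linarith

lemma eE_mono (hτ : ∀ i, 1 ≤ τ i) {i j : ℕ} (h : i ≤ j) : eE τ i ≤ eE τ j := monotone_nat_of_le_succ (fun i => (eE_mono1 hτ i).2) h

lemma eE_block (hτ : ∀ i, 1 ≤ τ i) (a v : ℕ) : eE τ a * (1 + 2*v*∑ j ∈ Finset.range v, 1/τ (a+j+1)) ≤ eE τ (a+2*v) := by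
  have hd : ∀ j : ℕ, eE τ a * (2*∑ l ∈ Finset.range j, 1/τ (a+l+1)) ≤ eE τ (a+j+1) - eE τ (a+j) := by
    intro j
    induction j with
    | zero => have := (eE_mono1 hτ a).2; simp; linarith
    | succ j ih =>
      have e := eE_rec τ (a+j)
      rw [Finset.sum_range_succ, show a+(j+1)+1 = a+j+2 by ring, show a+(j+1) = a+j+1 by ring, e]
      have h1 : eE τ a ≤ eE τ (a+j+1) := eE_mono hτ (by omega)
      have h2 : 0 ≤ 2/τ (a+j+1) := by have := hτ (a+j+1); positivity
      have h3 := mul_le_mul_of_nonneg_left h1 h2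
      have h4 : eE τ a * (2*(∑ l ∈ Finset.range j, 1/τ (a+l+1) + 1/τ (a+j+1))) =
        eE τ a * (2*∑ l ∈ Finset.range j, 1/τ (a+l+1)) + 2/τ (a+j+1)*eE τ a := by ring
      rw [h4]; linarith
  have hdm : ∀ i j : ℕ, eE τ (i+1) - eE τ i ≤ eE τ (i+j+1) - eE τ (i+j) := by
    intro i j
    induction j with
    | zero => simp
    | succ j ih =>
      have e := eE_rec τ (i+j)
      rw [show i+(j+1)+1 = i+j+2 by ring, show i+(j+1) = i+j+1 by ring, e]
      have : 0 ≤ 2/τ (i+j+1) * eE τ (i+j+1) := by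
        have := hτ (i+j+1)
        have := (eE_mono1 hτ (i+j+1)).1
        positivity
      linarith
  have hs : ∀ j : ℕ, eE τ (a+v) + j*(eE τ (a+v+1) - eE τ (a+v)) ≤ eE τ (a+v+j) := by
    intro j
    induction j with
    | zero => simp
    | succ j ih =>
      have := hdm (a+v) j
      rw [show a+v+(j+1) = a+v+j+1 by ring]
      push_cast; linarith
  have h1 := hs v
  have h2 := hd v
  have h3 : eE τ a ≤ eE τ (a+v) := eE_mono hτ (by omega)
  rw [show a+v+v = a+2*v by ring] at h1
  have h4 := mul_le_mul_of_nonneg_left h2 (by positivity : (0:ℝ) ≤ v)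
  have h5 : eE τ a * (1 + 2*v*∑ j ∈ Finset.range v, 1/τ (a+j+1)) = eE τ a + v*(eE τ a * (2*∑ l ∈ Finset.range v, 1/τ (a+l+1))) := by ring
  rw [h5]; linarith

lemma eE_block2 (hτ : ∀ i, 1 ≤ τ i) (a v : ℕ) (hv : 1 ≤ v) (Nb : ℝ) (hN : 0 < Nb) (hvN : 3*Nb ≤ 2*(v:ℝ)^3) :
    eE τ a * Real.exp (2 - (∑ j ∈ Finset.range (2*v), τ (a+j+1))/Nb) ≤ eE τ (a+2*v) := by
  refine le_trans ?_ (eE_block hτ a v)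
  apply mul_le_mul_of_nonneg_left _ (by linarith [(eE_mono1 hτ a).1])
  set S := ∑ j ∈ Finset.range (2*v), τ (a+j+1) with hS
  set S1 := ∑ j ∈ Finset.range v, τ (a+j+1) with hS1
  set Q := ∑ j ∈ Finset.range v, 1/τ (a+j+1) with hQ
  have hp : ∀ i, 0 < τ i := fun i => lt_of_lt_of_le one_pos (hτ i)
  have hSS : S1 ≤ S := by
    apply Finset.sum_le_sum_of_subset_of_nonneg
    · intro i; simp only [Finset.mem_range]; omega
    · intro i _ _; exact (hp _).le
  have hS1p : 0 < S1 := Finset.sum_pos (fun i _ => hp _) ⟨0, by simp; omega⟩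
  have hvr : (1:ℝ) ≤ v := by exact_mod_cast hv
  have hcs : (v:ℝ)^2 ≤ S1 * Q := by
    have := Finset.sum_sq_le_sum_mul_sum_of_sq_eq_mul (Finset.range v) (r := fun _ => (1:ℝ)) (f := fun j => τ (a+j+1))
      (g := fun j => 1/τ (a+j+1)) (fun i _ => (hp _).le) (fun i _ => by have := hp (a+i+1); positivity)
      (fun i _ => by have := hp (a+i+1); field_simp)
    simp only [Finset.sum_const, Finset.card_range, nsmul_eq_mul, mul_one] at this
    exact this
  have hQ0 : 0 ≤ Q := Finset.sum_nonneg (fun i _ => by have := hp (a+i+1); positivity)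
  have hcs2 : (v:ℝ)^2 ≤ S * Q := hcs.trans (mul_le_mul_of_nonneg_right hSS hQ0)
  have hSp : 0 < S := lt_of_lt_of_le hS1p hSS
  set s := S/Nb with hs
  have hsp : 0 < s := div_pos hSp hN
  have h1 : Real.exp (2-s) * s ≤ 3 := by
    have : s ≤ Real.exp (s-1) := by have := Real.add_one_le_exp (s-1); linarith
    calc Real.exp (2-s) * s ≤ Real.exp (2-s) * Real.exp (s-1) := mul_le_mul_of_nonneg_left this (Real.exp_pos _).le
      _ = Real.exp 1 := by rw [← Real.exp_add]; congr 1; ring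
      _ ≤ 3 := by have := Real.exp_one_lt_d9; linarith
  have h2 : Real.exp (2-s) ≤ 3/s := by rwa [le_div_iff₀ hsp]
  refine h2.trans ?_
  rw [hs, div_div_eq_mul_div, div_le_iff₀ hSp]
  have : 2*(v:ℝ)^3 ≤ 2*v*(S*Q) := by
    calc 2*(v:ℝ)^3 = 2*v*(v:ℝ)^2 := by ring
      _ ≤ _ := mul_le_mul_of_nonneg_left hcs2 (by positivity)
  nlinarith

lemma eE_grow (hτ : ∀ i, 1 ≤ τ i) (v : ℕ) (hv : 1 ≤ v) (Nb : ℝ) (hN : 0 < Nb) (hvN : 3*Nb ≤ 2*(v:ℝ)^3) (b : ℕ) :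
    Real.exp (2*b - (∑ j ∈ Finset.range (2*v*b), τ (j+1))/Nb) ≤ eE τ (2*v*b) := by
  induction b with
  | zero => simp [eE_zero]
  | succ b ih =>
    have h := eE_block2 hτ (2*v*b) v hv Nb hN hvN
    rw [show 2*v*b + 2*v = 2*v*(b+1) by ring] at h
    refine le_trans ?_ h
    refine le_trans (le_of_eq ?_) (mul_le_mul_of_nonneg_right ih (Real.exp_pos _).le)
    rw [← Real.exp_add, show 2*v*(b+1) = 2*v*b+2*v by ring, Finset.sum_range_add]
    congr 1
    push_cast
    have : ∀ i, τ (2*v*b+i+1) = τ (2*v*b+(i+1)) := fun i => by ring_nf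
    simp only [add_assoc]
    ring
end grow


noncomputable def upN (B : Finset Z2) (x : ℤ) : ℕ := (B.filter (fun w => w.1 = x ∧ 0 < w.2)).card
noncomputable def dnN (B : Finset Z2) (x : ℤ) : ℕ := (B.filter (fun w => w.1 = x ∧ w.2 < 0)).card
noncomputable def coN (B : Finset Z2) (x : ℤ) : ℕ := (B.filter (fun w => w.1 = x)).card

lemma coN_eq {B : Finset Z2} {x : ℤ} (h : (x,0) ∈ B) : coN B x = upN B x + dnN B x + 1 := by
  classical
  unfold coN upN dnN
  have e : B.filter (fun w => w.1 = x) = insert (x,0) (B.filter (fun w => w.1 = x ∧ 0 < w.2) ∪ B.filter (fun w => w.1 = x ∧ w.2 < 0)) := by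
    ext ⟨p,q⟩
    simp only [Finset.mem_filter, Finset.mem_insert, Finset.mem_union, Prod.mk.injEq]
    constructor
    · rintro ⟨h1,h2⟩
      rcases lt_trichotomy q 0 with h3|h3|h3
      · right; right; exact ⟨h1,h2,h3⟩
      · left; exact ⟨h2,h3⟩
      · right; left; exact ⟨h1,h2,h3⟩
    · rintro (⟨rfl,rfl⟩|⟨h1,h2,_⟩|⟨h1,h2,_⟩)
      · exact ⟨h,rfl⟩
      · exact ⟨h1,h2⟩
      · exact ⟨h1,h2⟩
  rw [e, Finset.card_insert_of_notMem (by simp), Finset.card_union_of_disjoint]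
  rw [Finset.disjoint_left]
  rintro ⟨p,q⟩ h1 h2
  simp only [Finset.mem_filter] at h1 h2
  omega

lemma le_upN {B : Finset Z2} (hB : PClosed B) {x : ℤ} {y : ℕ} (h : (x,(y:ℤ)) ∈ B) : y ≤ upN B x := by
  classical
  have : ((Finset.Icc 1 y).image (fun j : ℕ => ((x,(j:ℤ)) : Z2))).card = y := by
    rw [Finset.card_image_of_injective _ (fun a b h => by simpa using h)]; simp
  rw [← this]
  apply Finset.card_le_card
  intro w hw
  simp only [Finset.mem_image, Finset.mem_Icc] at hw
  obtain ⟨j,hj,rfl⟩ := hw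
  simp only [Finset.mem_filter, true_and]
  exact ⟨hB.down x j y hj.2 h, by omega⟩

lemma le_dnN {B : Finset Z2} (hB : PClosed B) {x : ℤ} {y : ℕ} (h : (x,-(y:ℤ)) ∈ B) : y ≤ dnN B x := by
  classical
  have : ((Finset.Icc 1 y).image (fun j : ℕ => ((x,-(j:ℤ)) : Z2))).card = y := by
    rw [Finset.card_image_of_injective _ (fun a b h => by simpa using h)]; simp
  rw [← this]
  apply Finset.card_le_card
  intro w hw
  simp only [Finset.mem_image, Finset.mem_Icc] at hw
  obtain ⟨j,hj,rfl⟩ := hw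
  simp only [Finset.mem_filter, true_and]
  exact ⟨hB.up x j y hj.2 h, by omega⟩

lemma sum_coN (B : Finset Z2) (k M : ℕ) : ∑ j ∈ Finset.range M, coN B ((k:ℤ)+(j+1:ℕ)) ≤ (B.filter (fun w => (k:ℤ) < w.1)).card := by
  classical
  unfold coN
  rw [← Finset.card_biUnion]
  · apply Finset.card_le_card
    intro w hw
    simp only [Finset.mem_biUnion, Finset.mem_filter] at hw ⊢
    obtain ⟨j,_,h1,h2⟩ := hw
    exact ⟨h1, by omega⟩
  · intro i _ j _ hij
    simp only [Function.onFun]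
    rw [Finset.disjoint_left]
    rintro w h1 h2
    simp only [Finset.mem_filter] at h1 h2
    omega

noncomputable def tauN (B : Finset Z2) (k : ℕ) (i : ℕ) : ℝ := max 1 (coN B ((k:ℤ)+i))
noncomputable def gE (B : Finset Z2) (k M : ℕ) (x : ℤ) : ℝ := eE (tauN B k) (min (x-k).toNat (M+1))
noncomputable def gT (B : Finset Z2) (k M : ℕ) (z : Z2) : ℝ :=
  if (k:ℤ) < z.1 ∧ z.1 ≤ k+M then
    (if 0 ≤ z.2 then max 0 (1 - z.2/((upN B z.1:ℝ)+1)) else max 0 (1 + z.2/((dnN B z.1:ℝ)+1)))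
  else 1

lemma gT_up {B : Finset Z2} {k M : ℕ} {x : ℤ} (hx : (k:ℤ) < x ∧ x ≤ k+M) (y : ℤ) (h0 : 0 ≤ y) (hy : y ≤ upN B x + 1) :
    gT B k M (x,y) = 1 - y/((upN B x:ℝ)+1) := by
  unfold gT
  rw [if_pos hx]; simp only
  rw [if_pos h0]
  apply max_eq_right
  have : (y:ℝ) ≤ upN B x + 1 := by exact_mod_cast hy
  rw [sub_nonneg, div_le_one (by positivity)]; exact this

lemma gT_dn {B : Finset Z2} {k M : ℕ} {x : ℤ} (hx : (k:ℤ) < x ∧ x ≤ k+M) (y : ℤ) (h0 : y ≤ 0) (hy : -y ≤ dnN B x + 1) :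
    gT B k M (x,y) = 1 + y/((dnN B x:ℝ)+1) := by
  unfold gT
  rw [if_pos hx]; simp only
  rcases eq_or_lt_of_le h0 with rfl | h
  · simp
  · rw [if_neg (by omega)]
    apply max_eq_right
    have : -(y:ℝ) ≤ dnN B x + 1 := by exact_mod_cast hy
    have : -1 ≤ (y:ℝ)/((dnN B x:ℝ)+1) := by rw [le_div_iff₀ (by positivity)]; linarith
    linarith

lemma gT_out {B : Finset Z2} {k M : ℕ} {z : Z2} (hx : ¬ ((k:ℤ) < z.1 ∧ z.1 ≤ k+M)) : gT B k M z = 1 := by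
  unfold gT; rw [if_neg hx]

lemma gT_nonneg (B : Finset Z2) (k M : ℕ) (z : Z2) : 0 ≤ gT B k M z := by
  unfold gT; split_ifs <;> simp

lemma gT_axis (B : Finset Z2) (k M : ℕ) (x : ℤ) : gT B k M (x,0) = 1 := by
  unfold gT; split_ifs <;> simp_all

lemma tauN_one (B : Finset Z2) (k i : ℕ) : 1 ≤ tauN B k i := le_max_left _ _

lemma stage_super {B : Finset Z2} (hB : PClosed B) (k M : ℕ) (z : Z2) (hz : z ∈ B) :
    cavg (fun w => gE B k M w.1 * gT B k M w) z ≤ gE B k M z.1 * gT B k M z := by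
  obtain ⟨x,y⟩ := z
  have hmono : ∀ {i j : ℕ}, i ≤ j → eE (tauN B k) i ≤ eE (tauN B k) j := fun h => eE_mono (tauN_one B k) h
  have hpos : ∀ i, 1 ≤ eE (tauN B k) i := fun i => (eE_mono1 (tauN_one B k) i).1
  unfold cavg
  by_cases hy : y = 0
  · subst hy
    simp only [if_true, gT_axis]
    by_cases hx : (k:ℤ) < x ∧ x ≤ k+M
    · obtain ⟨i, rfl⟩ : ∃ i : ℕ, x = k + (i+1:ℕ) := ⟨(x-k-1).toNat, by omega⟩
      rw [gT_up hx 1 (by omega) (by omega), gT_dn hx (-1) (by omega) (by omega)]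
      unfold gE
      rw [show ((k:ℤ)+(i+1:ℕ)+1-k).toNat = i+2 by omega, show ((k:ℤ)+(i+1:ℕ)-1-k).toNat = i by omega,
        show ((k:ℤ)+(i+1:ℕ)-k).toNat = i+1 by omega, min_eq_left (by omega), min_eq_left (by omega), min_eq_left (by omega), eE_rec]
      have hc := coN_eq hz
      have ht : tauN B k (i+1) = ((upN B (k+(i+1:ℕ)) : ℕ) : ℝ) + ((dnN B (k+(i+1:ℕ)) : ℕ) : ℝ) + 1 := by
        unfold tauN; rw [hc]; push_cast
        apply max_eq_right
        have : (0:ℝ) ≤ (upN B (k+(i+1)):ℝ) + dnN B (k+(i+1)) := by positivity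
        linarith
      rw [ht]
      set u : ℝ := ((upN B (k+(i+1:ℕ)) : ℕ) : ℝ)
      set l : ℝ := ((dnN B (k+(i+1:ℕ)) : ℕ) : ℝ)
      have hu : 0 ≤ u := by positivity
      have hl : 0 ≤ l := by positivity
      have key : 2/(u+l+1) ≤ 1/(u+1) + 1/(l+1) := by
        rw [div_add_div _ _ (by positivity) (by positivity), div_le_div_iff₀ (by positivity) (by positivity)]
        nlinarith [mul_nonneg hu hl, sq_nonneg (u-l), mul_nonneg hu hu, mul_nonneg hl hl]
      have := mul_le_mul_of_nonneg_right key (by linarith [hpos (i+1)] : 0 ≤ eE (tauN B k) (i+1))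
      have e1 : (((-1:ℤ)):ℝ)/(l+1) = -(1/(l+1)) := by push_cast; ring
      have e2 : (((1:ℤ)):ℝ)/(u+1) = 1/(u+1) := by push_cast; ring
      rw [e1, e2]
      linarith
    · rw [gT_out (z := (x,1)) hx, gT_out (z := (x,-1)) hx]
      unfold gE
      rcases lt_or_ge (k:ℤ) x with h | h
      · have hx' : (k:ℤ)+M < x := by by_contra h'; exact hx ⟨h, by omega⟩
        rw [min_eq_right (a := (x-k).toNat) (by omega), min_eq_right (a := (x+1-k).toNat) (by omega)]
        have := hmono (min_le_right (x-1-k).toNat (M+1))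
        linarith
      · rw [show (x-k).toNat = 0 by omega, show (x-1-k).toNat = 0 by omega]
        have h1 : eE (tauN B k) (min (x+1-k).toNat (M+1)) = 1 := by
          have : (x+1-k).toNat ≤ 1 := by omega
          rcases Nat.le_one_iff_eq_zero_or_eq_one.1 this with h | h
          · rw [h, min_eq_left (by omega), eE_zero]
          · rw [h, min_eq_left (by omega), eE_one]
        rw [h1, min_eq_left (by omega), eE_zero]; norm_num
  · simp only [hy, if_false]
    by_cases hx : (k:ℤ) < x ∧ x ≤ k+M
    · rcases lt_or_gt_of_ne hy with h | h
      · have hd := le_dnN hB (x := x) (y := (-y).toNat) (by rw [show -(((-y).toNat:ℕ):ℤ) = y by omega]; exact hz)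
        rw [gT_dn hx (y+1) (by omega) (by omega), gT_dn hx (y-1) (by omega) (by omega), gT_dn hx y (by omega) (by omega)]
        push_cast; apply le_of_eq; ring
      · have hd := le_upN hB (x := x) (y := y.toNat) (by rw [show ((y.toNat:ℕ):ℤ) = y by omega]; exact hz)
        rw [gT_up hx (y+1) (by omega) (by omega), gT_up hx (y-1) (by omega) (by omega), gT_up hx y (by omega) (by omega)]
        push_cast; apply le_of_eq; ring
    · rw [gT_out (z := (x,y+1)) hx, gT_out (z := (x,y-1)) hx, gT_out (z := (x,y)) hx]
      apply le_of_eq; ring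

lemma stage {Ω : Type*} [MeasurableSpace Ω] {P : Measure Ω} {W : ℕ → ℕ → Ω → Z2} (hW : IsIIDCombWalks P W)
    (k v b N T : ℕ) (hv : 1 ≤ v) (hb : 16 ≤ b) (hMN : 2*v*b ≤ N) (hN : 3*N ≤ v^3*b) :
    P {ω | ((CL W T ω).filter (fun w => (k:ℤ) < w.1)).card ≤ N ∧ N ≤ 8*((CL W T ω).filter (fun w => ((k+2*v*b:ℕ):ℤ) < w.1)).card}
      ≤ ENNReal.ofReal (Real.exp (-((b:ℝ)*N/16))) := by
  set M := 2*v*b with hM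
  have hNr : (M:ℝ) ≤ N := by exact_mod_cast hMN
  have hNp : 0 < N := by
    have : 0 < M := by positivity
    omega
  have hNpr : (0:ℝ) < N := by exact_mod_cast hNp
  have hbr : (16:ℝ) ≤ b := by exact_mod_cast hb
  have hgrow : ∀ B : Finset Z2, (B.filter (fun w => (k:ℤ) < w.1)).card ≤ N → Real.exp b ≤ eE (tauN B k) (M+1) := by
    intro B hB
    refine le_trans ?_ (eE_mono (tauN_one B k) (Nat.le_succ M))
    have hg := eE_grow (tauN_one B k) v hv (2*N/b) (by positivity) (by
      have : (3:ℝ)*N ≤ v^3*b := by exact_mod_cast hN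
      rw [← mul_div_assoc, div_le_iff₀ (by linarith)]; linarith) b
    refine le_trans (Real.exp_le_exp.2 ?_) hg
    have hs : ∑ j ∈ Finset.range M, tauN B k (j+1) ≤ 2*N := by
      have h1 : ∑ j ∈ Finset.range M, tauN B k (j+1) ≤ ∑ j ∈ Finset.range M, (1 + (coN B ((k:ℤ)+(j+1:ℕ)):ℝ)) := by
        apply Finset.sum_le_sum
        intro j _
        unfold tauN
        apply max_le
        · have : (0:ℝ) ≤ (coN B ((k:ℤ)+(j+1:ℕ)):ℝ) := by positivity
          linarith
        · linarith
      rw [Finset.sum_add_distrib] at h1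
      have h2 := (sum_coN B k M).trans hB
      have h3 : ∑ j ∈ Finset.range M, (coN B ((k:ℤ)+(j+1:ℕ)):ℝ) ≤ N := by exact_mod_cast h2
      simp only [Finset.sum_const, Finset.card_range, nsmul_eq_mul, mul_one] at h1
      linarith
    have h4 : (∑ j ∈ Finset.range M, tauN B k (j+1)) / (2*N/b) ≤ b := by
      rw [div_le_iff₀ (by positivity)]
      calc _ ≤ _ := hs
        _ = _ := by field_simp
    linarith
  set ψ : Z2 → ℝ := fun y => b*(if ((k+M:ℕ):ℤ) < y.1 then 1 else 0) - (if (k:ℤ) < y.1 then 1 else 0) with hψ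
  have := master hW (fun B => (B.filter (fun w => (k:ℤ) < w.1)).card ≤ N) (fun y => Real.exp (ψ y)) 1 one_pos
    (by
      intro B hB hBN
      have hE := hgrow B hBN
      have he1 : Real.exp (-1) ≤ 1/2 := by
        have := Real.add_one_le_exp (1:ℝ)
        rw [Real.exp_neg, one_div]; apply inv_anti₀ <;> linarith
      have he0 := Real.exp_pos (-1)
      have hg1 : ∀ x, 1 ≤ gE B k M x := fun x => (eE_mono1 (tauN_one B k) _).1
      have hg0 : ∀ z : Z2, 0 ≤ gE B k M z.1 * gT B k M z := fun z => mul_nonneg (by linarith [hg1 z.1]) (gT_nonneg _ _ _ _)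
      refine ⟨fun z => Real.exp (-1) + (1-Real.exp (-1)) * (gE B k M z.1 * gT B k M z), ?_, ?_, ?_, ?_⟩
      · simp only [gT_axis]
        unfold gE
        rw [show ((0:ℤ)-k).toNat = 0 by omega, min_eq_left (by omega), eE_zero]; linarith
      · intro z hz
        rw [cavg_lin (fun w : Z2 => gE B k M w.1 * gT B k M w)]
        have := mul_le_mul_of_nonneg_left (stage_super hB k M z hz) (by linarith : 0 ≤ 1 - Real.exp (-1))
        linarith
      · intro z _ w _
        have := mul_nonneg (by linarith : 0 ≤ 1 - Real.exp (-1)) (hg0 w)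
        linarith
      · rintro ⟨x,y⟩ _
        refine le_trans ?_ (le_max_left _ _)
        simp only [hψ]
        by_cases h1 : ((k+M:ℕ):ℤ) < x
        · rw [if_pos h1, if_pos (by omega), gT_out (by simp only; omega)]
          have h2 : Real.exp b ≤ gE B k M x := by
            unfold gE; rw [min_eq_right (by omega)]; exact hE
          have h3 : Real.exp (b*1-1) = Real.exp (-1) * Real.exp b := by rw [← Real.exp_add]; congr 1; ring
          rw [h3]
          have h4 : Real.exp (-1) * Real.exp b ≤ (1-Real.exp (-1)) * Real.exp b := mul_le_mul_of_nonneg_right (by linarith) (Real.exp_pos _).le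
          have h5 := mul_le_mul_of_nonneg_left h2 (by linarith : 0 ≤ 1 - Real.exp (-1))
          linarith
        · rw [if_neg h1]
          by_cases h2 : (k:ℤ) < x
          · rw [if_pos h2]
            have := mul_nonneg (by linarith : 0 ≤ 1 - Real.exp (-1)) (hg0 (x,y))
            rw [show (b:ℝ)*0-1 = -1 by ring]; linarith
          · rw [if_neg h2, gT_out (by simp only; omega)]
            unfold gE
            rw [show ((x:ℤ)-k).toNat = 0 by omega, min_eq_left (by omega), eE_zero]; simp)
    T (fun B => (B.filter (fun w => (k:ℤ) < w.1)).card ≤ N ∧ N ≤ 8*(B.filter (fun w => ((k+M:ℕ):ℤ) < w.1)).card)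
    (Real.exp (-((b:ℝ)*N/16))) (fun _ => (Real.exp_pos _).le) (Real.exp_pos _).le
    (by
      rintro B - - ⟨h1,h2⟩
      rw [one_pow, ← Real.exp_sum, ← Real.exp_add]
      apply Real.one_le_exp
      simp only [hψ, Finset.sum_sub_distrib, ← Finset.mul_sum, Finset.sum_boole]
      have h1' : ((B.filter (fun w => (k:ℤ) < w.1)).card:ℝ) ≤ N := by exact_mod_cast h1
      have h2' : (N:ℝ) ≤ 8*((B.filter (fun w => ((k+M:ℕ):ℤ) < w.1)).card:ℝ) := by exact_mod_cast h2
      nlinarith)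
  refine le_trans (measure_mono ?_) this
  rintro ω ⟨h1,h2⟩
  refine ⟨⟨h1,h2⟩, fun i hi => le_trans (Finset.card_le_card (Finset.filter_subset_filter _ (clF_mono _ hi.le))) h1⟩


def stV (S j : ℕ) : ℕ := min (8*4^j) (2^j*S)
def stB (R j : ℕ) : ℕ := 19 + 3*R/(512*8^j)
def stgM (S j : ℕ) : ℕ := 2 * stV S j * stB (S^3) j

lemma stgM_le (S j : ℕ) : (stgM S j : ℝ) ≤ 38*2^j*S + 6/64*(S:ℝ)^3*(1/2)^j := by
  unfold stgM stB
  have h1 : (stV S j:ℝ) ≤ 8*4^j := by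
    have : stV S j ≤ 8*4^j := min_le_left _ _
    exact_mod_cast this
  have h2 : (stV S j:ℝ) ≤ 2^j*S := by
    have : stV S j ≤ 2^j*S := min_le_right _ _
    exact_mod_cast this
  have h3 : ((3*S^3/(512*8^j):ℕ):ℝ) ≤ 3*(S:ℝ)^3/(512*8^j) := by
    refine Nat.cast_div_le.trans ?_
    push_cast; exact le_refl _
  push_cast
  have h4 : (stV S j:ℝ) * ((3*S^3/(512*8^j):ℕ):ℝ) ≤ 8*4^j * (3*(S:ℝ)^3/(512*8^j)) := by gcongr
  have h5 : (8:ℝ)*4^j * (3*(S:ℝ)^3/(512*8^j)) = 3/64*(S:ℝ)^3*(1/2)^j := by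
    have : (8:ℝ)^j = 4^j*2^j := by rw [← mul_pow]; norm_num
    rw [this, one_div, inv_pow]; field_simp; ring
  nlinarith

lemma sum_stgM (S j : ℕ) : (∑ i ∈ Finset.range j, (stgM S i:ℝ)) ≤ 38*S*(2^j-1) + 12/64*(S:ℝ)^3*(1-(1/2)^j) := by
  induction j with
  | zero => simp
  | succ j ih =>
    rw [Finset.sum_range_succ]
    have := stgM_le S j
    have e1 : (2:ℝ)^(j+1) = 2^j*2 := pow_succ _ _
    have e2 : (1/2:ℝ)^(j+1) = (1/2)^j*(1/2) := pow_succ _ _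
    rw [e1, e2]
    nlinarith

lemma stage' {Ω : Type*} [MeasurableSpace Ω] {P : Measure Ω} {W : ℕ → ℕ → Ω → Z2} (hW : IsIIDCombWalks P W)
    (k S j T : ℕ) (hS : 13 ≤ S) :
    P {ω | ((CL W T ω).filter (fun w => (k:ℤ) < w.1)).card ≤ 8^j*S^3 ∧ 8^j*S^3 ≤ 8*((CL W T ω).filter (fun w => ((k+stgM S j:ℕ):ℤ) < w.1)).card}
      ≤ ENNReal.ofReal (Real.exp (-(3*((S:ℝ)^3)^2/8192))) := by
  have hb : 3*S^3 ≤ stB (S^3) j * (512*8^j) := by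
    unfold stB
    have h := Nat.div_add_mod (3*S^3) (512*8^j)
    have h2 := Nat.mod_lt (3*S^3) (show 0 < 512*8^j by positivity)
    have h3 : (19 + 3*S^3/(512*8^j)) * (512*8^j) = 512*8^j * (3*S^3/(512*8^j)) + 19*(512*8^j) := by ring
    omega
  have hb3 : 19 ≤ stB (S^3) j := by unfold stB; exact Nat.le_add_right _ _
  have hv1 : 1 ≤ stV S j := by
    unfold stV; apply le_min
    · have : 0 < 8*4^j := by positivity
      omega
    · have : 0 < 2^j*S := by positivity
      omega
  have hMN : 2*stV S j*stB (S^3) j ≤ 8^j*S^3 := by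
    have h := stgM_le S j
    unfold stgM at h
    have hS' : (13:ℝ) ≤ S := by exact_mod_cast hS
    have : ((2*stV S j*stB (S^3) j:ℕ):ℝ) ≤ ((8^j*S^3:ℕ):ℝ) := by
      refine h.trans ?_
      push_cast
      have h1 : (1/2:ℝ)^j ≤ 1 := pow_le_one₀ (by norm_num) (by norm_num)
      have h2 : (2:ℝ)^j ≤ 8^j := pow_le_pow_left₀ (by norm_num) (by norm_num) _
      have h3 : (1:ℝ) ≤ 8^j := one_le_pow₀ (by norm_num)
      have h4 : (76:ℝ)*S ≤ S^3 := by
        have : (169:ℝ) ≤ S^2 := by nlinarith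
        nlinarith
      have h5 : (0:ℝ) ≤ S^3 := by positivity
      nlinarith [mul_le_mul_of_nonneg_right h2 (by linarith : (0:ℝ) ≤ S), mul_le_mul_of_nonneg_left h1 h5, mul_le_mul_of_nonneg_right h3 h5, mul_le_mul_of_nonneg_left h4 (by linarith : (0:ℝ) ≤ 8^j)]
    exact_mod_cast this
  have h3N : 3*(8^j*S^3) ≤ (stV S j)^3*stB (S^3) j := by
    unfold stV
    rcases le_total (8*4^j) (2^j*S) with h | h
    · rw [min_eq_left h]
      calc 3*(8^j*S^3) = 8^j*(3*S^3) := by ring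
        _ ≤ 8^j*(stB (S^3) j * (512*8^j)) := by gcongr
        _ = _ := by
          rw [mul_pow, ← pow_mul, mul_comm j 3, pow_mul]
          have : (4^3)^j = 8^j*8^j := by rw [← mul_pow]; norm_num
          rw [this]; ring
    · rw [min_eq_right h]
      have : (2^j*S)^3 = 8^j*S^3 := by
        rw [mul_pow, ← pow_mul, mul_comm j 3, pow_mul]; norm_num
      rw [this, mul_comm]
      apply Nat.mul_le_mul_left
      omega
  refine (stage hW k (stV S j) (stB (S^3) j) (8^j*S^3) T hv1 (by omega) hMN h3N).trans ?_
  apply ENNReal.ofReal_le_ofReal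
  apply Real.exp_le_exp.2
  rw [neg_le_neg_iff, div_le_div_iff₀ (by norm_num) (by norm_num)]
  have hb' : (3:ℝ)*S^3 ≤ stB (S^3) j * (512*8^j) := by exact_mod_cast hb
  push_cast
  have := mul_le_mul_of_nonneg_right hb' (by positivity : (0:ℝ) ≤ S^3)
  nlinarith

lemma stages {Ω : Type*} [MeasurableSpace Ω] {P : Measure Ω} {W : ℕ → ℕ → Ω → Z2} (hW : IsIIDCombWalks P W)
    (S T : ℕ) (hS : 13 ≤ S) (j : ℕ) : ∀ k : ℕ,
    P {ω | ((CL W T ω).filter (fun w => (k:ℤ) < w.1)).card ≤ 8^j*S^3 ∧ S^3 ≤ 8*((CL W T ω).filter (fun w => ((k+∑ i ∈ Finset.range (j+1), stgM S i:ℕ):ℤ) < w.1)).card}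
      ≤ (j+1:ℕ) * ENNReal.ofReal (Real.exp (-(3*((S:ℝ)^3)^2/8192))) := by
  induction j with
  | zero =>
    intro k
    have := stage' hW k S 0 T hS
    simpa using this
  | succ j ih =>
    intro k
    refine le_trans (measure_mono ?_) ((measure_union_le _ _).trans (add_le_add (stage' hW k S (j+1) T hS) (ih (k+stgM S (j+1))))) |>.trans (le_of_eq ?_)
    · rintro ω ⟨h1,h2⟩
      by_cases h : 8^(j+1)*S^3 ≤ 8*((CL W T ω).filter (fun w => ((k+stgM S (j+1):ℕ):ℤ) < w.1)).card
      · left; exact ⟨h1,h⟩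
      · right
        refine ⟨?_, ?_⟩
        · rw [pow_succ] at h
          have : 8^j*8*S^3 = 8*(8^j*S^3) := by ring
          omega
        · rw [Finset.sum_range_succ] at h2
          rw [show k + stgM S (j+1) + ∑ i ∈ Finset.range (j+1), stgM S i = k + (∑ i ∈ Finset.range (j+1), stgM S i + stgM S (j+1)) by ring]
          exact h2
    · push_cast; ring

lemma tip {Ω : Type*} [MeasurableSpace Ω] {P : Measure Ω} {W : ℕ → ℕ → Ω → Z2} (hW : IsIIDCombWalks P W)
    (p k T : ℕ) :
    P {ω | ((CL W T ω).filter (fun w => (k:ℤ) < w.1)).card ≤ 64^p*(4096*8^p) ∧ (((k+4096*8^p:ℕ):ℤ),(0:ℤ)) ∈ CL W T ω ∧ PClosed (CL W T ω)}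
      ≤ ENNReal.ofReal ((2*p+1)*Real.exp (-(3*((4096:ℝ)*8^p)^2/8192))) := by
  have hp : 1 ≤ 2^p := Nat.one_le_two_pow
  have hS3 : (16*2^p)^3 = 4096*8^p := by
    rw [mul_pow, ← pow_mul, mul_comm p 3, pow_mul]; norm_num
  have h := stages hW (16*2^p) T (by omega) (2*p) k
  rw [hS3, pow_mul] at h
  rw [ENNReal.ofReal_mul (by positivity)]
  refine le_trans (measure_mono ?_) (h.trans (le_of_eq ?_))
  · rintro ω ⟨h1,h2,h3⟩
    refine ⟨by simpa using h1, ?_⟩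
    set D := ∑ i ∈ Finset.range (2*p+1), stgM (16*2^p) i with hD
    have hDle : 8*D ≤ 7*(4096*8^p) := by
      have := sum_stgM (16*2^p) (2*p+1)
      have hDr : (D:ℝ) = ∑ i ∈ Finset.range (2*p+1), (stgM (16*2^p) i:ℝ) := by rw [hD]; push_cast; rfl
      rw [← hDr] at this
      have e1 : (2:ℝ)^(2*p+1) = 2*(2^p)^2 := by rw [pow_succ, mul_comm 2 p, pow_mul]; ring
      have e2 : (8:ℝ)^p = (2^p)^3 := by rw [← pow_mul, mul_comm p 3, pow_mul]; norm_num
      have h0 : (0:ℝ) ≤ (1/2)^(2*p+1) := by positivity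
      have : (8*D:ℝ) ≤ 7*(4096*8^p) := by
        rw [e1] at this; rw [e2]
        push_cast at this
        set q : ℝ := 2^p
        have hq : 0 < q := by positivity
        have : 12/64*(16*q)^3*(1-(1/2)^(2*p+1)) ≤ 12/64*(16*q)^3 := by
          apply mul_le_of_le_one_right (by positivity); linarith
        nlinarith [pow_pos hq 3]
      exact_mod_cast this
    have hsub : (Finset.Ioc (k+D) (k+4096*8^p)).image (fun j : ℕ => (((j:ℤ),(0:ℤ)):Z2)) ⊆ (CL W T ω).filter (fun w => ((k+D:ℕ):ℤ) < w.1) := by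
      intro w hw
      simp only [Finset.mem_image, Finset.mem_Ioc] at hw
      obtain ⟨j,hj,rfl⟩ := hw
      rw [Finset.mem_filter]
      exact ⟨h3.left j _ hj.2 h2, by simp only; omega⟩
    have := Finset.card_le_card hsub
    rw [Finset.card_image_of_injective _ (fun a b h => by simpa using h), Nat.card_Ioc] at this
    refine le_trans ?_ (Nat.mul_le_mul_left 8 this)
    omega
  · have : ((16*2^p:ℕ):ℝ)^3 = 4096*8^p := by exact_mod_cast hS3
    rw [this]
    congr 1
    rw [show (2*(p:ℝ)+1) = ((2*p+1:ℕ):ℝ) by push_cast; ring, ENNReal.ofReal_natCast]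


lemma Kbound {m n r : ℝ} (hn : 0 ≤ n) (hnm : n ≤ m) (hm : 0 < m) (hr : 0 ≤ r) : 2671*r*n^2/m^2 ≤ 2671*r := by
  rw [div_le_iff₀ (by positivity)]
  have : n^2 ≤ m^2 := by gcongr
  have := mul_le_mul_of_nonneg_left this (by positivity : 0 ≤ 2671*r)
  linarith

lemma tooth_num {h r m n : ℝ} (hr : 1 ≤ r) (hh : 2^50*r ≤ h) (hn : 0 ≤ n) (hnm : n ≤ m) (hm : 0 < m) :
    -(r/h)*(h*(600000*r)/6 - 12*(2671*r*n^2)*h/m^2 - 34) + 2*(r/h)^2*(361*h^2) ≤ -(20*r^2) := by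
  have hh0 : 0 < h := by norm_num at hh; linarith
  have hh1 : 1 ≤ h := by norm_num at hh; linarith
  have hk := Kbound hn hnm hm (by linarith : 0 ≤ r)
  have e1 : 12*(2671*r*n^2)*h/m^2 = 12*h*(2671*r*n^2/m^2) := by ring
  have e2 : 2*(r/h)^2*(361*h^2) = 722*r^2 := by field_simp; norm_num
  rw [e1, e2]
  have h1 := mul_le_mul_of_nonneg_left hk (by positivity : 0 ≤ 12*h)
  have hhr : 1 ≤ h*r := by nlinarith
  have h2 : 60000*(h*r) ≤ h*(600000*r)/6 - 12*h*(2671*r*n^2/m^2) - 34 := by nlinarith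
  have h3 := mul_le_mul_of_nonneg_left h2 (by positivity : 0 ≤ r/h)
  have h4 : r/h*(60000*(h*r)) = 60000*r^2 := by field_simp
  rw [h4] at h3
  nlinarith

lemma vol_num {d r m n v : ℝ} (hr : 1 ≤ r) (hd : 2^51*r ≤ d) (hn : 0 ≤ n) (hnm : n ≤ m) (hm : 0 < m) (hv : d^3/2^36 ≤ v) :
    -(1/2^43)*(v*(1-2*(1/2^43)) - 2*(2671*r*n^2)*d^2/m^2 - 6*d) + 20*(1/2^43)^2*d^3 ≤ -(20*r^2) := by
  have hd1 : 1 ≤ d := by norm_num at hd; linarith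
  have hk := Kbound hn hnm hm (by linarith : 0 ≤ r)
  have e1 : 2*(2671*r*n^2)*d^2/m^2 = 2*d^2*(2671*r*n^2/m^2) := by ring
  rw [e1]
  have h1 := mul_le_mul_of_nonneg_left hk (by positivity : 0 ≤ 2*d^2)
  have h2 : 6*d ≤ 6*(r*d^2) := by
    have : d ≤ d^2 := by nlinarith
    nlinarith
  have h3 : 2^51*(r*d^2) ≤ d^3 := by
    have := mul_le_mul_of_nonneg_right hd (by positivity : 0 ≤ d^2)
    nlinarith
  have h4 : r^2 ≤ r*d^2 := by
    have : d ≤ d^2 := by nlinarith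
    have : r ≤ d^2 := by norm_num at hd; linarith
    nlinarith
  have h5 : d^3 ≤ 2^36*v := by rw [div_le_iff₀ (by norm_num)] at hv; linarith
  have h6 : 2^90*r^2 ≤ d^3 := by
    have hr0 : 0 ≤ r := by linarith
    calc (2:ℝ)^90*r^2 ≤ 2^90*(r^2*r) := by nlinarith [sq_nonneg r]
      _ ≤ 2^153*r^3 := by nlinarith [pow_nonneg hr0 3]
      _ = (2^51*r)^3 := by ring
      _ ≤ d^3 := by gcongr
  norm_num at h3 h5 h6 ⊢
  nlinarith

lemma tip_num {R r : ℝ} (p : ℕ) (hR : 2^46*r ≤ R) (hr : 1 ≤ r) (hp : (p:ℝ) ≤ R) :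
    (2*p+1)*Real.exp (-(3*R^2/8192)) ≤ Real.exp (-(20*r^2)) := by
  have h1 : 2*(p:ℝ)+1 ≤ Real.exp (2*R) := by
    have := Real.add_one_le_exp (2*R); linarith
  refine (mul_le_mul_of_nonneg_right h1 (Real.exp_pos _).le).trans ?_
  rw [← Real.exp_add]
  apply Real.exp_le_exp.2
  norm_num at hR
  have : 70368744177664*r*R ≤ R*R := by
    apply mul_le_mul_of_nonneg_right hR; linarith
  have : 70368744177664*r*(70368744177664*r) ≤ 70368744177664*r*R := by
    apply mul_le_mul_of_nonneg_left hR; positivity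
  have : R ≤ r*R := by nlinarith
  nlinarith

lemma bad_pos {Ω : Type*} [MeasurableSpace Ω] {P : Measure Ω} {W : ℕ → ℕ → Ω → Z2} (hW : IsIIDCombWalks P W)
    (m n n' r T : ℕ) (hr : 1 ≤ r) (hm : m = n + 2^51*r) (hn1 : 1 ≤ n') (hn : n' ≤ n)
    (hT : ((T+1:ℕ):ℝ) ≤ 4/9*(n':ℝ)^3 + 2671*r*(n:ℝ)^2) (x0 y0 : ℕ) :
    P {ω | DF n' ⊆ CL W T ω ∧ CL W T ω ⊆ DF m ∧ CL W (T+1) ω = insert (((x0:ℤ),(y0:ℤ)):Z2) (CL W T ω) ∧ (((x0:ℤ),(y0:ℤ)):Z2) ∉ DF m}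
      ≤ ENNReal.ofReal (2*Real.exp (-(20*(r:ℝ)^2))) := by
  have hrr : (1:ℝ) ≤ r := by exact_mod_cast hr
  have hmr : (m:ℝ) = n + 2^51*r := by rw [hm]; push_cast; ring
  have hnr : (1:ℝ) ≤ n := by exact_mod_cast hn1.trans hn
  have hn'r : (n':ℝ) ≤ n := by exact_mod_cast hn
  have hnm : (n:ℝ) ≤ m := by rw [hmr]; linarith [show (0:ℝ) ≤ 2^51*r by positivity]
  have hm0 : (0:ℝ) < m := by linarith
  have hmono : ∀ ω, CL W T ω ⊆ DF m → ∀ i ≤ T, CL W i ω ⊆ DF m := fun ω h i hi => (clF_mono _ hi).trans h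
  have hgood := iid_good hW
  by_cases hx : x0 + 2^50*r ≤ m
  · obtain ⟨h, hh⟩ : ∃ h, x0 + h = m := ⟨m-x0, by omega⟩
    have hhb : 2^50*r ≤ h := by omega
    have hhbr : (2:ℝ)^50*r ≤ h := by exact_mod_cast hhb
    have hh0 : (0:ℝ) < h := lt_of_lt_of_le (by positivity) hhbr
    have h0 := outer_tooth hW m n' h (T+1) x0 (by omega) (by omega) (by omega) hn1 (by omega) (r/h) (by positivity)
      (by rw [div_le_iff₀ hh0]; norm_num at hhbr; linarith) (2671*r*(n:ℝ)^2) hT (by positivity) (600000*r) (by positivity)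
      (by norm_num at hhbr; linarith) (by rw [hmr]; norm_num; linarith)
    refine le_trans (measure_mono_ae ?_) (h0.trans (ENNReal.ofReal_le_ofReal ?_))
    · filter_upwards [hgood] with ω hg
      rintro ⟨h1,h2,h3,h4⟩
      have hpc : PClosed (CL W (T+1) ω) := clF_pclosed hg _
      have hz : (((x0:ℤ),(y0:ℤ)):Z2) ∈ CL W (T+1) ω := by rw [h3]; exact Finset.mem_insert_self _ _
      have hy : LL h ≤ y0 := by
        by_contra hlt
        apply h4
        rw [mem_DF']
        rw [abs_of_nonneg (by omega : (0:ℤ) ≤ x0)]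
        refine ⟨by omega, ?_⟩
        have := (LL_lt h y0).1 (by rw [abs_of_nonneg (by omega)]; omega)
        rwa [show (m:ℤ)-x0 = h by omega]
      have hl := hpc.down x0 (LL h) y0 hy hz
      have hnot : (((x0:ℤ),((LL h:ℕ):ℤ)):Z2) ∉ DF m := by
        rw [mem_DF', abs_of_nonneg (by omega : (0:ℤ) ≤ x0), show (m:ℤ)-x0 = h by omega, ← LL_lt, abs_of_nonneg (by omega)]
        omega
      have he : (((x0:ℤ),((LL h:ℕ):ℤ)):Z2) = ((x0:ℤ),(y0:ℤ)) := by
        rw [h3, Finset.mem_insert] at hl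
        rcases hl with hl | hl
        · exact hl
        · exact absurd (h2 hl) hnot
      refine ⟨⟨hl, ?_, ?_⟩, fun i hi => hmono ω h2 i (by omega)⟩
      · rw [h3]; exact h1.trans (Finset.subset_insert _ _)
      · rw [h3, he]; exact Finset.insert_subset_insert _ h2
    · have := Real.exp_le_exp.2 (tooth_num hrr hhbr (by linarith) hnm hm0)
      have := Real.exp_pos (-(20*(r:ℝ)^2))
      linarith
  · obtain ⟨d, hd⟩ : ∃ d, n' + d = m := ⟨m-n', by omega⟩
    have hdb : 2^51*r ≤ d := by omega
    have hdbr : (2:ℝ)^51*r ≤ d := by exact_mod_cast hdb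
    set p := Nat.log 8 (d/8192) with hp
    have hq1 : 8^p ≤ d/8192 := Nat.pow_log_le_self 8 (by omega)
    have hq2 : d/8192 < 8^(p+1) := Nat.lt_pow_succ_log_self (by norm_num) _
    rw [pow_succ] at hq2
    have hR2 : 2*(4096*8^p) ≤ d := by omega
    have hR16 : d ≤ 16*(4096*8^p) := by omega
    have hR16r : (d:ℝ) ≤ 16*(4096*8^p) := by exact_mod_cast hR16
    have hvr : (d:ℝ)^3/2^36 ≤ ((64^p*(4096*8^p):ℕ):ℝ) := by
      rw [div_le_iff₀ (by norm_num)]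
      calc (d:ℝ)^3 ≤ (16*(4096*8^p))^3 := by gcongr
        _ = ((8*8:ℝ)^p)*(8^p)*2^48 := by rw [mul_pow (8:ℝ) 8 p]; ring
        _ = _ := by push_cast; norm_num; ring
    have h1 := outer_volume hW m n' d T hd hn1 (by omega) (1/2^43) (by norm_num) (by norm_num) (2671*r*(n:ℝ)^2)
      (by push_cast at hT; linarith) (by positivity) ((64^p*(4096*8^p):ℕ):ℝ)
    have h2 := tip hW p n' T
    have h3 : Real.exp (-(20*(r:ℝ)^2)) + Real.exp (-(20*(r:ℝ)^2)) = 2*Real.exp (-(20*(r:ℝ)^2)) := by ring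
    rw [← h3, ENNReal.ofReal_add (Real.exp_pos _).le (Real.exp_pos _).le]
    have h1' := h1.trans (ENNReal.ofReal_le_ofReal (Real.exp_le_exp.2 (vol_num hrr hdbr (by linarith) hnm hm0 hvr)))
    have h2' := h2.trans (ENNReal.ofReal_le_ofReal (tip_num p (by norm_num at hdbr ⊢; linarith) hrr (by
      have : p < 8^p := Nat.lt_pow_self (by norm_num)
      have : p ≤ 4096*8^p := by omega
      exact_mod_cast this)))
    refine le_trans (measure_mono_ae ?_) ((measure_union_le _ _).trans (add_le_add h1' h2'))
    filter_upwards [hgood] with ω hg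
    rintro ⟨a1,a2,a3,a4⟩
    by_cases hV : 64^p*(4096*8^p) ≤ ((CL W T ω).filter (fun w => (n':ℤ) ≤ w.1)).card
    · left
      exact ⟨⟨a1,a2,by exact_mod_cast hV⟩, fun i hi => hmono ω a2 i hi.le⟩
    · right
      have hpc : PClosed (CL W (T+1) ω) := clF_pclosed hg _
      have hz : (((x0:ℤ),(y0:ℤ)):Z2) ∈ CL W (T+1) ω := by rw [a3]; exact Finset.mem_insert_self _ _
      have hl := hpc.left (n'+4096*8^p) x0 (by omega) (hpc.axis hz)
      rw [a3, Finset.mem_insert] at hl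
      refine ⟨?_, ?_, clF_pclosed hg _⟩
      · refine le_trans (Finset.card_le_card ?_) (not_le.1 hV).le
        intro w; simp only [Finset.mem_filter]; intro hw; exact ⟨hw.1, by omega⟩
      · rcases hl with hl | hl
        · exfalso
          simp only [Prod.mk.injEq] at hl
          omega
        · exact hl

lemma bad_any {Ω : Type*} [MeasurableSpace Ω] {P : Measure Ω} {W : ℕ → ℕ → Ω → Z2} (hW : IsIIDCombWalks P W)
    (m n n' r T : ℕ) (hr : 1 ≤ r) (hm : m = n + 2^51*r) (hn1 : 1 ≤ n') (hn : n' ≤ n)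
    (hT : ((T+1:ℕ):ℝ) ≤ 4/9*(n':ℝ)^3 + 2671*r*(n:ℝ)^2) (z : Z2) :
    P {ω | DF n' ⊆ CL W T ω ∧ CL W T ω ⊆ DF m ∧ CL W (T+1) ω = insert z (CL W T ω) ∧ z ∉ DF m}
      ≤ ENNReal.ofReal (2*Real.exp (-(20*(r:ℝ)^2))) := by
  obtain ⟨σ, hσ, hz, -, habs⟩ := exists_refl z
  have hDF : ∀ k w, σ.symm w ∈ DF k ↔ w ∈ DF k := by
    rintro k w
    have h := habs (σ.symm w)
    rw [σ.apply_symm_apply] at h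
    obtain ⟨x,y⟩ := w
    rw [show σ.symm (x,y) = ((σ.symm (x,y)).1, (σ.symm (x,y)).2) from rfl, mem_DF', mem_DF', ← h.1, ← h.2]
  have hb := bad_pos (refl_iid hW hσ) m n n' r T hr hm hn1 hn hT z.1.natAbs z.2.natAbs
  refine le_trans (measure_mono ?_) hb
  have hz' : ((((z.1.natAbs:ℕ):ℤ),((z.2.natAbs:ℕ):ℤ)):Z2) = σ z := by rw [hz]; simp
  rw [hz']
  rintro ω ⟨h1,h2,h3,h4⟩
  refine ⟨?_, ?_, ?_, ?_⟩
  · intro w hw; rw [refl_CL_mem]; exact h1 ((hDF _ _).2 hw)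
  · intro w hw; rw [refl_CL_mem] at hw; exact (hDF _ _).1 (h2 hw)
  · rw [refl_CL, refl_CL, h3, Finset.map_insert]; rfl
  · intro hw; apply h4; rw [← hDF, σ.symm_apply_apply] at hw; exact hw


lemma rr_le (n : ℕ) (hn : 25000000 ≤ n) : 2000*rr n + 1 ≤ n := by
  have hnr : (25000000:ℝ) ≤ n := by exact_mod_cast hn
  set s := Real.sqrt n with hs
  have hss : s^2 = n := Real.sq_sqrt (by positivity)
  have hs5 : 5000 ≤ s := by
    apply Real.le_sqrt_of_sq_le; linarith
  have hlog : Real.log n ≤ 2*s := by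
    rw [← hss, Real.log_pow]
    have := Real.log_le_sub_one_of_pos (by linarith : 0 < s)
    push_cast; linarith
  have hl0 : 0 ≤ Real.log n := Real.log_natCast_nonneg n
  have h1 : Real.sqrt (Real.log n) ≤ 2*s+1 := by
    apply Real.sqrt_le_iff.2
    constructor <;> nlinarith
  have h2 : (rr n:ℝ) < Real.sqrt (Real.log n) + 1 := Nat.ceil_lt_add_one (Real.sqrt_nonneg _)
  have : (2000*rr n + 1:ℝ) ≤ n := by rw [← hss]; nlinarith
  exact_mod_cast this

lemma DF_succ_of_parent {m : ℕ} {z : Z2} (h : parent z ∈ DF m) : z ∈ DF (m+1) := by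
  obtain ⟨x,y⟩ := z
  unfold parent at h
  simp only at h
  split_ifs at h with h0
  · subst h0
    rw [mem_DF'] at h ⊢
    have h1 : |x| ≤ |x - x.sign| + 1 := by
      rcases lt_trichotomy x 0 with hx | rfl | hx
      · rw [Int.sign_eq_neg_one_of_neg hx, abs_of_neg hx, abs_of_nonpos (by omega)]; omega
      · simp
      · rw [Int.sign_eq_one_of_pos hx, abs_of_pos hx, abs_of_nonneg (by omega)]; omega
    refine ⟨by push_cast; omega, ?_⟩
    simp only [abs_zero, mul_zero]
    apply pow_pos
    push_cast; omega
  · rw [mem_DF'] at h ⊢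
    have h1 : |y| = |y - y.sign| + 1 := by
      rcases lt_or_gt_of_ne h0 with hx | hx
      · rw [Int.sign_eq_neg_one_of_neg hx, abs_of_neg hx, abs_of_nonpos (by omega)]; omega
      · rw [Int.sign_eq_one_of_pos hx, abs_of_pos hx, abs_of_nonneg (by omega)]; omega
    refine ⟨by push_cast; omega, ?_⟩
    rw [h1]
    push_cast
    nlinarith [h.1, h.2]

noncomputable def badSet {Ω : Type*} (W : ℕ → ℕ → Ω → Z2) (n : ℕ) (q : ℕ × ℕ × Z2) : Set Ω :=
  {ω | ((q.2.1+1:ℕ):ℝ) ≤ 4/9*(q.1:ℝ)^3 + 2671*(rr n:ℝ)*(n:ℝ)^2 ∧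
    (DF q.1 ⊆ CL W q.2.1 ω ∧ CL W q.2.1 ω ⊆ DF (n+2^51*rr n) ∧ CL W (q.2.1+1) ω = insert q.2.2 (CL W q.2.1 ω) ∧ q.2.2 ∉ DF (n+2^51*rr n))}

noncomputable def badIdx (n : ℕ) : Finset (ℕ × ℕ × Z2) :=
  Finset.Icc 1 n ×ˢ Finset.range (DF n).card ×ˢ DF (n+2^51*rr n+1)

lemma bad_total {Ω : Type*} [MeasurableSpace Ω] {P : Measure Ω} {W : ℕ → ℕ → Ω → Z2} (hW : IsIIDCombWalks P W)
    (n : ℕ) (hn : 25000000 ≤ n) :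
    P (⋃ q ∈ badIdx n, badSet W n q) ≤ ENNReal.ofReal (2^161/(n:ℝ)^2) := by
  have hr := rr_le n hn
  have hrp := rr_pos n (by omega)
  have h1 : ∀ q ∈ badIdx n, P (badSet W n q) ≤ ENNReal.ofReal (2*Real.exp (-(20*(rr n:ℝ)^2))) := by
    rintro ⟨n',T,z⟩ hq
    simp only [badIdx, Finset.mem_product, Finset.mem_Icc, Finset.mem_range] at hq
    by_cases hT : ((T+1:ℕ):ℝ) ≤ 4/9*(n':ℝ)^3 + 2671*(rr n:ℝ)*(n:ℝ)^2
    · refine le_trans (measure_mono ?_) (bad_any hW (n+2^51*rr n) n n' (rr n) T hrp rfl hq.1.1 hq.1.2 hT z)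
      rintro ω ⟨_,h⟩; exact h
    · have : badSet W n (n',T,z) = ∅ := by
        ext ω; simp only [badSet, Set.mem_ofPred_eq, Set.mem_empty_iff_false, iff_false]
        rintro ⟨h,_⟩; exact hT h
      rw [this]; simp
  refine (measure_biUnion_finset_le _ _).trans ((Finset.sum_le_sum h1).trans ?_)
  rw [Finset.sum_const, nsmul_eq_mul, ← ENNReal.ofReal_natCast, ← ENNReal.ofReal_mul (by positivity)]
  apply ENNReal.ofReal_le_ofReal
  have hn0 : (25000000:ℝ) ≤ n := by exact_mod_cast hn
  have hnp : (0:ℝ) < n := by linarith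
  have hexp : Real.exp (-(20*(rr n:ℝ)^2)) ≤ 1/(n:ℝ)^20 := by
    refine (exp_rr n (by omega) 20 (by norm_num)).trans (le_of_eq ?_)
    rw [Real.rpow_neg hnp.le, show (20:ℝ) = ((20:ℕ):ℝ) by norm_num, Real.rpow_natCast, one_div]
  have hc1 : ((DF n).card:ℝ) ≤ 4*(n:ℝ)^3 := by
    refine (card_DF_bounds n (by omega)).2.trans ?_
    nlinarith [pow_pos hnp 3, pow_pos hnp 2]
  set M := n+2^51*rr n+1 with hM
  have hMn : (M:ℝ) ≤ 2^52*n := by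
    have : M ≤ 2^52*n := by omega
    exact_mod_cast this
  have hM1 : (1:ℝ) ≤ M := by exact_mod_cast (by omega : 1 ≤ M)
  have hc2 : ((DF M).card:ℝ) ≤ 4*(2^52*n)^3 := by
    refine (card_DF_bounds M (by omega)).2.trans ?_
    have : (M:ℝ) ≤ (M:ℝ)^3 := by nlinarith [sq_nonneg ((M:ℝ))]
    have : (M:ℝ)^3 ≤ (2^52*n)^3 := by gcongr
    linarith
  have hcard : ((badIdx n).card:ℝ) ≤ n*(4*(n:ℝ)^3*(4*(2^52*n)^3)) := by
    unfold badIdx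
    rw [Finset.card_product, Finset.card_product, Finset.card_range, Nat.card_Icc, Nat.add_sub_cancel, ← hM]
    push_cast
    gcongr
  calc ((badIdx n).card:ℝ) * (2*Real.exp (-(20*(rr n:ℝ)^2))) ≤ n*(4*(n:ℝ)^3*(4*(2^52*n)^3)) * (2*(1/(n:ℝ)^20)) := by gcongr
    _ = 2^161/(n:ℝ)^13 := by field_simp; norm_num
    _ ≤ 2^161/(n:ℝ)^2 := by
      gcongr
      · linarith
      · norm_num

lemma finite_DF (B : Finset Z2) : ∃ N : ℕ, ∀ n, N ≤ n → B ⊆ DF n := by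
  classical
  refine ⟨∑ z ∈ B, (z.1.natAbs + 3*z.2.natAbs + 1), fun n hn => ?_⟩
  rintro ⟨x,y⟩ hz
  have h := Finset.single_le_sum (f := fun z : Z2 => z.1.natAbs + 3*z.2.natAbs + 1) (fun _ _ => Nat.zero_le _) hz
  simp only at h
  rw [mem_DF', Int.abs_eq_natAbs, Int.abs_eq_natAbs]
  refine ⟨by omega, ?_⟩
  have : (3*y.natAbs:ℤ) + 1 ≤ (n:ℤ) - x.natAbs := by omega
  nlinarith

theorem outer_ae {Ω : Type*} [MeasurableSpace Ω] {P : Measure Ω} {W : ℕ → ℕ → Ω → Z2} (hW : IsIIDCombWalks P W) :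
    ∀ᵐ ω ∂P, ∃ N : ℕ, ∀ n, N ≤ n → CL W (DF n).card ω ⊆ DF (n+2^51*rr n) := by
  have hbc := bc (P := P) (fun n => ⋃ q ∈ badIdx n, badSet W n q) 25000000 (2^161) (by norm_num) (fun n hn => bad_total hW n hn)
  filter_upwards [hbc, inner_ae hW, iid_good hW] with ω ⟨N1,hN1⟩ ⟨N2,hN2⟩ hg
  set N0 := max N2 25000000 with hN0
  obtain ⟨N3,hN3⟩ := finite_DF (CL W (DF N0).card ω)
  refine ⟨max (max N1 N0) N3, fun n hn => ?_⟩
  have hn1 : N1 ≤ n := (le_max_left _ _).trans ((le_max_left _ _).trans hn)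
  have hn0 : N0 ≤ n := (le_max_right _ _).trans ((le_max_left _ _).trans hn)
  have hn3 : N3 ≤ n := (le_max_right _ _).trans hn
  have hN02 : N2 ≤ N0 := le_max_left _ _
  have hN05 : 25000000 ≤ N0 := le_max_right _ _
  by_contra hcon
  apply hN1 n hn1
  set m := n+2^51*rr n with hm
  have hmono : ∀ {i j : ℕ}, i ≤ j → CL W i ω ⊆ CL W j ω := fun h => clF_mono _ h
  classical
  have hex : ∃ t, ¬ CL W t ω ⊆ DF m := ⟨_, hcon⟩
  obtain ⟨t, ht, htmin⟩ : ∃ t, (¬ CL W t ω ⊆ DF m) ∧ ∀ i < t, CL W i ω ⊆ DF m :=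
    ⟨Nat.find hex, Nat.find_spec hex, fun i hi => not_not.1 (Nat.find_min hex hi)⟩
  have ht0 : t ≠ 0 := by
    rintro rfl; apply ht; unfold CL clF; simp
  obtain ⟨T, rfl⟩ := Nat.exists_eq_succ_of_ne_zero ht0
  have hTd : T+1 ≤ (DF n).card := by
    by_contra h; exact hcon (htmin _ (not_le.1 h))
  have hTN : (DF N0).card < T+1 := by
    by_contra h
    exact ht ((hmono (not_lt.1 h)).trans ((hN3 n hn3).trans (DF_mono (by omega))))
  have hexk : ∃ k, T+1 ≤ (DF k).card := ⟨n, hTd⟩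
  obtain ⟨n1, hk, hkmin⟩ : ∃ k, T+1 ≤ (DF k).card ∧ ∀ i < k, (DF i).card < T+1 :=
    ⟨Nat.find hexk, Nat.find_spec hexk, fun i hi => not_le.1 (Nat.find_min hexk hi)⟩
  have hn1n : n1 ≤ n := by
    by_contra h; have := hkmin n (not_le.1 h); omega
  have hn1N : N0 < n1 := by
    by_contra h
    have := Finset.card_le_card (DF_mono (not_lt.1 h))
    omega
  obtain ⟨q, rfl⟩ : ∃ q, n1 = q+1 := ⟨n1-1, by omega⟩
  have hqT : (DF q).card ≤ T := by have := hkmin q (by omega); omega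
  have hrq := rr_le q (by omega)
  have hrqn : rr q ≤ rr n := rr_mono (by omega) (by omega)
  have hin := hN2 q (by omega)
  obtain ⟨n', hn'⟩ : ∃ n', n' + 2000*rr q = q := ⟨q - 2000*rr q, by omega⟩
  rw [show q - 2000*rr q = n' by omega] at hin
  set z : Z2 := settlePoint (clF (fun i t => W i t ω) T) (W T · ω) with hz
  have hins : CL W (T+1) ω = insert z (CL W T ω) := rfl
  have hsub := htmin T (Nat.lt_succ_self T)
  have hzm : z ∉ DF m := by
    intro h; apply ht
    show CL W (T+1) ω ⊆ _
    rw [hins]; exact Finset.insert_subset h hsub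
  have hm1 : 1 ≤ m := by omega
  have hz1 : z ∈ DF (m+1) := by
    have hpc : PClosed (CL W (T+1) ω) := clF_pclosed hg _
    have hz0 : z ≠ (0,0) := by
      intro h; apply hzm; rw [h, mem_DF']; simp only [abs_zero]
      refine ⟨by omega, ?_⟩
      have : (1:ℤ) ≤ m := by omega
      nlinarith
    have hp := hpc z (by rw [hins]; exact Finset.mem_insert_self _ _) hz0
    rw [hins, Finset.mem_insert] at hp
    rcases hp with hp | hp
    · exfalso
      obtain ⟨x,y⟩ := z
      unfold parent at hp
      simp only at hp
      split_ifs at hp with h0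
      · subst h0
        simp only [Prod.mk.injEq, sub_eq_self, Int.sign_eq_zero_iff_zero, and_true] at hp
        subst hp; exact hz0 rfl
      · simp only [Prod.mk.injEq, sub_eq_self, Int.sign_eq_zero_iff_zero, true_and] at hp
        exact h0 hp
    · exact DF_succ_of_parent (hsub hp)
  refine Set.mem_iUnion₂.2 ⟨(n',T,z), ?_, ?_, ?_, hsub, hins, hzm⟩
  · simp only [badIdx, Finset.mem_product, Finset.mem_Icc, Finset.mem_range]
    exact ⟨⟨by omega, by omega⟩, by omega, hz1⟩
  · simp only
    have hd := (card_DF_bounds (q+1) (by omega)).2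
    have hk' : ((T+1:ℕ):ℝ) ≤ ((DF (q+1)).card:ℝ) := by exact_mod_cast hk
    refine hk'.trans (hd.trans ?_)
    have hrp : (1:ℝ) ≤ rr n := by exact_mod_cast rr_pos n (by omega)
    have e1 : ((q+1:ℕ):ℝ) = n' + 2000*rr q + 1 := by
      have : (q:ℝ) = n' + 2000*rr q := by exact_mod_cast hn'.symm
      push_cast; linarith
    have e2 : ((q+1:ℕ):ℝ) ≤ n := by exact_mod_cast hn1n
    have e3 : (rr q:ℝ) ≤ rr n := by exact_mod_cast hrqn
    set A : ℝ := ((q+1:ℕ):ℝ)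
    set r : ℝ := (rr n:ℝ)
    have hA1 : 1 ≤ A := by rw [e1]; linarith [show (0:ℝ) ≤ n' by positivity, show (0:ℝ) ≤ rr q by positivity]
    have hn'0 : (0:ℝ) ≤ n' := by positivity
    have hn'A : (n':ℝ) ≤ A := by rw [e1]; linarith [show (0:ℝ) ≤ rr q by positivity]
    have e4 : A - n' ≤ 2001*r := by rw [e1]; linarith
    have e5 : A^3 - (n':ℝ)^3 = (A-n')*(A^2+A*n'+n'^2) := by ring
    have e6 : A^2+A*n'+(n':ℝ)^2 ≤ 3*(n:ℝ)^2 := by nlinarith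
    have e7 : (A-n')*(A^2+A*n'+(n':ℝ)^2) ≤ 2001*r*(3*(n:ℝ)^2) :=
      mul_le_mul e4 e6 (by positivity) (by linarith)
    have e8 : A ≤ r*(n:ℝ)^2 := by
      have : A ≤ (n:ℝ)^2 := by nlinarith
      nlinarith [sq_nonneg (n:ℝ)]
    nlinarith
  · exact hin.trans (hmono hqT)

lemma combD_mono {ρ ρ' : ℝ} (h : ρ ≤ ρ') : combD ρ ⊆ combD ρ' := by
  rintro z ⟨h1,h2⟩
  refine ⟨by linarith, h2.trans_le ?_⟩
  gcongr

/-- **Theorem (fluctuations for internal DLA on the comb).**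
There is a positive constant `a` such that with probability 1, for all `n` large
enough, `𝒟(n − a√(log n)) ⊆ A(n) ⊆ 𝒟(n + a√(log n))`. -/
theorem comb_idla_fluctuations :
    ∃ a : ℝ, 0 < a ∧
      ∀ (Ω : Type*) [MeasurableSpace Ω] (P : Measure Ω) (W : ℕ → ℕ → Ω → ℤ × ℤ),
        IsIIDCombWalks P W →
        ∀ᵐ ω ∂P, ∃ N : ℕ, ∀ n : ℕ, N ≤ n →
          combD ((n : ℝ) - a * Real.sqrt (Real.log n)) ⊆
              dlaCluster (fun i t => W i t ω) ((combD n).ncard) ∧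
            dlaCluster (fun i t => W i t ω) ((combD n).ncard) ⊆
              combD ((n : ℝ) + a * Real.sqrt (Real.log n)) := by
  refine ⟨2^52, by norm_num, fun Ω _ P W hW => ?_⟩
  filter_upwards [inner_ae hW, outer_ae hW] with ω ⟨N1,h1⟩ ⟨N2,h2⟩
  refine ⟨max (max N1 N2) 3, fun n hn => ?_⟩
  have hn3 : 3 ≤ n := (le_max_right _ _).trans hn
  have hs : 1 ≤ Real.sqrt (Real.log n) := by
    rw [Real.one_le_sqrt, Real.le_log_iff_exp_le (by positivity)]
    have : (3:ℝ) ≤ n := by exact_mod_cast hn3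
    have := Real.exp_one_lt_d9
    linarith
  have hr : (rr n:ℝ) ≤ 2*Real.sqrt (Real.log n) := by
    have : (rr n:ℝ) < Real.sqrt (Real.log n) + 1 := Nat.ceil_lt_add_one (Real.sqrt_nonneg _)
    linarith
  rw [combD_eq n, Set.ncard_coe_finset, clF_eq]
  constructor
  · have := h1 n ((le_max_left _ _).trans ((le_max_left _ _).trans hn))
    refine Set.Subset.trans ?_ (Finset.coe_subset.2 this)
    rw [← combD_eq]
    apply combD_mono
    have h3 : (n:ℝ) ≤ ((n-2000*rr n:ℕ):ℝ) + 2000*rr n := by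
      exact_mod_cast (by omega : n ≤ (n-2000*rr n) + 2000*rr n)
    norm_num; linarith
  · have := h2 n ((le_max_right _ _).trans ((le_max_left _ _).trans hn))
    refine Set.Subset.trans (Finset.coe_subset.2 this) ?_
    rw [← combD_eq]
    apply combD_mono
    push_cast; norm_num; linarith
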